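/- arXiv:1606.04294 — 2 statements merged into one kernel-verified Lean document; each statement's English description precedes it below -/
import Mathlib

section
/- Let m > 1, let A₁,…,A_m be n×n invertible real matrices such that A_i − A_j is invertible for i ≠ j, let 0 ≤ α < n, and let T_α be the integral operator T_α f(x) = ∫_{ℝⁿ} |x−A₁y|^{−α₁} ⋯ |x−A_m y|^{−α_m} f(y) dy with α₁,…,α_m > 0 and α₁+⋯+α_m = n − α. Suppose p : ℝⁿ → (0,∞) satisfies the local log-Hölder condition and the log-Hölder condition at infinity, 0 < p₋ ≤ p₊ < n/α, and p(A_i x) = p(x) for all x ∈ ℝⁿ and 1 ≤ i ≤ m. Define q by 1/q(x) = 1/p(x) − α/n. Then T_α extends to a bounded operator from H^{p(·)}(ℝⁿ) to L^{q(·)}(ℝⁿ): there is a constant C such that ‖T_α f‖_{q(·)} ≤ C ‖f‖_{H^{p(·)}} for all f ∈ H^{p(·)}(ℝⁿ). -/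
open MeasureTheory ENNReal

noncomputable section

abbrev Rn (n : ℕ) := EuclideanSpace ℝ (Fin n)

/-- The variable exponent Lebesgue quasinorm of an `ℝ≥0∞`-valued function. -/
def varLpNormE {n : ℕ} (p : Rn n → ℝ) (g : Rn n → ℝ≥0∞) : ℝ≥0∞ :=
  sInf {l : ℝ≥0∞ | ∃ lam : ℝ, 0 < lam ∧ l = ENNReal.ofReal lam ∧
    (∫⁻ x, (g x / ENNReal.ofReal lam) ^ (p x)) ≤ 1}

/-- The variable exponent Lebesgue quasinorm `‖f‖_{p(·)}`. -/
def varLpNorm {n : ℕ} (p : Rn n → ℝ) (f : Rn n → ℝ) : ℝ≥0∞ :=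
  varLpNormE p (fun x => ENNReal.ofReal |f x|)

/-- The local log-Hölder continuity condition. -/
def LogHolderLocal {n : ℕ} (p : Rn n → ℝ) : Prop :=
  ∃ c > 0, ∀ x y : Rn n, ‖x - y‖ < 1/2 → |p x - p y| ≤ c / (-Real.log ‖x - y‖)

/-- The log-Hölder condition at infinity. -/
def LogHolderInfty {n : ℕ} (p : Rn n → ℝ) : Prop :=
  ∃ C > 0, ∃ pinf : ℝ, ∀ x : Rn n, |p x - pinf| ≤ C / Real.log (Real.exp 1 + ‖x‖)

/-- The (closed) cube centered at `z` with side length `r`. -/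
def cube {n : ℕ} (z : Rn n) (r : ℝ) : Set (Rn n) := {x | ∀ i, |x i - z i| ≤ r / 2}

/-- The characteristic function of the cube `Q(z,r)`. -/
def cubeInd {n : ℕ} (z : Rn n) (r : ℝ) : Rn n → ℝ := Set.indicator (cube z r) 1

/-- The fractional maximal operator `M_β`. -/
def fracMax {n : ℕ} (β : ℝ) (f : Rn n → ℝ) (x : Rn n) : ℝ :=
  ⨆ (z : Rn n) (r : ℝ) (_ : 0 < r) (_ : x ∈ cube z r),
    (volume (cube z r)).toReal ^ (β / (n : ℝ) - 1) * ∫ y in cube z r, |f y|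

/-- `p̲ = min (p₋, 1)`. -/
def pUnder {n : ℕ} (p : Rn n → ℝ) : ℝ := min (⨅ x, p x) 1

/-- The quantity `𝒜({λ_j},{Q_j},p(·))`. -/
def AFun {n : ℕ} (p : Rn n → ℝ) (lam : ℕ → ℝ) (z : ℕ → Rn n) (r : ℕ → ℝ) : ℝ≥0∞ :=
  varLpNorm p (fun x =>
    (∑' j, (lam j * cubeInd (z j) (r j) x /
        (varLpNorm p (cubeInd (z j) (r j))).toReal) ^ pUnder p) ^ (1 / pUnder p))

/-- `d_{p(·)} = min {ℓ ∈ ℕ : p₋ (n + ℓ + 1) > n}` where `t` plays the role of `p₋`. -/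
def dIndex (n : ℕ) (t : ℝ) : ℕ := sInf {l : ℕ | t * (n + l + 1) > n}

/-- `p₋`, the essential lower bound of the exponent. -/
def pLow {n : ℕ} (p : Rn n → ℝ) : ℝ := ⨅ x, p x

/-- A `(p(·), p₀, d)`-atom supported in the cube `Q(z,r)`. -/
structure IsPAtom {n : ℕ} (p : Rn n → ℝ) (p₀ : ℝ) (d : ℕ) (a : Rn n → ℝ)
    (z : Rn n) (r : ℝ) : Prop where
  measurable : Measurable a
  support : ∀ x, x ∉ cube z r → a x = 0
  size : eLpNorm a (ENNReal.ofReal p₀) volume ≤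
    ENNReal.ofReal ((volume (cube z r)).toReal ^ (1 / p₀)) / varLpNorm p (cubeInd z r)
  moments : ∀ γ : Fin n → ℕ, (∑ i, γ i) ≤ d → ∫ x, a x * ∏ i, x i ^ γ i = 0

/-- Action of an `n × n` matrix on `ℝⁿ`. -/
def mApp {n : ℕ} (A : Matrix (Fin n) (Fin n) ℝ) (x : Rn n) : Rn n :=
  Matrix.toEuclideanLin A x

/-- The operator norm of a matrix acting on Euclidean space. -/
def opNorm {n : ℕ} (A : Matrix (Fin n) (Fin n) ℝ) : ℝ :=
  ‖Matrix.toEuclideanCLM (𝕜 := ℝ) A‖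

/-- The kernel `k(x,y) = |x - A₁ y|^{-α₁} ⋯ |x - A_m y|^{-α_m}`. -/
def kern {n m : ℕ} (A : Fin m → Matrix (Fin n) (Fin n) ℝ) (αe : Fin m → ℝ)
    (x y : Rn n) : ℝ :=
  ∏ i, ‖x - mApp (A i) y‖ ^ (-(αe i))

/-- The fractional type integral operator `T_α`. -/
def Tα {n m : ℕ} (A : Fin m → Matrix (Fin n) (Fin n) ℝ) (αe : Fin m → ℝ)
    (f : Rn n → ℝ) (x : Rn n) : ℝ :=
  ∫ y, kern A αe x y * f y

/-- The Riesz potential `I_α`. -/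
def riesz {n : ℕ} (α : ℝ) (f : Rn n → ℝ) (x : Rn n) : ℝ :=
  ∫ y, ‖x - y‖ ^ (α - (n : ℝ)) * f y

/-- Partial derivative in the `i`-th coordinate direction. -/
def pderiv1 {n : ℕ} (i : Fin n) (g : Rn n → ℝ) : Rn n → ℝ :=
  fun x => fderiv ℝ g x (EuclideanSpace.single i 1)

/-- The multiindex partial derivative `∂^γ`. -/
def mderiv {n : ℕ} (γ : Fin n → ℕ) (g : Rn n → ℝ) : Rn n → ℝ :=
  (List.finRange n).foldr (fun i h => (pderiv1 i)^[γ i] h) g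

/-- The finite set of multiindices `γ` with `|γ| ≤ N`. -/
def multiIndices (n N : ℕ) : Finset (Fin n → ℕ) :=
  (Fintype.piFinset fun _ => Finset.range (N+1)).filter (fun γ => (∑ i, γ i) ≤ N)

/-- The family `F_N` of normalized Schwartz test functions. -/
def FN (n N : ℕ) : Set (SchwartzMap (Rn n) ℝ) :=
  {φ | (∑ γ ∈ multiIndices n N, ⨆ x : Rn n, (1 + ‖x‖) ^ N * |mderiv γ (⇑φ) x|) ≤ 1}

/-- The grand maximal function `𝓜 f`. -/
def grandMax (n N : ℕ) (f : Rn n → ℝ) (x : Rn n) : ℝ≥0∞ :=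
  ⨆ (t : ℝ) (_ : 0 < t) (φ : FN n N),
    ENNReal.ofReal |∫ y, t ^ (-(n : ℝ)) * (φ : SchwartzMap (Rn n) ℝ) (t⁻¹ • (x - y)) * f y|

/-- The variable Hardy space quasinorm `‖f‖_{H^{p(·)}}` (with parameter `N`). -/
def hardyNorm {n : ℕ} (p : Rn n → ℝ) (N : ℕ) (f : Rn n → ℝ) : ℝ≥0∞ :=
  varLpNormE p (grandMax n N f)

/-- `γ! = γ₁! ⋯ γ_n!`. -/
def mfact {n : ℕ} (γ : Fin n → ℕ) : ℕ := ∏ i, (γ i).factorial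

/-- The degree-`d` Taylor polynomial of `g` at `z`, evaluated at `y`. -/
def taylorPoly {n : ℕ} (d : ℕ) (g : Rn n → ℝ) (z y : Rn n) : ℝ :=
  ∑ γ ∈ multiIndices n d, (mderiv γ g z / (mfact γ : ℝ)) * ∏ i, (y i - z i) ^ γ i

end
open MeasureTheory ENNReal

open scoped ContDiff in
def BRep {n : ℕ} {P : Type} [NormedAddCommGroup P] [NormedSpace ℝ P] (K : Set P) (R : ℝ)
    (g : ℝ → P → Rn n → ℝ) : Prop :=
  ∃ Ψ : P × Rn n → ℝ, ContDiff ℝ ∞ Ψ ∧ (∀ c p, g c p = fun y => c * Ψ (p, y)) ∧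
    ∀ p ∈ K, ∀ y, R < ‖y‖ → Ψ (p, y) = 0

open scoped ContDiff in
lemma BRep.step {n : ℕ} {P : Type} [NormedAddCommGroup P] [NormedSpace ℝ P] {K : Set P} {R : ℝ}
    {g : ℝ → P → Rn n → ℝ} (h : BRep K R g) (i : Fin n) :
    BRep K R (fun c p => pderiv1 i (g c p)) := by
  obtain ⟨Ψ, h1, h2, h3⟩ := h
  have hd : ∀ p y, HasFDerivAt (fun y => Ψ (p, y))
      ((fderiv ℝ Ψ (p, y)).comp (ContinuousLinearMap.inr ℝ P (Rn n))) y := by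
    intro p y
    have h4 : HasFDerivAt Ψ (fderiv ℝ Ψ (p, y)) (p, y) :=
      (h1.differentiable (by simp)).differentiableAt.hasFDerivAt
    exact h4.comp y (hasFDerivAt_prodMk_right p y)
  refine ⟨fun x => fderiv ℝ Ψ x (0, EuclideanSpace.single i 1), ?_, ?_, ?_⟩
  · exact (h1.fderiv_right (m := ∞) (by simp)).clm_apply contDiff_const
  · intro c p
    funext y
    simp only [h2, pderiv1]
    rw [((hd p y).const_mul c).fderiv]
    simp
  · intro p hp y hy
    have h5 : (fun y => Ψ (p, y)) =ᶠ[nhds y] fun _ => 0 := by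
      filter_upwards [(isOpen_lt continuous_const continuous_norm).mem_nhds hy] with z hz
      exact h3 p hp z hz
    have h6 := h5.fderiv_eq (𝕜 := ℝ)
    rw [(hd p y).fderiv] at h6
    have h7 := congrArg (fun L => L (EuclideanSpace.single i (1:ℝ))) h6
    simpa using h7

lemma BRep.mderiv {n : ℕ} {P : Type} [NormedAddCommGroup P] [NormedSpace ℝ P] {K : Set P} {R : ℝ}
    {g : ℝ → P → Rn n → ℝ} (h : BRep K R g) (γ : Fin n → ℕ) :
    BRep K R (fun c p => mderiv γ (g c p)) := by
  unfold _root_.mderiv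
  induction (List.finRange n) with
  | nil => simpa using h
  | cons i l ih =>
    simp only [List.foldr_cons]
    induction (γ i) with
    | zero => simpa using ih
    | succ k ihk =>
      simp only [Function.iterate_succ_apply']
      exact ihk.step i

/-- compactly supported version of the grand maximal function -/
noncomputable def cMax (n N : ℕ) (f : Rn n → ℝ) (x : Rn n) : ℝ≥0∞ :=
  ⨆ (t : ℝ) (_ : 0 < t) (φ : FN n N) (_ : HasCompactSupport (φ : SchwartzMap (Rn n) ℝ)),
    ENNReal.ofReal |∫ y, t ^ (-(n : ℝ)) * (φ : SchwartzMap (Rn n) ℝ) (t⁻¹ • (x - y)) * f y|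

lemma cMax_le (n N : ℕ) (f : Rn n → ℝ) (x : Rn n) : cMax n N f x ≤ grandMax n N f x := by
  unfold cMax grandMax
  gcongr with t ht φ
  exact iSup_le fun _ => le_rfl

lemma cMax_measurable (n N : ℕ) (f : Rn n → ℝ) (hf : LocallyIntegrable f) :
    Measurable (cMax n N f) := by
  apply LowerSemicontinuous.measurable
  unfold cMax
  refine lowerSemicontinuous_iSup fun t => lowerSemicontinuous_iSup fun ht =>
    lowerSemicontinuous_iSup fun φ => lowerSemicontinuous_iSup fun hφ => ?_
  apply Continuous.lowerSemicontinuous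
  refine ENNReal.continuous_ofReal.comp (continuous_abs.comp ?_)
  set ψ : Rn n → ℝ := fun v => t ^ (-(n : ℝ)) * (φ : SchwartzMap (Rn n) ℝ) (t⁻¹ • v) with hψ
  have hc : Continuous ψ := by
    have := (φ : SchwartzMap (Rn n) ℝ).continuous
    fun_prop
  have hs : HasCompactSupport ψ := by
    have : HasCompactSupport fun v : Rn n => (φ : SchwartzMap (Rn n) ℝ) (t⁻¹ • v) :=
      hφ.comp_homeomorph (Homeomorph.smulOfNeZero (t⁻¹) (inv_ne_zero ht.ne'))
    exact this.mul_left
  have h := HasCompactSupport.continuous_convolution_right (ContinuousLinearMap.mul ℝ ℝ) hs hf hc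
  convert h using 1
  funext x
  rw [MeasureTheory.convolution_def]
  congr 1
  funext y
  simp [hψ]
  ring

open scoped ContDiff in
lemma bump_bound {n : ℕ} (N : ℕ) {P : Type} [NormedAddCommGroup P] [NormedSpace ℝ P]
    (K : Set P) (hK : IsCompact K) (Φ : P × Rn n → ℝ) (hΦ : ContDiff ℝ ∞ Φ) (R : ℝ)
    (hR : ∀ p ∈ K, ∀ y, R < ‖y‖ → Φ (p, y) = 0) (L : ℝ) :
    ∃ C : ℝ, 0 < C ∧ ∀ f : Rn n → ℝ, ∀ p ∈ K, ∀ (c z : Rn n) (ρ : ℝ), 0 < ρ →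
      ‖z - c‖ ≤ L * ρ →
      ENNReal.ofReal |∫ y, Φ (p, ρ⁻¹ • (y - c)) * f y| ≤
        ENNReal.ofReal (C * ρ ^ n) * cMax n N f z := by
  set K' : Set (P × Rn n) := K ×ˢ Metric.closedBall 0 L with hK'
  have hcK' : IsCompact K' := hK.prod (isCompact_closedBall _ _)
  set Θ : (P × Rn n) × Rn n → ℝ := fun x => Φ (x.1.1, x.1.2 - x.2) with hΘ
  have hΘs : ContDiff ℝ ∞ Θ := by
    apply hΦ.comp
    fun_prop
  have hΘ0 : ∀ q ∈ K', ∀ y, R + L < ‖y‖ → Θ (q, y) = 0 := by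
    rintro ⟨p, b⟩ ⟨hp, hb⟩ y hy
    apply hR p hp
    simp only [Metric.mem_closedBall, dist_zero_right] at hb
    have := norm_sub_norm_le y b
    rw [norm_sub_rev] at this
    simp only
    linarith
  have hrep : BRep K' (R + L) (fun c q y => c * Θ (q, y)) := ⟨Θ, hΘs, fun _ _ => rfl, hΘ0⟩
  have hB : ∀ γ : Fin n → ℕ, ∃ B : ℝ, 0 ≤ B ∧ ∀ c : ℝ, 0 ≤ c → ∀ q ∈ K', ∀ y,
      (1 + ‖y‖) ^ N * |mderiv γ (fun y => c * Θ (q, y)) y| ≤ c * B := by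
    intro γ
    obtain ⟨Ψ, h1, h2, h3⟩ := hrep.mderiv γ
    have hcomp : IsCompact (K' ×ˢ Metric.closedBall (0 : Rn n) (R + L)) :=
      hcK'.prod (isCompact_closedBall _ _)
    obtain ⟨B, hB⟩ := hcomp.exists_bound_of_continuousOn
      (f := fun x : (P × Rn n) × Rn n => (1 + ‖x.2‖) ^ N * |Ψ x|)
      (by have := h1.continuous; exact Continuous.continuousOn (by fun_prop))
    refine ⟨max B 0, le_max_right _ _, ?_⟩
    intro c hc q hq y
    beta_reduce at h2
    rw [h2 c q]
    by_cases hy : R + L < ‖y‖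
    · simp only [h3 q hq y hy]
      simp only [mul_zero, abs_zero]
      positivity
    · have := hB (q, y) ⟨hq, by simpa using hy⟩
      have h4 : (1 + ‖y‖) ^ N * |Ψ (q, y)| ≤ max B 0 :=
        (le_abs_self _).trans (this.trans (le_max_left _ _))
      rw [abs_mul, abs_of_nonneg hc]
      nlinarith
  choose B hB0 hB using hB
  set S : ℝ := 1 + ∑ γ ∈ multiIndices n N, B γ with hS
  have hSpos : 0 < S := by
    have : 0 ≤ ∑ γ ∈ multiIndices n N, B γ := Finset.sum_nonneg fun γ _ => hB0 γ
    linarith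
  refine ⟨S, hSpos, ?_⟩
  intro f p hp c z ρ hρ hz
  set b : Rn n := ρ⁻¹ • (z - c) with hb
  have hbK : (p, b) ∈ K' := by
    refine ⟨hp, ?_⟩
    simp only [Metric.mem_closedBall, dist_zero_right, hb, norm_smul, norm_inv, Real.norm_eq_abs,
      abs_of_pos hρ]
    rw [inv_mul_le_iff₀ hρ]
    linarith
  have hsm : ContDiff ℝ ∞ (fun y => S⁻¹ * Θ ((p, b), y)) := by fun_prop
  have hcs : HasCompactSupport (fun y => S⁻¹ * Θ ((p, b), y)) := by
    apply HasCompactSupport.of_support_subset_isCompact (isCompact_closedBall (0 : Rn n) (R + L))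
    intro y hy
    by_contra hcon
    simp only [Metric.mem_closedBall, dist_zero_right, not_le] at hcon
    apply hy
    simp only [hΘ0 _ hbK y hcon, mul_zero]
  let φ : SchwartzMap (Rn n) ℝ := hcs.toSchwartzMap hsm
  have hφ : ∀ y, φ y = S⁻¹ * Θ ((p, b), y) := fun y => rfl
  have hφ' : (⇑φ) = (fun y => S⁻¹ * Θ ((p, b), y)) := rfl
  have hφN : φ ∈ FN n N := by
    simp only [FN, Set.mem_ofPred_eq, hφ']
    calc _ ≤ ∑ γ ∈ multiIndices n N, S⁻¹ * B γ := by
          apply Finset.sum_le_sum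
          intro γ _
          exact ciSup_le fun y => hB γ S⁻¹ (by positivity) _ hbK y
      _ ≤ 1 := by
          rw [← Finset.mul_sum, inv_mul_le_iff₀ hSpos]
          linarith
  have key : ENNReal.ofReal |∫ y, ρ ^ (-(n : ℝ)) * φ (ρ⁻¹ • (z - y)) * f y| ≤ cMax n N f z := by
    unfold cMax
    exact le_iSup_of_le ρ (le_iSup_of_le hρ (le_iSup_of_le ⟨φ, hφN⟩ (le_iSup_of_le hcs le_rfl)))
  have heq : ∫ y, Φ (p, ρ⁻¹ • (y - c)) * f y =
      (S * ρ ^ n) * ∫ y, ρ ^ (-(n : ℝ)) * φ (ρ⁻¹ • (z - y)) * f y := by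
    rw [← integral_const_mul]
    congr 1
    funext y
    rw [hφ]
    have h8 : b - ρ⁻¹ • (z - y) = ρ⁻¹ • (y - c) := by
      rw [hb, ← smul_sub]; congr 1; abel
    simp only [hΘ, h8]
    rw [Real.rpow_neg hρ.le, Real.rpow_natCast]
    field_simp
  rw [heq, abs_mul, abs_of_pos (by positivity), ENNReal.ofReal_mul (by positivity)]
  gcongr

open MeasureTheory ENNReal

open scoped ContDiff in
lemma exists_smooth_pow {n : ℕ} (δ : ℝ) (hδ : 0 < δ) (a : ℝ) :
    ∃ g : Rn n → ℝ, ContDiff ℝ ∞ g ∧ ∀ v, δ ≤ ‖v‖ → g v = ‖v‖ ^ (-a) := by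
  refine ⟨fun v => Real.smoothTransition (2 * ‖v‖ ^ 2 / δ ^ 2 - 1) * (‖v‖ ^ 2) ^ (-a / 2), ?_, ?_⟩
  · rw [contDiff_iff_contDiffAt]
    intro v
    have h1 : ContDiff ℝ ∞ fun v : Rn n => ‖v‖ ^ 2 := contDiff_norm_sq ℝ
    have h2 : ContDiff ℝ ∞ fun v : Rn n => Real.smoothTransition (2 * ‖v‖ ^ 2 / δ ^ 2 - 1) := by
      apply Real.smoothTransition.contDiff.comp
      fun_prop
    by_cases hv : v = 0
    · have : (fun v : Rn n => Real.smoothTransition (2 * ‖v‖ ^ 2 / δ ^ 2 - 1) *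
          (‖v‖ ^ 2) ^ (-a / 2)) =ᶠ[nhds v] fun _ => 0 := by
        have hopen : IsOpen {v : Rn n | 2 * ‖v‖ ^ 2 / δ ^ 2 - 1 < 0} :=
          isOpen_lt (by fun_prop) continuous_const
        filter_upwards [hopen.mem_nhds (by simp [hv])] with w hw
        rw [Real.smoothTransition.zero_of_nonpos (le_of_lt hw), zero_mul]
      exact contDiffAt_const.congr_of_eventuallyEq this
    · apply h2.contDiffAt.mul
      apply ContDiffAt.rpow h1.contDiffAt contDiffAt_const
      simpa using hv
  · intro v hv
    have : 1 ≤ 2 * ‖v‖ ^ 2 / δ ^ 2 - 1 := by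
      have : 1 ≤ ‖v‖ ^ 2 / δ ^ 2 := by
        rw [le_div_iff₀ (by positivity), one_mul]
        gcongr
      have h3 : 2 * ‖v‖ ^ 2 / δ ^ 2 = 2 * (‖v‖ ^ 2 / δ ^ 2) := by ring
      linarith
    simp only
    rw [Real.smoothTransition.one_of_one_le this, one_mul, ← Real.rpow_natCast,
      ← Real.rpow_mul (norm_nonneg _)]
    congr 1
    push_cast
    ring

open scoped ContDiff in
lemma piece {n m : ℕ} (N : ℕ) (a : Fin m → (Rn n ≃L[ℝ] Rn n)) (αe : Fin m → ℝ)
    (cut : Rn n × Rn n → ℝ) (hcut : ContDiff ℝ ∞ cut) (R : ℝ)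
    (hR : ∀ b, ‖b‖ ≤ 1 → ∀ w, R < ‖w‖ → cut (b, w) = 0) (L M δ : ℝ) (hδ : 0 < δ) :
    ∃ C : ℝ, 0 < C ∧ ∀ f : Rn n → ℝ, ∀ b c x : Rn n, ∀ ρ : ℝ, ∀ τ : Fin m → ℝ,
      ‖b‖ ≤ 1 → 0 < ρ → (∀ l, 0 < τ l) → (∀ l, ‖x - a l c‖ ≤ M * τ l) → (∀ l, ρ ≤ M * τ l) →
      (∀ w l, cut (b, w) ≠ 0 → δ * τ l ≤ ‖x - a l (c + ρ • w)‖) →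
      ∀ z, ‖z - c‖ ≤ L * ρ →
      ENNReal.ofReal |∫ y, (∏ l, ‖x - a l y‖ ^ (-(αe l))) * cut (b, ρ⁻¹ • (y - c)) * f y| ≤
        ENNReal.ofReal (C * (∏ l, τ l ^ (-(αe l))) * ρ ^ n) * cMax n N f z := by
  choose g hg1 hg2 using fun l => exists_smooth_pow (n := n) δ hδ (αe l)
  set K : Set (Rn n × ((Fin m → Rn n) × (Fin m → ℝ))) := Metric.closedBall 0 (max 1 M) with hK
  set Φ' : (Rn n × ((Fin m → Rn n) × (Fin m → ℝ))) × Rn n → ℝ := fun X =>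
    cut (X.1.1, X.2) * ∏ l, g l (X.1.2.1 l - X.1.2.2 l • a l X.2) with hΦ'
  have hs : ContDiff ℝ ∞ Φ' := by
    apply ContDiff.mul
    · exact hcut.comp (by fun_prop)
    · apply contDiff_prod
      intro l _
      apply (hg1 l).comp
      fun_prop
  set K' : Set (Rn n × ((Fin m → Rn n) × (Fin m → ℝ))) := {X ∈ K | ‖X.1‖ ≤ 1} with hK'
  have hcK : IsCompact K' := by
    have : IsClosed {X : Rn n × ((Fin m → Rn n) × (Fin m → ℝ)) | ‖X.1‖ ≤ 1} :=
      isClosed_le (by fun_prop) continuous_const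
    exact (isCompact_closedBall _ _).inter_right this
  obtain ⟨C, hC, hb⟩ := bump_bound N K' hcK Φ' hs R
    (by
      rintro X ⟨_, hX⟩ y hy
      simp only [hΦ']
      rw [hR _ hX y hy, zero_mul]) L
  refine ⟨C, hC, ?_⟩
  intro f b c x ρ τ hb1 hρ hτ h1 h2 h3 z hz
  set X : Rn n × ((Fin m → Rn n) × (Fin m → ℝ)) :=
    (b, (fun l => (τ l)⁻¹ • (x - a l c)), (fun l => ρ / τ l)) with hX
  have hXK : X ∈ K' := by
    refine ⟨?_, hb1⟩
    simp only [hK, Metric.mem_closedBall, dist_zero_right, hX, Prod.norm_def]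
    refine max_le (hb1.trans (le_max_left _ _)) (max_le ?_ ?_)
    · rw [pi_norm_le_iff_of_nonneg (by positivity)]
      intro l
      rw [norm_smul, norm_inv, Real.norm_eq_abs, abs_of_pos (hτ l), inv_mul_le_iff₀ (hτ l)]
      have := h1 l
      have h4 : M * τ l ≤ τ l * max 1 M := by
        rw [mul_comm]; gcongr; exact (hτ l).le; exact le_max_right _ _
      linarith
    · rw [pi_norm_le_iff_of_nonneg (by positivity)]
      intro l
      rw [Real.norm_eq_abs, abs_of_pos (div_pos hρ (hτ l)), div_le_iff₀ (hτ l)]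
      have h4 : M * τ l ≤ max 1 M * τ l := by
        gcongr; exact (hτ l).le; exact le_max_right _ _
      linarith [h2 l]
  have h5 := hb f X hXK c z ρ hρ hz
  have h6 : (∫ y, (∏ l, ‖x - a l y‖ ^ (-(αe l))) * cut (b, ρ⁻¹ • (y - c)) * f y) =
      (∏ l, τ l ^ (-(αe l))) * ∫ y, Φ' (X, ρ⁻¹ • (y - c)) * f y := by
    rw [← integral_const_mul]
    congr 1
    funext y
    rw [← mul_assoc]
    congr 1
    set w := ρ⁻¹ • (y - c) with hw
    have hy : y = c + ρ • w := by
      rw [hw, smul_smul, mul_inv_cancel₀ hρ.ne', one_smul]; abel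
    by_cases h0 : cut (b, w) = 0
    · simp [hΦ', hX, h0]
    have h7 : ∀ l, ‖x - a l y‖ ^ (-(αe l)) =
        τ l ^ (-(αe l)) * g l ((τ l)⁻¹ • (x - a l c) - (ρ / τ l) • a l w) := by
      intro l
      have h8 : (τ l)⁻¹ • (x - a l c) - (ρ / τ l) • a l w = (τ l)⁻¹ • (x - a l y) := by
        have h11 : x - a l y = (x - a l c) - ρ • a l w := by
          have h12 : ρ • w = y - c := by
            rw [hw, smul_smul, mul_inv_cancel₀ hρ.ne', one_smul]
          rw [← map_smul, h12, map_sub]; abel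
        rw [h11, smul_sub _ (x - a l c), smul_smul]
        congr 2
        ring
      have h9 : ‖x - a l y‖ = τ l * ‖(τ l)⁻¹ • (x - a l y)‖ := by
        rw [norm_smul, norm_inv, Real.norm_eq_abs, abs_of_pos (hτ l), mul_inv_cancel_left₀ (hτ l).ne']
      have h10 := h3 w l h0
      rw [← hy] at h10
      rw [h8, hg2 l]
      · rw [h9, Real.mul_rpow (hτ l).le (norm_nonneg _)]
      · rw [norm_smul, norm_inv, Real.norm_eq_abs, abs_of_pos (hτ l), inv_mul_eq_div,
          le_div_iff₀ (hτ l)]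
        exact h10
    simp only [hΦ', hX]
    rw [Finset.prod_congr rfl fun l _ => h7 l, Finset.prod_mul_distrib]
    ring
  rw [h6, abs_mul, abs_of_nonneg (Finset.prod_nonneg fun l _ => Real.rpow_nonneg (hτ l).le _),
    ENNReal.ofReal_mul (Finset.prod_nonneg fun l _ => Real.rpow_nonneg (hτ l).le _)]
  calc _ ≤ ENNReal.ofReal (∏ l, τ l ^ (-(αe l))) * (ENNReal.ofReal (C * ρ ^ n) * cMax n N f z) := by
        gcongr
    _ = _ := by
        rw [← mul_assoc, ← ENNReal.ofReal_mul (Finset.prod_nonneg fun l _ => Real.rpow_nonneg (hτ l).le _)]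
        congr 2
        ring

open MeasureTheory ENNReal

noncomputable def chi {n : ℕ} (w : Rn n) : ℝ := Real.smoothTransition (2 - ‖w‖ ^ 2)
noncomputable def psi {n : ℕ} (w : Rn n) : ℝ := chi w - chi ((2 : ℝ) • w)

open scoped ContDiff in
lemma chi_contDiff {n : ℕ} : ContDiff ℝ ∞ (chi (n := n)) := by
  have h1 : ContDiff ℝ ∞ fun v : Rn n => ‖v‖ ^ 2 := contDiff_norm_sq ℝ
  apply Real.smoothTransition.contDiff.comp
  fun_prop

open scoped ContDiff in
lemma psi_contDiff {n : ℕ} : ContDiff ℝ ∞ (psi (n := n)) := by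
  apply chi_contDiff.sub
  exact chi_contDiff.comp (by fun_prop)

lemma chi_nonneg {n : ℕ} (w : Rn n) : 0 ≤ chi w := Real.smoothTransition.nonneg _
lemma chi_le_one {n : ℕ} (w : Rn n) : chi w ≤ 1 := Real.smoothTransition.le_one _
lemma chi_one {n : ℕ} {w : Rn n} (h : ‖w‖ ≤ 1) : chi w = 1 := by
  apply Real.smoothTransition.one_of_one_le
  nlinarith [norm_nonneg w]
lemma chi_zero {n : ℕ} {w : Rn n} (h : 2 ≤ ‖w‖) : chi w = 0 := by
  apply Real.smoothTransition.zero_of_nonpos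
  nlinarith [norm_nonneg w]
lemma psi_supp {n : ℕ} {w : Rn n} (h : psi w ≠ 0) : 1 / 2 ≤ ‖w‖ ∧ ‖w‖ ≤ 2 := by
  constructor
  · by_contra hc
    push Not at hc
    apply h
    unfold psi
    rw [chi_one (by linarith), chi_one, sub_self]
    rw [norm_smul]; norm_num; linarith
  · by_contra hc
    push Not at hc
    apply h
    unfold psi
    rw [chi_zero (by linarith), chi_zero, sub_self]
    rw [norm_smul]; norm_num; linarith

noncomputable def midcut {n m : ℕ} (a : Fin m → (Rn n ≃L[ℝ] Rn n)) (c C : ℝ)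
    (X : Rn n × Rn n) : ℝ :=
  chi (C⁻¹ • X.2) - ∑ i, chi (c⁻¹ • (X.2 - (a i).symm X.1))

open scoped ContDiff in
lemma midcut_contDiff {n m : ℕ} (a : Fin m → (Rn n ≃L[ℝ] Rn n)) (c C : ℝ) :
    ContDiff ℝ ∞ (midcut a c C) := by
  unfold midcut
  apply ContDiff.sub
  · exact chi_contDiff.comp (by fun_prop)
  · apply ContDiff.sum
    intro i _
    exact chi_contDiff.comp (by fun_prop)

lemma near_piece {n m : ℕ} (N : ℕ) (a : Fin m → (Rn n ≃L[ℝ] Rn n)) (αe : Fin m → ℝ)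
    (M d c : ℝ) (hM : 1 ≤ M) (hMa : ∀ i v, ‖a i v‖ ≤ M * ‖v‖)
    (hMs : ∀ i v, ‖(a i).symm v‖ ≤ M * ‖v‖)
    (hd : ∀ i l, i ≠ l → ∀ x, d * ‖x‖ ≤ ‖(a i).symm x - (a l).symm x‖)
    (hc : 0 < c) (hc1 : c ≤ 1 / 4) (hc2 : 5 * c ≤ d) :
    ∃ C : ℝ, 0 < C ∧ ∀ f : Rn n → ℝ, ∀ x, x ≠ 0 → ∀ i (r : ℝ), 0 < r → r ≤ c →
      ∀ z, ‖z - (a i).symm x‖ ≤ r * ‖x‖ →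
      ENNReal.ofReal |∫ y, (∏ l, ‖x - a l y‖ ^ (-(αe l))) *
        psi ((r * ‖x‖)⁻¹ • (y - (a i).symm x)) * f y| ≤
        ENNReal.ofReal (C * (r ^ (-αe i) * ‖x‖ ^ (-(∑ l, αe l))) * (r * ‖x‖) ^ n) *
          cMax n N f z := by
  have hlow : ∀ i v, ‖v‖ ≤ M * ‖a i v‖ := fun i v => by
    have := hMs i (a i v); simpa using this
  obtain ⟨C, hC, hp⟩ := piece N a αe (fun X => psi X.2) (psi_contDiff.comp (by fun_prop)) 2
    (by
      intro b _ w hw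
      by_contra h
      linarith [(psi_supp h).2]) 1 (1 + M ^ 2) (c / M) (by positivity)
  refine ⟨C, hC, ?_⟩
  intro f x hx i r hr hrc z hz
  have hT : 0 < ‖x‖ := norm_pos_iff.2 hx
  have hprod : (∏ l, (if l = i then r * ‖x‖ else ‖x‖) ^ (-(αe l))) =
      r ^ (-αe i) * ‖x‖ ^ (-(∑ l, αe l)) := by
    have h1 : ∀ l, (if l = i then r * ‖x‖ else ‖x‖) ^ (-(αe l)) =
        (if l = i then r ^ (-αe i) else 1) * ‖x‖ ^ (-αe l) := by
      intro l
      split_ifs with h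
      · rw [h, Real.mul_rpow hr.le hT.le]
      · rw [one_mul]
    rw [Finset.prod_congr rfl fun l _ => h1 l, Finset.prod_mul_distrib]
    congr 1
    · simp
    · rw [← Finset.sum_neg_distrib, ← Real.rpow_sum_of_pos hT]
  have h := hp f 0 ((a i).symm x) x (r * ‖x‖) (fun l => if l = i then r * ‖x‖ else ‖x‖)
    (by simp) (by positivity) (by intro l; split_ifs <;> positivity) ?_ ?_ ?_ z (by simpa using hz)
  · rw [hprod] at h
    exact h
  · intro l
    split_ifs with h
    · subst h
      simp only [ContinuousLinearEquiv.apply_symm_apply, sub_self, norm_zero]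
      positivity
    · calc _ ≤ ‖x‖ + ‖a l ((a i).symm x)‖ := norm_sub_le _ _
        _ ≤ ‖x‖ + M * (M * ‖x‖) := by
            gcongr
            exact (hMa _ _).trans (by gcongr; exact hMs _ _)
        _ = _ := by ring
  · intro l
    split_ifs with h
    · nlinarith [mul_pos hr hT, sq_nonneg M]
    · have : r ≤ 1 + M ^ 2 := by nlinarith [sq_nonneg M]
      gcongr
  · intro w l hw
    obtain ⟨hw1, hw2⟩ := psi_supp hw
    split_ifs with h
    · subst h
      rw [map_add, ContinuousLinearEquiv.apply_symm_apply, sub_add_cancel_left, norm_neg, map_smul,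
        norm_smul, Real.norm_eq_abs, abs_of_pos (by positivity)]
      have h1 := hlow l w
      have h2 : c / M ≤ ‖a l w‖ := by
        rw [div_le_iff₀ (by linarith)]
        linarith
      rw [mul_comm]
      gcongr
    · have h1 := hlow l ((a l).symm x - ((a i).symm x + (r * ‖x‖) • w))
      rw [map_sub, ContinuousLinearEquiv.apply_symm_apply] at h1
      have h2 := hd l i h x
      have h3 : ‖(a l).symm x - (a i).symm x‖ ≤
          ‖(a l).symm x - ((a i).symm x + (r * ‖x‖) • w)‖ + ‖(r * ‖x‖) • w‖ := by
        have := norm_add_le ((a l).symm x - ((a i).symm x + (r * ‖x‖) • w)) ((r * ‖x‖) • w)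
        rwa [show (a l).symm x - ((a i).symm x + (r * ‖x‖) • w) + (r * ‖x‖) • w =
          (a l).symm x - (a i).symm x by abel] at this
      rw [norm_smul, Real.norm_eq_abs, abs_of_pos (by positivity : 0 < r * ‖x‖)] at h3
      have h4 : r * ‖x‖ * ‖w‖ ≤ c * ‖x‖ * 2 := by gcongr
      have h5 : 5 * c * ‖x‖ ≤ d * ‖x‖ := by gcongr
      have h6 : 0 < c * ‖x‖ := by positivity
      rw [div_mul_eq_mul_div, div_le_iff₀ (by linarith), mul_comm _ M]
      linarith

lemma far_piece {n m : ℕ} (N : ℕ) (a : Fin m → (Rn n ≃L[ℝ] Rn n)) (αe : Fin m → ℝ)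
    (M : ℝ) (hM : 1 ≤ M) (hMs : ∀ i v, ‖(a i).symm v‖ ≤ M * ‖v‖) :
    ∃ C : ℝ, 0 < C ∧ ∀ f : Rn n → ℝ, ∀ x, x ≠ 0 → ∀ ρ : ℝ, 6 * M * ‖x‖ ≤ ρ →
      ∀ z, ‖z‖ ≤ 2 * ρ →
      ENNReal.ofReal |∫ y, (∏ l, ‖x - a l y‖ ^ (-(αe l))) *
        psi (ρ⁻¹ • y) * f y| ≤
        ENNReal.ofReal (C * ρ ^ (-(∑ l, αe l)) * ρ ^ n) * cMax n N f z := by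
  have hlow : ∀ i v, ‖v‖ ≤ M * ‖a i v‖ := fun i v => by
    have := hMs i (a i v); simpa using this
  obtain ⟨C, hC, hp⟩ := piece N a αe (fun X => psi X.2) (psi_contDiff.comp (by fun_prop)) 2
    (by
      intro b _ w hw
      by_contra h
      linarith [(psi_supp h).2]) 2 1 (1 / (3 * M)) (by positivity)
  refine ⟨C, hC, ?_⟩
  intro f x hx ρ hρ z hz
  have hT : 0 < ‖x‖ := norm_pos_iff.2 hx
  have hρ0 : 0 < ρ := lt_of_lt_of_le (by positivity) hρ
  have h := hp f 0 0 x ρ (fun l => ρ)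
    (by simp) hρ0 (fun _ => hρ0) ?_ (by simp) ?_ z (by simpa using hz)
  · rw [← Real.rpow_sum_of_pos hρ0, Finset.sum_neg_distrib] at h
    simpa using h
  · intro l
    simp only [map_zero, sub_zero, one_mul]
    nlinarith
  · intro w l hw
    obtain ⟨hw1, hw2⟩ := psi_supp hw
    rw [zero_add]
    have h1 := hlow l (ρ • w)
    rw [norm_smul, Real.norm_eq_abs, abs_of_pos hρ0] at h1
    have h2 := norm_sub_norm_le (a l (ρ • w)) x
    rw [norm_sub_rev] at h2
    have h3 : ρ * (1 / 2) ≤ ρ * ‖w‖ := by gcongr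
    rw [div_mul_eq_mul_div, div_le_iff₀ (by positivity)]
    nlinarith

lemma mid_piece {n m : ℕ} (N : ℕ) (a : Fin m → (Rn n ≃L[ℝ] Rn n)) (αe : Fin m → ℝ)
    (M d c : ℝ) (hM : 1 ≤ M)
    (hMs : ∀ i v, ‖(a i).symm v‖ ≤ M * ‖v‖)
    (hd : ∀ i l, i ≠ l → ∀ x, d * ‖x‖ ≤ ‖(a i).symm x - (a l).symm x‖)
    (hc : 0 < c) (hc1 : c ≤ 1 / 4) (hc2 : 5 * c ≤ d) :
    ∃ C : ℝ, 0 < C ∧ ∀ f : Rn n → ℝ, ∀ x, x ≠ 0 →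
      ∀ z, ‖z‖ ≤ 2 * ‖x‖ →
      ENNReal.ofReal |∫ y, (∏ l, ‖x - a l y‖ ^ (-(αe l))) *
        midcut a c (3 * M) (‖x‖⁻¹ • x, ‖x‖⁻¹ • y) * f y| ≤
        ENNReal.ofReal (C * ‖x‖ ^ (-(∑ l, αe l)) * ‖x‖ ^ n) * cMax n N f z := by
  have hlow : ∀ i v, ‖v‖ ≤ M * ‖a i v‖ := fun i v => by
    have := hMs i (a i v); simpa using this
  obtain ⟨C, hC, hp⟩ := piece N a αe (midcut a c (3 * M)) (midcut_contDiff _ _ _) (6 * M)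
    (by
      intro b hb w hw
      unfold midcut
      rw [chi_zero, Finset.sum_eq_zero, sub_zero]
      · intro i _
        apply chi_zero
        dsimp only
        rw [norm_smul, norm_inv, Real.norm_eq_abs, abs_of_pos hc, inv_mul_eq_div, le_div_iff₀ hc]
        have h1 := hMs i b
        have h2 := norm_sub_norm_le w ((a i).symm b)
        nlinarith
      · dsimp only
        rw [norm_smul, norm_inv, Real.norm_eq_abs, abs_of_pos (by positivity), inv_mul_eq_div,
          le_div_iff₀ (by positivity)]
        linarith) 2 1 (c / M) (by positivity)
  refine ⟨C, hC, ?_⟩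
  intro f x hx z hz
  have hT : 0 < ‖x‖ := norm_pos_iff.2 hx
  have hb : ‖‖x‖⁻¹ • x‖ = 1 := by
    rw [norm_smul, norm_inv, norm_norm, inv_mul_cancel₀ hT.ne']
  have h := hp f (‖x‖⁻¹ • x) 0 x ‖x‖ (fun l => ‖x‖)
    hb.le hT (fun _ => hT) (by simp) (by simp) ?_ z (by simpa using hz)
  · rw [← Real.rpow_sum_of_pos hT, Finset.sum_neg_distrib] at h
    simpa using h
  · intro w l hw
    set θ := ‖x‖⁻¹ • x with hθ
    have hxθ : x = ‖x‖ • θ := by rw [hθ, smul_smul, mul_inv_cancel₀ hT.ne', one_smul]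
    have h1 : ‖x - a l (0 + ‖x‖ • w)‖ = ‖x‖ * ‖θ - a l w‖ := by
      have : x - a l (0 + ‖x‖ • w) = ‖x‖ • (θ - a l w) := by
        rw [zero_add, map_smul, smul_sub, ← hxθ]
      rw [this, norm_smul, norm_norm]
    rw [h1, mul_comm]
    gcongr
    have h2 := hlow l ((a l).symm θ - w)
    rw [map_sub, ContinuousLinearEquiv.apply_symm_apply] at h2
    rw [div_le_iff₀ (by linarith), mul_comm _ M]
    refine le_trans ?_ h2
    by_contra hcon
    push Not at hcon
    apply hw
    unfold midcut
    dsimp only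
    have h3 : ‖(a l).symm θ‖ ≤ M := by have := hMs l θ; rwa [hb, mul_one] at this
    rw [norm_sub_rev] at hcon
    rw [chi_one, Finset.sum_eq_single l, chi_one, sub_self]
    · rw [norm_smul, norm_inv, Real.norm_eq_abs, abs_of_pos hc, inv_mul_eq_div, div_le_iff₀ hc]
      linarith
    · intro i _ hi
      apply chi_zero
      rw [norm_smul, norm_inv, Real.norm_eq_abs, abs_of_pos hc, inv_mul_eq_div, le_div_iff₀ hc]
      have h4 := hd i l hi θ
      rw [hb] at h4
      have h5 := norm_sub_le (w - (a l).symm θ) (w - (a i).symm θ)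
      have h6 : (w - (a l).symm θ) - (w - (a i).symm θ) = (a i).symm θ - (a l).symm θ := by abel
      rw [h6] at h5
      linarith
    · simp
    · rw [norm_smul, norm_inv, Real.norm_eq_abs, abs_of_pos (by positivity), inv_mul_eq_div,
          div_le_iff₀ (by positivity)]
      have := norm_sub_norm_le w ((a l).symm θ)
      linarith

open MeasureTheory ENNReal

lemma X_bound {ι : Type*} (S : Set ι) (F : ι → ℝ≥0∞) (X b : ℝ≥0∞) (K w : ℝ) (hK : 0 < K) (hw : 0 < w)
    (h1 : ∀ z ∈ S, X ≤ ENNReal.ofReal (K * w) * F z)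
    (h2 : ∀ l : ℝ≥0∞, (∀ z ∈ S, l ≤ F z) → ENNReal.ofReal w * l ≤ b) :
    X ≤ ENNReal.ofReal K * b := by
  have hK' : ENNReal.ofReal K ≠ 0 := by simpa using hK
  have hw' : ENNReal.ofReal w ≠ 0 := by simpa using hw
  have h3 := h2 (X / ENNReal.ofReal (K * w)) (by
    intro z hz
    rw [mul_comm] at h1
    exact ENNReal.div_le_of_le_mul' (by rw [mul_comm K w]; exact h1 z hz))
  calc X = ENNReal.ofReal K * (ENNReal.ofReal w * (X / ENNReal.ofReal (K * w))) := by
        rw [← mul_assoc, ← ENNReal.ofReal_mul hK.le, ENNReal.mul_div_cancel]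
        · simpa using mul_pos hK hw
        · exact ENNReal.ofReal_ne_top
    _ ≤ _ := by gcongr

lemma geo_bound (s : ℝ) (hs : 0 < s) (J : ℕ) :
    ∑ j ∈ Finset.range J, ((1 / 2 : ℝ) ^ j) ^ s ≤ (1 - (1 / 2 : ℝ) ^ s)⁻¹ := by
  have h1 : (1 / 2 : ℝ) ^ s < 1 := Real.rpow_lt_one (by norm_num) (by norm_num) hs
  have h0 : 0 ≤ (1 / 2 : ℝ) ^ s := by positivity
  have : ∀ j : ℕ, ((1 / 2 : ℝ) ^ j) ^ s = ((1 / 2 : ℝ) ^ s) ^ j := by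
    intro j
    rw [← Real.rpow_natCast, ← Real.rpow_natCast, ← Real.rpow_mul (by norm_num),
      ← Real.rpow_mul (by norm_num), mul_comm]
  simp_rw [this]
  rw [← tsum_geometric_of_lt_one h0 h1]
  exact (summable_geometric_of_lt_one h0 h1).sum_le_tsum _ (fun _ _ => by positivity)

noncomputable def PJ {n m : ℕ} (a : Fin m → (Rn n ≃L[ℝ] Rn n)) (c C : ℝ) (x : Rn n) (J : ℕ)
    (y : Rn n) : ℝ :=
  midcut a c C (‖x‖⁻¹ • x, ‖x‖⁻¹ • y) +
    ∑ i, ∑ j ∈ Finset.range J, psi ((c * (1 / 2) ^ j * ‖x‖)⁻¹ • (y - (a i).symm x)) +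
    ∑ j ∈ Finset.range J, psi ((2 * C * (2 ^ j * ‖x‖))⁻¹ • y)

lemma PJ_eq {n m : ℕ} (a : Fin m → (Rn n ≃L[ℝ] Rn n)) (c C : ℝ) (hc : 0 < c) (hC : 0 < C)
    (x : Rn n) (hx : x ≠ 0) (J : ℕ) (y : Rn n) :
    PJ a c C x J y = chi ((C * (2 ^ J * ‖x‖))⁻¹ • y) -
      ∑ i, chi ((c * (1 / 2) ^ J * ‖x‖)⁻¹ • (y - (a i).symm x)) := by
  have hT : 0 < ‖x‖ := norm_pos_iff.2 hx
  unfold PJ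
  induction J with
  | zero =>
    simp only [midcut, Finset.range_zero, Finset.sum_empty, Finset.sum_const_zero, add_zero,
      pow_zero, one_mul, mul_one, mul_inv, mul_smul, smul_sub, map_smul]
  | succ J ih =>
    have h1 : ∀ i, psi ((c * (1 / 2) ^ J * ‖x‖)⁻¹ • (y - (a i).symm x)) =
        chi ((c * (1 / 2) ^ J * ‖x‖)⁻¹ • (y - (a i).symm x)) -
        chi ((c * (1 / 2) ^ (J + 1) * ‖x‖)⁻¹ • (y - (a i).symm x)) := by
      intro i
      unfold psi
      rw [smul_smul]
      congr 3
      rw [pow_succ]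
      field_simp
    have h2 : psi ((2 * C * (2 ^ J * ‖x‖))⁻¹ • y) =
        chi ((C * (2 ^ (J + 1) * ‖x‖))⁻¹ • y) - chi ((C * (2 ^ J * ‖x‖))⁻¹ • y) := by
      unfold psi
      rw [smul_smul]
      congr 3
      · congr 1
        rw [pow_succ]
        field_simp
      · field_simp
    simp only [Finset.sum_range_succ, Finset.sum_add_distrib, h1, h2, Finset.sum_sub_distrib]
    rw [Finset.sum_congr rfl fun i _ => (Finset.sum_congr rfl fun j _ => rfl)] at ih
    linarith

lemma PJ_bound {n m : ℕ} (a : Fin m → (Rn n ≃L[ℝ] Rn n)) (c C : ℝ) (hc : 0 < c) (hC : 0 < C)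
    (x : Rn n) (hx : x ≠ 0) (J : ℕ) (y : Rn n) : |PJ a c C x J y| ≤ 1 + m := by
  rw [PJ_eq a c C hc hC x hx]
  have h1 := chi_nonneg ((C * (2 ^ J * ‖x‖))⁻¹ • y)
  have h2 := chi_le_one ((C * (2 ^ J * ‖x‖))⁻¹ • y)
  have h3 : 0 ≤ ∑ i, chi ((c * (1 / 2) ^ J * ‖x‖)⁻¹ • (y - (a i).symm x)) :=
    Finset.sum_nonneg fun i _ => chi_nonneg _
  have h4 : ∑ i, chi ((c * (1 / 2) ^ J * ‖x‖)⁻¹ • (y - (a i).symm x)) ≤ ∑ i : Fin m, (1 : ℝ) :=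
    Finset.sum_le_sum fun i _ => chi_le_one _
  simp only [Finset.sum_const, Finset.card_univ, Fintype.card_fin, nsmul_eq_mul, mul_one] at h4
  rw [abs_le]
  constructor <;> linarith

lemma PJ_tendsto {n m : ℕ} (a : Fin m → (Rn n ≃L[ℝ] Rn n)) (c C : ℝ) (hc : 0 < c) (hC : 0 < C)
    (x : Rn n) (hx : x ≠ 0) (y : Rn n) (hy : ∀ i, y ≠ (a i).symm x) :
    Filter.Tendsto (fun J => PJ a c C x J y) Filter.atTop (nhds 1) := by
  have hT : 0 < ‖x‖ := norm_pos_iff.2 hx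
  have h1 : ∀ᶠ J : ℕ in Filter.atTop, chi ((C * (2 ^ J * ‖x‖))⁻¹ • y) = 1 := by
    have : Filter.Tendsto (fun J : ℕ => (2 : ℝ) ^ J) Filter.atTop Filter.atTop :=
      tendsto_pow_atTop_atTop_of_one_lt (by norm_num)
    filter_upwards [this.eventually_ge_atTop (‖y‖ / (C * ‖x‖))] with J hJ
    apply chi_one
    rw [norm_smul, norm_inv, Real.norm_eq_abs, abs_of_pos (by positivity), inv_mul_eq_div,
      div_le_iff₀ (by positivity)]
    rw [div_le_iff₀ (by positivity)] at hJ
    linarith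
  have h2 : ∀ i, ∀ᶠ J : ℕ in Filter.atTop,
      chi ((c * (1 / 2) ^ J * ‖x‖)⁻¹ • (y - (a i).symm x)) = 0 := by
    intro i
    have : Filter.Tendsto (fun J : ℕ => (1 / 2 : ℝ) ^ J) Filter.atTop (nhds 0) :=
      tendsto_pow_atTop_nhds_zero_of_lt_one (by norm_num) (by norm_num)
    have hpos : 0 < ‖y - (a i).symm x‖ / (2 * c * ‖x‖) := by
      have := norm_pos_iff.2 (sub_ne_zero.2 (hy i))
      positivity
    filter_upwards [this.eventually (gt_mem_nhds hpos)] with J hJ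
    apply chi_zero
    rw [norm_smul, norm_inv, Real.norm_eq_abs, abs_of_pos (by positivity), inv_mul_eq_div,
      le_div_iff₀ (by positivity)]
    rw [lt_div_iff₀ (by positivity)] at hJ
    linarith
  apply tendsto_const_nhds.congr'
  filter_upwards [h1, Filter.eventually_all.2 h2] with J hJ1 hJ2
  rw [PJ_eq a c C hc hC x hx, hJ1, Finset.sum_eq_zero fun i _ => hJ2 i, sub_zero]

set_option maxHeartbeats 1000000 in
lemma decomp {n m : ℕ} (hn : 0 < n) (N : ℕ) (a : Fin m → (Rn n ≃L[ℝ] Rn n)) (αe : Fin m → ℝ)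
    (d : ℝ) (hd0 : 0 < d)
    (hd : ∀ i l, i ≠ l → ∀ x, d * ‖x‖ ≤ ‖(a i).symm x - (a l).symm x‖)
    (α : ℝ) (hα : 0 ≤ α) (hsum : ∑ i, αe i = (n : ℝ) - α) (hlt : ∀ i, αe i < ∑ i, αe i) :
    ∃ C : ℝ, 0 < C ∧ ∀ f : Rn n → ℝ, ∀ x, x ≠ 0 →
      Integrable (fun y => (∏ l, ‖x - a l y‖ ^ (-(αe l))) * f y) →
      ∀ (b : Fin m → ℝ≥0∞) (h : ℕ → ℝ≥0∞),
      (∀ i (ρ : ℝ) (l : ℝ≥0∞), 0 < ρ → ρ ≤ ‖(a i).symm x‖ / 2 →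
        (∀ z, ‖z - (a i).symm x‖ ≤ ρ → l ≤ cMax n N f z) → ENNReal.ofReal (ρ ^ α) * l ≤ b i) →
      (∀ (j : ℕ) (l : ℝ≥0∞), (∀ z, ‖z‖ ≤ 2 * (2 ^ j * ‖x‖) → l ≤ cMax n N f z) →
        ENNReal.ofReal ((2 ^ j * ‖x‖) ^ α) * l ≤ h j) →
      ENNReal.ofReal |∫ y, (∏ l, ‖x - a l y‖ ^ (-(αe l))) * f y| ≤
        ENNReal.ofReal C * (∑ i, b i + ∑' j, h j) := by
  obtain ⟨M, hM, hMa, hMs⟩ : ∃ M : ℝ, 1 ≤ M ∧ (∀ i v, ‖a i v‖ ≤ M * ‖v‖) ∧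
      ∀ i v, ‖(a i).symm v‖ ≤ M * ‖v‖ := by
    have h0 : ∀ i, 0 ≤ ‖(a i : Rn n →L[ℝ] Rn n)‖ + ‖((a i).symm : Rn n →L[ℝ] Rn n)‖ :=
      fun i => by positivity
    refine ⟨1 + ∑ i, (‖(a i : Rn n →L[ℝ] Rn n)‖ + ‖((a i).symm : Rn n →L[ℝ] Rn n)‖), ?_, ?_, ?_⟩
    · have := Finset.sum_nonneg (s := Finset.univ) fun i _ => h0 i
      linarith
    · intro i v
      have h1 := Finset.single_le_sum (s := Finset.univ) (fun i _ => h0 i) (Finset.mem_univ i)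
      have h2 := (a i : Rn n →L[ℝ] Rn n).le_opNorm v
      refine h2.trans ?_
      gcongr
      have := norm_nonneg ((a i).symm : Rn n →L[ℝ] Rn n)
      linarith
    · intro i v
      have h1 := Finset.single_le_sum (s := Finset.univ) (fun i _ => h0 i) (Finset.mem_univ i)
      have h2 := ((a i).symm : Rn n →L[ℝ] Rn n).le_opNorm v
      refine h2.trans ?_
      gcongr
      have := norm_nonneg (a i : Rn n →L[ℝ] Rn n)
      linarith
  set c : ℝ := min (1 / 4) (min (d / 5) (1 / (2 * M))) with hcdef
  have hc : 0 < c := by rw [hcdef]; positivity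
  have hc1 : c ≤ 1 / 4 := min_le_left _ _
  have hc2 : 5 * c ≤ d := by
    have : c ≤ d / 5 := (min_le_right _ _).trans (min_le_left _ _)
    linarith
  have hc3 : c * (2 * M) ≤ 1 := by
    have : c ≤ 1 / (2 * M) := (min_le_right _ _).trans (min_le_right _ _)
    rwa [le_div_iff₀ (by positivity)] at this
  obtain ⟨C1, hC1, hnear⟩ := near_piece N a αe M d c hM hMa hMs hd hc hc1 hc2
  obtain ⟨C2, hC2, hfar⟩ := far_piece N a αe M hM hMs
  obtain ⟨C3, hC3, hmid⟩ := mid_piece N a αe M d c hM hMs hd hc hc1 hc2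
  set D : Fin m → ℝ := fun i => (1 - (1 / 2 : ℝ) ^ (∑ i, αe i - αe i))⁻¹ with hD
  have hD0 : ∀ i, 0 < D i := by
    intro i
    have : (1 / 2 : ℝ) ^ (∑ i, αe i - αe i) < 1 :=
      Real.rpow_lt_one (by norm_num) (by norm_num) (by linarith [hlt i])
    simp only [hD]
    apply inv_pos.2
    linarith
  set C4 : ℝ := C3 + C1 * (∑ i, D i) + C2 * (6 * M) ^ α with hC4
  have hDs : 0 ≤ ∑ i, D i := Finset.sum_nonneg fun i _ => (hD0 i).le
  have hMα : 0 < (6 * M) ^ α := by positivity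
  refine ⟨C4, by positivity, ?_⟩
  intro f x hx hint b h hb hh
  have hT : 0 < ‖x‖ := norm_pos_iff.2 hx
  -- near
  have near : ∀ i (j : ℕ), ENNReal.ofReal |∫ y, (∏ l, ‖x - a l y‖ ^ (-(αe l))) *
        psi ((c * (1 / 2) ^ j * ‖x‖)⁻¹ • (y - (a i).symm x)) * f y| ≤
        ENNReal.ofReal (C1 * ((1 / 2 : ℝ) ^ j) ^ (∑ i, αe i - αe i)) * b i := by
    intro i j
    have hr0 : 0 < c * (1 / 2 : ℝ) ^ j := by positivity
    have hrc : c * (1 / 2 : ℝ) ^ j ≤ c := by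
      have : (1 / 2 : ℝ) ^ j ≤ 1 := pow_le_one₀ (by norm_num) (by norm_num)
      nlinarith
    have h1 := hnear f x hx i (c * (1 / 2) ^ j) hr0 hrc
    set r := c * (1 / 2 : ℝ) ^ j with hr
    have h2 : C1 * (r ^ (-αe i) * ‖x‖ ^ (-(∑ l, αe l))) * (r * ‖x‖) ^ n =
        (C1 * r ^ (∑ i, αe i - αe i)) * (r * ‖x‖) ^ α := by
      have e1 : (r * ‖x‖) ^ n = (r * ‖x‖) ^ (∑ l, αe l) * (r * ‖x‖) ^ α := by
        rw [← Real.rpow_add (by positivity), hsum, ← Real.rpow_natCast]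
        congr 1
        ring
      rw [e1, Real.mul_rpow hr0.le hT.le (z := ∑ l, αe l), sub_eq_add_neg, Real.rpow_add hr0,
        Real.rpow_neg hT.le]
      have : ‖x‖ ^ (∑ l, αe l) ≠ 0 := by positivity
      field_simp
    simp only [h2] at h1
    refine (X_bound {z | ‖z - (a i).symm x‖ ≤ r * ‖x‖} (cMax n N f) _ (b i) _ _ (by positivity)
      (by positivity) h1 ?_).trans ?_
    · intro l hl
      apply hb i _ l (by positivity) _ hl
      have h3 := hMa i ((a i).symm x)
      rw [ContinuousLinearEquiv.apply_symm_apply] at h3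
      rw [le_div_iff₀ (by norm_num)]
      have h4 : r * ‖x‖ ≤ c * ‖x‖ := by gcongr
      have h5 : c * 2 * ‖x‖ ≤ c * 2 * (M * ‖(a i).symm x‖) := by gcongr
      have h6 := norm_nonneg ((a i).symm x)
      nlinarith
    · gcongr
      · linarith [hlt i]
      · nlinarith [pow_pos (by norm_num : (0 : ℝ) < 1 / 2) j]
  have nearS : ∀ i (J : ℕ), ∑ j ∈ Finset.range J,
      ENNReal.ofReal |∫ y, (∏ l, ‖x - a l y‖ ^ (-(αe l))) *
        psi ((c * (1 / 2) ^ j * ‖x‖)⁻¹ • (y - (a i).symm x)) * f y| ≤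
        ENNReal.ofReal (C1 * (∑ i, D i)) * b i := by
    intro i J
    calc _ ≤ ∑ j ∈ Finset.range J,
          ENNReal.ofReal (C1 * ((1 / 2 : ℝ) ^ j) ^ (∑ i, αe i - αe i)) * b i :=
          Finset.sum_le_sum fun j _ => near i j
      _ = ENNReal.ofReal (C1 * ∑ j ∈ Finset.range J, ((1 / 2 : ℝ) ^ j) ^ (∑ i, αe i - αe i)) * b i := by
          rw [← Finset.sum_mul, Finset.mul_sum, ENNReal.ofReal_sum_of_nonneg]
          intro j _
          positivity
      _ ≤ _ := by
          gcongr
          exact (geo_bound _ (by linarith [hlt i]) J).trans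
            (Finset.single_le_sum (f := D) (fun i _ => (hD0 i).le) (Finset.mem_univ i))
  have far : ∀ j : ℕ, ENNReal.ofReal |∫ y, (∏ l, ‖x - a l y‖ ^ (-(αe l))) *
        psi ((2 * (3 * M) * (2 ^ j * ‖x‖))⁻¹ • y) * f y| ≤
        ENNReal.ofReal (C2 * (6 * M) ^ α) * h j := by
    intro j
    have h2j : (1 : ℝ) ≤ 2 ^ j := one_le_pow₀ (by norm_num)
    have hρ : 6 * M * ‖x‖ ≤ 2 * (3 * M) * (2 ^ j * ‖x‖) := by
      have : 6 * M * (1 * ‖x‖) ≤ 6 * M * (2 ^ j * ‖x‖) := by gcongr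
      linarith
    have h1 := hfar f x hx _ hρ
    set ρ := 2 * (3 * M) * (2 ^ j * ‖x‖) with hρd
    have hρ0 : 0 < ρ := by positivity
    have h2 : C2 * ρ ^ (-(∑ l, αe l)) * ρ ^ n = (C2 * (6 * M) ^ α) * (2 ^ j * ‖x‖) ^ α := by
      rw [mul_assoc, mul_assoc, ← Real.mul_rpow (by positivity) (by positivity), ← Real.rpow_natCast,
        ← Real.rpow_add hρ0, hsum]
      congr 2
      · rw [hρd]; ring
      · ring
    simp only [h2] at h1
    refine X_bound {z | ‖z‖ ≤ 2 * ρ} (cMax n N f) _ (h j) _ _ (by positivity)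
      (by positivity) h1 ?_
    intro l hl
    apply hh j l
    intro z hz
    apply hl z
    show ‖z‖ ≤ 2 * ρ
    have : 0 < 2 ^ j * ‖x‖ := by positivity
    nlinarith
  have mid : ENNReal.ofReal |∫ y, (∏ l, ‖x - a l y‖ ^ (-(αe l))) *
        midcut a c (3 * M) (‖x‖⁻¹ • x, ‖x‖⁻¹ • y) * f y| ≤ ENNReal.ofReal C3 * h 0 := by
    have h1 := hmid f x hx
    have h2 : C3 * ‖x‖ ^ (-(∑ l, αe l)) * ‖x‖ ^ n = C3 * ‖x‖ ^ α := by
      rw [mul_assoc, ← Real.rpow_natCast, ← Real.rpow_add hT, hsum]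
      congr 2
      ring
    simp only [h2] at h1
    refine X_bound {z | ‖z‖ ≤ 2 * ‖x‖} (cMax n N f) _ (h 0) _ _ (by positivity)
      (by positivity) h1 ?_
    intro l hl
    have := hh 0 l (by simpa using hl)
    simpa using this
  -- integrability helper
  have hintc : ∀ g : Rn n → ℝ, Continuous g → (∃ B, ∀ y, |g y| ≤ B) →
      Integrable (fun y => (∏ l, ‖x - a l y‖ ^ (-(αe l))) * g y * f y) := by
    rintro g hg ⟨B, hB⟩
    have := hint.bdd_mul (g := fun y => (∏ l, ‖x - a l y‖ ^ (-(αe l))) * f y) (f := g) (c := B)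
      hg.aestronglyMeasurable (Filter.Eventually.of_forall hB)
    refine this.congr (Filter.Eventually.of_forall fun y => ?_)
    dsimp only
    ring
  have hpsi : ∀ w : Rn n, |psi w| ≤ 1 := by
    intro w
    unfold psi
    rw [abs_le]
    constructor <;> linarith [chi_nonneg w, chi_le_one w, chi_nonneg ((2:ℝ) • w), chi_le_one ((2:ℝ) • w)]
  have hpsic : Continuous (psi (n := n)) := psi_contDiff.continuous
  have hmidc := (midcut_contDiff a c (3 * M)).continuous
  have hchib : ∀ J y, |PJ a c (3 * M) x J y| ≤ 1 + m := PJ_bound a c (3 * M) hc (by positivity) x hx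
  have partialB : ∀ J, ENNReal.ofReal |∫ y, (∏ l, ‖x - a l y‖ ^ (-(αe l))) *
      PJ a c (3 * M) x J y * f y| ≤ ENNReal.ofReal C4 * (∑ i, b i + ∑' j, h j) := by
    intro J
    have i1 : Integrable (fun y => (∏ l, ‖x - a l y‖ ^ (-(αe l))) *
        midcut a c (3 * M) (‖x‖⁻¹ • x, ‖x‖⁻¹ • y) * f y) := by
      apply hintc
      · fun_prop
      · refine ⟨1 + m, fun y => ?_⟩
        have := hchib 0 y
        simpa [PJ] using this
    have i2 : ∀ i, ∀ j : ℕ, Integrable (fun y => (∏ l, ‖x - a l y‖ ^ (-(αe l))) *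
        psi ((c * (1 / 2) ^ j * ‖x‖)⁻¹ • (y - (a i).symm x)) * f y) := fun i j =>
      hintc _ (by fun_prop) ⟨1, fun y => hpsi _⟩
    have i3 : ∀ j : ℕ, Integrable (fun y => (∏ l, ‖x - a l y‖ ^ (-(αe l))) *
        psi ((2 * (3 * M) * (2 ^ j * ‖x‖))⁻¹ • y) * f y) := fun j =>
      hintc _ (by fun_prop) ⟨1, fun y => hpsi _⟩
    have heq : (∫ y, (∏ l, ‖x - a l y‖ ^ (-(αe l))) * PJ a c (3 * M) x J y * f y) =
        (∫ y, (∏ l, ‖x - a l y‖ ^ (-(αe l))) *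
          midcut a c (3 * M) (‖x‖⁻¹ • x, ‖x‖⁻¹ • y) * f y) +
        (∑ i, ∑ j ∈ Finset.range J, ∫ y, (∏ l, ‖x - a l y‖ ^ (-(αe l))) *
          psi ((c * (1 / 2) ^ j * ‖x‖)⁻¹ • (y - (a i).symm x)) * f y) +
        ∑ j ∈ Finset.range J, ∫ y, (∏ l, ‖x - a l y‖ ^ (-(αe l))) *
          psi ((2 * (3 * M) * (2 ^ j * ‖x‖))⁻¹ • y) * f y := by
      simp_rw [← integral_finsetSum (Finset.range J) fun j _ => i2 _ j]
      rw [← integral_finsetSum (Finset.univ) fun i _ =>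
          integrable_finsetSum (Finset.range J) fun j _ => i2 i j,
        ← integral_finsetSum (Finset.range J) fun j _ => i3 j, ← integral_add i1, ← integral_add]
      · congr 1
        funext y
        simp only [PJ, mul_add, add_mul, Finset.mul_sum, Finset.sum_mul]
      · exact i1.add (integrable_finsetSum _ fun i _ =>
          integrable_finsetSum (Finset.range J) fun j _ => i2 i j)
      · exact integrable_finsetSum _ fun j _ => i3 j
      · exact (integrable_finsetSum _ fun i _ =>
          integrable_finsetSum (Finset.range J) fun j _ => i2 i j)
    have habs : ∀ (s : Finset ℕ) (u : ℕ → ℝ), ENNReal.ofReal |∑ j ∈ s, u j| ≤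
        ∑ j ∈ s, ENNReal.ofReal |u j| := by
      intro s u
      rw [← ENNReal.ofReal_sum_of_nonneg fun _ _ => abs_nonneg _]
      exact ENNReal.ofReal_le_ofReal (Finset.abs_sum_le_sum_abs _ _)
    have habs' : ∀ (u : Fin m → ℝ), ENNReal.ofReal |∑ j, u j| ≤
        ∑ j, ENNReal.ofReal |u j| := by
      intro u
      rw [← ENNReal.ofReal_sum_of_nonneg fun _ _ => abs_nonneg _]
      exact ENNReal.ofReal_le_ofReal (Finset.abs_sum_le_sum_abs _ _)
    have hadd : ∀ u v : ℝ, ENNReal.ofReal |u + v| ≤ ENNReal.ofReal |u| + ENNReal.ofReal |v| := by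
      intro u v
      rw [← ENNReal.ofReal_add (abs_nonneg _) (abs_nonneg _)]
      exact ENNReal.ofReal_le_ofReal (abs_add_le _ _)
    rw [heq]
    refine (hadd _ _).trans ((add_le_add (hadd _ _) (habs _ _)).trans ?_)
    have f1 : ENNReal.ofReal C3 * h 0 ≤ ENNReal.ofReal C3 * (∑ i, b i + ∑' j, h j) := by
      gcongr
      exact (ENNReal.le_tsum 0).trans le_add_self
    have f2 : ∑ i, ENNReal.ofReal (C1 * (∑ i, D i)) * b i ≤
        ENNReal.ofReal (C1 * (∑ i, D i)) * (∑ i, b i + ∑' j, h j) := by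
      rw [← Finset.mul_sum]
      gcongr
      exact le_self_add
    have f3 : ∑ j ∈ Finset.range J, ENNReal.ofReal (C2 * (6 * M) ^ α) * h j ≤
        ENNReal.ofReal (C2 * (6 * M) ^ α) * (∑ i, b i + ∑' j, h j) := by
      rw [← Finset.mul_sum]
      gcongr
      exact (ENNReal.sum_le_tsum _).trans le_add_self
    have e4 : ENNReal.ofReal C4 = ENNReal.ofReal C3 + ENNReal.ofReal (C1 * (∑ i, D i)) +
        ENNReal.ofReal (C2 * (6 * M) ^ α) := by
      rw [← ENNReal.ofReal_add (by positivity) (by positivity),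
        ← ENNReal.ofReal_add (by positivity) (by positivity)]
    rw [e4, add_mul, add_mul]
    refine add_le_add (add_le_add (mid.trans f1) ?_) ?_
    · refine (habs' _).trans (le_trans ?_ f2)
      exact Finset.sum_le_sum fun i _ => (habs _ _).trans (nearS i J)
    · exact (Finset.sum_le_sum fun j _ => far j).trans f3
  have htend : Filter.Tendsto (fun J => ∫ y, (∏ l, ‖x - a l y‖ ^ (-(αe l))) *
      PJ a c (3 * M) x J y * f y) Filter.atTop
      (nhds (∫ y, (∏ l, ‖x - a l y‖ ^ (-(αe l))) * f y)) := by
    apply tendsto_integral_of_dominated_convergence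
      (fun y => (1 + m) * |(∏ l, ‖x - a l y‖ ^ (-(αe l))) * f y|)
    · intro J
      refine (hintc _ ?_ ⟨_, hchib J⟩).aestronglyMeasurable
      unfold PJ
      fun_prop
    · exact hint.abs.const_mul _
    · intro J
      refine Filter.Eventually.of_forall fun y => ?_
      generalize hK : (∏ l, ‖x - a l y‖ ^ (-(αe l))) = K
      rw [Real.norm_eq_abs, mul_right_comm, abs_mul, mul_comm]
      exact mul_le_mul_of_nonneg_right (hchib J y) (abs_nonneg _)
    · have hnull : ∀ᵐ y : Rn n, ∀ i, y ≠ (a i).symm x := by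
        haveI : Nonempty (Fin n) := ⟨⟨0, hn⟩⟩
        haveI : Nontrivial (Rn n) := inferInstance
        rw [ae_all_iff]
        intro i
        exact Measure.ae_ne volume _
      filter_upwards [hnull] with y hy
      have := (PJ_tendsto a c (3 * M) hc (by positivity) x hx y hy).const_mul
        ((∏ l, ‖x - a l y‖ ^ (-(αe l))) * f y)
      rw [mul_one] at this
      refine this.congr fun J => ?_
      ring
  have ht2 := (ENNReal.continuous_ofReal.tendsto _).comp ((continuous_abs.tendsto _).comp htend)
  exact le_of_tendsto ht2 (Filter.Eventually.of_forall partialB)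

open MeasureTheory ENNReal

lemma osc_loc {n : ℕ} {p : Rn n → ℝ} (h : LogHolderLocal p) : ∃ c : ℝ, 0 < c ∧ ∀ x y : Rn n, ∀ r : ℝ,
    0 < r → r < 1 / 2 → ‖x - y‖ ≤ r → |p x - p y| * (-Real.log r) ≤ c := by
  obtain ⟨c, hc, h⟩ := h
  refine ⟨c, hc, fun x y r hr hr2 hxy => ?_⟩
  have hl : 0 < -Real.log r := by
    have := Real.log_neg hr (by linarith)
    linarith
  rcases eq_or_ne x y with rfl | hne
  · simp [hc.le]
  have h0 : 0 < ‖x - y‖ := norm_pos_iff.2 (sub_ne_zero.2 hne)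
  have h1 := h x y (by linarith)
  have h2 : -Real.log r ≤ -Real.log ‖x - y‖ := by
    have := Real.log_le_log h0 hxy
    linarith
  rw [le_div_iff₀ (by linarith)] at h1
  exact (mul_le_mul_of_nonneg_left h2 (abs_nonneg _)).trans h1

lemma osc_inf {n : ℕ} {p : Rn n → ℝ} (h : LogHolderInfty p) : ∃ D : ℝ, 0 < D ∧ ∀ x y : Rn n,
    ‖x‖ ≤ 2 * ‖y‖ → |p x - p y| * Real.log (Real.exp 1 + ‖x‖) ≤ D := by
  obtain ⟨C, hC, P, h⟩ := h
  refine ⟨3 * C, by positivity, fun x y hxy => ?_⟩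
  have he : 1 ≤ Real.exp 1 := Real.one_le_exp (by norm_num)
  have hlog : ∀ x : Rn n, 1 ≤ Real.log (Real.exp 1 + ‖x‖) := by
    intro x
    rw [Real.le_log_iff_exp_le (by positivity)]
    linarith [norm_nonneg x]
  have h1 := h x
  have h2 := h y
  rw [le_div_iff₀ (by linarith [hlog x])] at h1
  rw [le_div_iff₀ (by linarith [hlog y])] at h2
  have h3 : Real.log (Real.exp 1 + ‖x‖) ≤ 2 * Real.log (Real.exp 1 + ‖y‖) := by
    rw [← Real.log_rpow (by positivity)]
    apply Real.log_le_log (by positivity)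
    norm_num
    nlinarith [norm_nonneg x, norm_nonneg y]
  have h4 : |p x - p y| ≤ |p x - P| + |p y - P| := by
    have := abs_sub_le (p x) P (p y)
    rwa [abs_sub_comm P] at this
  have h5 : |p y - P| * Real.log (Real.exp 1 + ‖x‖) ≤ 2 * C := by
    have := mul_le_mul_of_nonneg_left h3 (abs_nonneg (p y - P))
    linarith
  have := mul_le_mul_of_nonneg_right h4 (by linarith [hlog x] : 0 ≤ Real.log (Real.exp 1 + ‖x‖))
  linarith

lemma near_real {n : ℕ} (p : Rn n → ℝ) (hloc : LogHolderLocal p) (hinf : LogHolderInfty p)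
    (pm pp v : ℝ) (hpm : 0 < pm) (h1 : ∀ x, pm ≤ p x) (h2 : ∀ x, p x ≤ pp) (hv : 0 < v) :
    ∃ C : ℝ, 0 < C ∧ ∀ (u : Rn n) (r t : ℝ), 0 < r → r ≤ ‖u‖ / 2 →
      (∀ κ : ℝ, 0 ≤ κ → (∀ z, ‖z - u‖ ≤ r → κ ≤ Real.exp (t * p z)) → κ * (v * r ^ n) ≤ 1) →
      r ^ n * Real.exp (t * p u) ≤ C := by
  obtain ⟨c, hc, oloc⟩ := osc_loc hloc
  obtain ⟨D, hD, oinf⟩ := osc_inf hinf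
  have hpp : pm ≤ pp := (h1 0).trans (h2 0)
  set E : ℝ := (|Real.log v| * c + n * c) / pm with hE
  set K : ℝ := Real.log (4 ^ n / v) with hK
  set C1 := Real.exp (D * n / pm) / v with hC1
  set C2 := (1 / v) * Real.exp ((pp - pm) / pm * |K|) with hC2
  set C3 := Real.exp E / v with hC3
  refine ⟨1 + C1 + C2 + C3, by positivity, ?_⟩
  have q1 : 0 < C1 := by positivity
  have q2 : 0 < C2 := by positivity
  have q3 : 0 < C3 := by positivity
  intro u r t hr hru hκ
  -- general consequence
  have gen : ∀ E' : ℝ, (∀ z, ‖z - u‖ ≤ r → t * p u - E' ≤ t * p z) →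
      r ^ n * Real.exp (t * p u) ≤ Real.exp E' / v := by
    intro E' hz
    have := hκ (Real.exp (t * p u - E')) (by positivity) fun z hzr => Real.exp_le_exp.2 (hz z hzr)
    rw [le_div_iff₀ hv]
    rw [Real.exp_sub] at this
    have e : Real.exp E' ≠ 0 := by positivity
    have : Real.exp (t * p u) / Real.exp E' * (v * r ^ n) * Real.exp E' ≤ 1 * Real.exp E' := by
      gcongr
    field_simp at this
    linarith
  have habs : ∀ z, t * p u - t * p z ≤ |p z - p u| * |t| := by
    intro z
    have := le_abs_self ((p u - p z) * t)
    rw [abs_mul, abs_sub_comm] at this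
    linarith
  rcases le_total t 0 with ht | ht
  · rcases le_total r 1 with hr1 | hr1
    · have e1 : r ^ n ≤ 1 := pow_le_one₀ hr.le hr1
      have e2 : Real.exp (t * p u) ≤ 1 := by
        rw [Real.exp_le_one_iff]
        nlinarith [h1 u]
      have : r ^ n * Real.exp (t * p u) ≤ 1 * 1 := by gcongr
      linarith
    · set L := Real.log (Real.exp 1 + ‖u‖) with hL
      rcases le_total t (-(L * n / pm)) with htL | htL
      · have e1 : t * p u ≤ -(L * n) := by
          have a1 : t * p u ≤ t * pm := by nlinarith [h1 u]
          have a2 : t * pm ≤ -(L * n / pm) * pm := by gcongr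
          have a3 : -(L * n / pm) * pm = -(L * n) := by field_simp
          linarith
        have e2 : Real.exp (t * p u) ≤ ((Real.exp 1 + ‖u‖) ^ n)⁻¹ := by
          refine (Real.exp_le_exp.2 e1).trans (le_of_eq ?_)
          rw [Real.exp_neg, mul_comm L, Real.exp_nat_mul, hL, Real.exp_log (by positivity)]
        have e3 : r ^ n ≤ (Real.exp 1 + ‖u‖) ^ n := by
          gcongr
          linarith [Real.exp_pos 1, norm_nonneg u]
        have : r ^ n * Real.exp (t * p u) ≤ (Real.exp 1 + ‖u‖) ^ n * ((Real.exp 1 + ‖u‖) ^ n)⁻¹ := by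
          gcongr
        rw [mul_inv_cancel₀ (by positivity)] at this
        linarith
      · have := gen (D * n / pm) (by
          intro z hz
          have e1 : ‖u‖ ≤ 2 * ‖z‖ := by
            have := norm_sub_norm_le u z
            rw [norm_sub_rev] at this
            linarith
          have e2 := oinf u z e1
          have e3 := habs z
          have e4 : |p z - p u| * |t| ≤ |p z - p u| * (L * n / pm) := by
            gcongr
            rw [abs_of_nonpos ht]
            linarith
          have e5 : |p z - p u| * (L * n / pm) ≤ D * n / pm := by
            rw [abs_sub_comm] at e2
            have : |p z - p u| * L * n / pm ≤ D * n / pm := by gcongr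
            calc _ = |p z - p u| * L * n / pm := by ring
              _ ≤ _ := this
          linarith)
        linarith
  · have e0 := hκ (Real.exp (t * pm)) (by positivity) fun z hz => Real.exp_le_exp.2 (by
      have := h1 z
      gcongr)
    rcases le_total (1 / 4) r with hr1 | hr1
    · have e1 : Real.exp (t * pm) ≤ 4 ^ n / v := by
        have : (1 / 4 : ℝ) ^ n ≤ r ^ n := by gcongr
        rw [le_div_iff₀ hv]
        have a1 : Real.exp (t * pm) * (v * (1 / 4) ^ n) ≤ 1 := le_trans (by gcongr) e0
        rw [div_pow, one_pow] at a1
        field_simp at a1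
        linarith
      have e2 : t * pm ≤ |K| := by
        refine le_trans ?_ (le_abs_self _)
        rwa [hK, Real.le_log_iff_exp_le (by positivity)]
      have e3 : t * p u ≤ t * pm + (pp - pm) / pm * |K| := by
        have a1 : t * p u ≤ t * pp := by gcongr; exact h2 u
        have a2 : (pp - pm) / pm * (t * pm) ≤ (pp - pm) / pm * |K| := by
          have : 0 ≤ pp - pm := by linarith
          gcongr
        have a3 : (pp - pm) / pm * (t * pm) = t * pp - t * pm := by field_simp
        linarith
      have e4 : r ^ n * Real.exp (t * p u) ≤ C2 := by
        calc r ^ n * Real.exp (t * p u) ≤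
            r ^ n * (Real.exp (t * pm) * Real.exp ((pp - pm) / pm * |K|)) := by
              rw [← Real.exp_add]
              gcongr
          _ = (1 / v) * ((Real.exp (t * pm) * (v * r ^ n)) * Real.exp ((pp - pm) / pm * |K|)) := by
              field_simp
          _ ≤ (1 / v) * (1 * Real.exp ((pp - pm) / pm * |K|)) := by gcongr
          _ = C2 := by rw [one_mul]
      linarith
    · have hlr : 1 ≤ -Real.log r := by
        have a1 : Real.log r ≤ Real.log (1 / 4) := Real.log_le_log hr hr1
        have a2 : Real.log (1 / 4 : ℝ) ≤ -1 := by
          rw [Real.log_le_iff_le_exp (by norm_num), Real.exp_neg]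
          have := Real.exp_one_lt_d9
          rw [one_div]
          gcongr
          linarith
        linarith
      have e1 : t * pm ≤ |Real.log v| + n * (-Real.log r) := by
        have a1 : Real.exp (t * pm) ≤ (v * r ^ n)⁻¹ := by
          rw [← one_div, le_div_iff₀ (by positivity)]
          exact e0
        rw [← Real.le_log_iff_exp_le (by positivity), Real.log_inv, Real.log_mul hv.ne' (by positivity),
          Real.log_pow] at a1
        have := neg_abs_le (Real.log v)
        linarith
      have := gen E (by
        intro z hz
        have a1 := oloc z u r hr (by linarith) hz
        have a2 := habs z
        rw [abs_of_nonneg ht] at a2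
        have a3 : |p z - p u| ≤ c := by
          have := mul_le_mul_of_nonneg_left hlr (abs_nonneg (p z - p u))
          linarith
        have a4 : |p z - p u| * t ≤ E := by
          rw [hE, le_div_iff₀ hpm]
          have b1 := mul_le_mul_of_nonneg_left e1 (abs_nonneg (p z - p u))
          have b2 := mul_le_mul_of_nonneg_right a3 (abs_nonneg (Real.log v))
          have b3 := mul_le_mul_of_nonneg_left a1 (Nat.cast_nonneg n : (0 : ℝ) ≤ n)
          linarith
        linarith)
      linarith

lemma near {n : ℕ} (p : Rn n → ℝ) (hloc : LogHolderLocal p) (hinf : LogHolderInfty p)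
    (pm pp : ℝ) (hpm : 0 < pm) (h1 : ∀ x, pm ≤ p x) (h2 : ∀ x, p x ≤ pp) :
    ∃ C : ℝ, 0 < C ∧ ∀ F : Rn n → ℝ≥0∞, ∫⁻ x, F x ^ p x ≤ 1 → ∀ (u : Rn n) (r : ℝ) (l : ℝ≥0∞),
      0 < r → r ≤ ‖u‖ / 2 → (∀ z, ‖z - u‖ ≤ r → l ≤ F z) →
      ENNReal.ofReal (r ^ n) * l ^ p u ≤ ENNReal.ofReal C := by
  have hv0 : volume (Metric.ball (0 : Rn n) 1) ≠ 0 := (Metric.measure_ball_pos _ _ one_pos).ne'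
  have hv1 : volume (Metric.ball (0 : Rn n) 1) ≠ ⊤ := measure_ball_lt_top.ne
  set v := (volume (Metric.ball (0 : Rn n) 1)).toReal with hv
  have hvp : 0 < v := ENNReal.toReal_pos hv0 hv1
  obtain ⟨C, hC, H⟩ := near_real p hloc hinf pm pp v hpm h1 h2 hvp
  refine ⟨C, hC, fun F hF u r l hr hru hl => ?_⟩
  have hvol : volume (Metric.closedBall u r) = ENNReal.ofReal (v * r ^ n) := by
    rw [Measure.addHaar_closedBall _ _ hr.le, finrank_euclideanSpace, Fintype.card_fin, mul_comm,
      ENNReal.ofReal_mul hvp.le, hv, ENNReal.ofReal_toReal hv1]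
  have key : ∀ κ : ℝ≥0∞, (∀ z, ‖z - u‖ ≤ r → κ ≤ l ^ p z) → κ * ENNReal.ofReal (v * r ^ n) ≤ 1 := by
    intro κ hκ
    calc κ * ENNReal.ofReal (v * r ^ n) = ∫⁻ z in Metric.closedBall u r, κ := by
          rw [lintegral_const, Measure.restrict_apply_univ, hvol]
      _ ≤ ∫⁻ z in Metric.closedBall u r, F z ^ p z := by
          apply setLIntegral_mono' Metric.isClosed_closedBall.measurableSet
          intro z hz
          rw [Metric.mem_closedBall, dist_eq_norm] at hz
          exact (hκ z hz).trans (ENNReal.rpow_le_rpow (hl z hz) (hpm.le.trans (h1 z)))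
      _ ≤ ∫⁻ z, F z ^ p z := setLIntegral_le_lintegral _ _
      _ ≤ 1 := hF
  have hpos : 0 < v * r ^ n := by positivity
  induction l using ENNReal.recTopCoe with
  | top =>
    exfalso
    have := key ⊤ (fun z _ => by rw [ENNReal.top_rpow_of_pos (hpm.trans_le (h1 z))])
    rw [ENNReal.top_mul (by simpa using hpos)] at this
    simp at this
  | coe l =>
    rcases eq_or_ne l 0 with rfl | hl0
    · simp [hpm.trans_le (h1 u)]
    have hl1 : (0 : ℝ) < l := by positivity
    have hrp : ∀ s : ℝ, (l : ℝ≥0∞) ^ s = ENNReal.ofReal (Real.exp (Real.log l * s)) := by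
      intro s
      rw [← Real.rpow_def_of_pos hl1, ← ENNReal.ofReal_rpow_of_pos hl1, ENNReal.ofReal_coe_nnreal]
    rw [hrp, ← ENNReal.ofReal_mul (by positivity)]
    apply ENNReal.ofReal_le_ofReal
    apply H u r (Real.log l) hr hru
    intro κ hκ0 hκ
    have := key (ENNReal.ofReal κ) (fun z hz => by
      rw [hrp]
      exact ENNReal.ofReal_le_ofReal (hκ z hz))
    rw [← ENNReal.ofReal_mul hκ0] at this
    simpa using this

/-- corollary used for fractional gain -/
lemma near_frac {n : ℕ} (hn : 0 < n) (α pu : ℝ) (hα : 0 ≤ α) (hpu : 0 < pu) (hpα : pu * α < n)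
    (C r : ℝ) (hC : 0 < C) (hr : 0 < r) (l : ℝ≥0∞)
    (h : ENNReal.ofReal (r ^ n) * l ^ pu ≤ ENNReal.ofReal C) :
    ENNReal.ofReal (r ^ α) * l ≤ ENNReal.ofReal (C ^ (α / n)) * l ^ (1 - α * pu / n) := by
  have hn' : (0 : ℝ) < n := by exact_mod_cast hn
  have e1 : (0 : ℝ) ≤ 1 - α * pu / n := by
    have : α * pu / n ≤ 1 := by
      rw [div_le_one hn']
      linarith
    linarith
  have e2 : l = l ^ (α * pu / n) * l ^ (1 - α * pu / n) := by
    rw [← ENNReal.rpow_add_of_nonneg _ _ (by positivity) e1]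
    simp
  have e3 : ENNReal.ofReal (r ^ α) * l ^ (α * pu / n) ≤ ENNReal.ofReal (C ^ (α / n)) := by
    have := ENNReal.rpow_le_rpow h (by positivity : 0 ≤ α / n)
    rw [ENNReal.mul_rpow_of_nonneg _ _ (by positivity), ← ENNReal.rpow_mul,
      ENNReal.ofReal_rpow_of_pos (by positivity), ENNReal.ofReal_rpow_of_pos hC,
      ← Real.rpow_natCast, ← Real.rpow_mul hr.le] at this
    convert this using 3
    · field_simp
    · ring
  calc ENNReal.ofReal (r ^ α) * l
      = ENNReal.ofReal (r ^ α) * l ^ (α * pu / n) * l ^ (1 - α * pu / n) := by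
        rw [mul_assoc, ← e2]
    _ ≤ _ := by gcongr

open MeasureTheory ENNReal

def OscLoc {n : ℕ} (p : Rn n → ℝ) : Prop := ∃ c : ℝ, 0 < c ∧ ∀ x y : Rn n, ∀ r : ℝ,
    0 < r → r < 1 / 2 → ‖x - y‖ ≤ r → |p x - p y| * (-Real.log r) ≤ c

def OscInf {n : ℕ} (p : Rn n → ℝ) : Prop := ∃ D : ℝ, 0 < D ∧ ∀ x y : Rn n,
    ‖x‖ ≤ 2 * ‖y‖ → |p x - p y| * Real.log (Real.exp 1 + ‖x‖) ≤ D

set_option maxHeartbeats 800000 in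
lemma hardy_real {n : ℕ} (hn : 0 < n) (q : Rn n → ℝ) (hloc : OscLoc q) (hinf : OscInf q)
    (a1 a2 : ℝ) (ha1 : 0 < a1) (h1 : ∀ x, a1 ≤ q x) (h2 : ∀ x, q x ≤ a2) (C0 : ℝ) (hC0 : 0 < C0) :
    ∃ K b : ℝ, 0 < K ∧ 0 < b ∧ ∀ (x : Rn n) (Q t : ℝ), x ≠ 0 → 1 ≤ Q →
      ‖Q • x‖ ^ n * Real.exp (t * q (Q • x)) ≤ C0 →
      Real.exp (t * q x) ≤ K * (Q ^ ((n : ℝ) / 2) * Real.exp (t * q (Q • x))) ∨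
      (‖x‖ ≤ Q ^ (-(1 / 2) : ℝ) ∧ Real.exp (t * q x) ≤ K) ∨
      Real.exp (t * q x) ≤ K * (Q ^ (-b) * (1 + ‖x‖) ^ (-((n : ℝ) + 1))) := by
  obtain ⟨c, hc, oloc⟩ := hloc
  obtain ⟨D, hD, oinf⟩ := hinf
  have hn' : (0 : ℝ) < n := by exact_mod_cast hn
  have ha2 : 0 < a2 := ha1.trans_le ((h1 0).trans (h2 0))
  have ha12 : a1 ≤ a2 := (h1 0).trans (h2 0)
  set c0 := |Real.log C0| with hc0
  have hc00 : 0 ≤ c0 := abs_nonneg _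
  set c1 := c0 + n * Real.log 4 with hc1
  have hlog4 : 0 < Real.log 4 := Real.log_pos (by norm_num)
  have hc10 : 0 ≤ c1 := by positivity
  set c2 := a2 / a1 * c1 with hc2
  have hc20 : 0 ≤ c2 := by positivity
  set a := a1 / a2 * n with ha
  have ha0 : 0 < a := by positivity
  set E := (c0 * c + n * c) / a1 with hE
  set ε := n / (2 * D) with hε
  have hε0 : 0 < ε := by positivity
  set M := (n + 1) / a1 with hM
  set T := c0 / a1 with hT
  set b := min (a / 2) (ε * a1) with hb
  have hb0 : 0 < b := by positivity
  set K := 1 + Real.exp E + Real.exp c2 * 2 ^ ((n : ℝ) + 1) + Real.exp c2 + Real.exp (D * M + D * T) with hK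
  have p1 := Real.exp_pos E
  have p2 : 0 < Real.exp c2 * 2 ^ ((n : ℝ) + 1) := by positivity
  have p3 := Real.exp_pos (D * M + D * T)
  have p4 := Real.exp_pos c2
  refine ⟨K, b, by positivity, hb0, fun x Q t hx hQ hyp => ?_⟩
  have hQ0 : 0 < Q := by linarith
  have hx0 : 0 < ‖x‖ := norm_pos_iff.2 hx
  set y := Q • x with hy
  have hyn : ‖y‖ = Q * ‖x‖ := by rw [hy, norm_smul, Real.norm_eq_abs, abs_of_pos hQ0]
  have hy0 : 0 < ‖y‖ := by rw [hyn]; positivity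
  have hxy : ‖x‖ ≤ ‖y‖ := by rw [hyn]; nlinarith
  have hlogQ : 0 ≤ Real.log Q := Real.log_nonneg hQ
  have H0 : n * Real.log ‖y‖ + t * q y ≤ c0 := by
    have : Real.log (‖y‖ ^ n * Real.exp (t * q y)) ≤ Real.log C0 :=
      Real.log_le_log (by positivity) hyp
    rw [Real.log_mul (by positivity) (by positivity), Real.log_pow, Real.log_exp] at this
    exact this.trans (le_abs_self _)
  have habs : t * q x - t * q y ≤ |q x - q y| * |t| := by
    have := le_abs_self ((q x - q y) * t)
    rw [abs_mul] at this
    linarith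
  have hQn : 1 ≤ Q ^ ((n : ℝ) / 2) := Real.one_le_rpow hQ (by positivity)
  rcases le_or_gt ‖y‖ (1 / 4) with hA | hA
  · -- case A
    rcases le_total t 0 with ht | ht
    · right; left
      constructor
      · have e1 : ‖x‖ = Q⁻¹ * ‖y‖ := by rw [hyn]; field_simp
        rw [e1]
        calc Q⁻¹ * ‖y‖ ≤ Q⁻¹ * 1 := by gcongr; linarith
          _ = Q ^ (-1 : ℝ) := by rw [mul_one, Real.rpow_neg_one]
          _ ≤ _ := Real.rpow_le_rpow_of_exponent_le hQ (by norm_num)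
      · have : Real.exp (t * q x) ≤ 1 := by
          rw [Real.exp_le_one_iff]
          nlinarith [h1 x]
        linarith
    · left
      have hlr : 1 ≤ -Real.log ‖y‖ := by
        have a1 : Real.log ‖y‖ ≤ Real.log (1 / 4) := Real.log_le_log hy0 hA
        have a2 : Real.log (1 / 4 : ℝ) ≤ -1 := by
          rw [Real.log_le_iff_le_exp (by norm_num), Real.exp_neg]
          have := Real.exp_one_lt_d9
          rw [one_div]
          gcongr
          linarith
        linarith
      have d1 : ‖x - y‖ ≤ ‖y‖ := by
        have : x - y = -((Q - 1) • x) := by rw [hy, sub_smul, one_smul]; abel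
        rw [this, norm_neg, norm_smul, Real.norm_eq_abs, abs_of_nonneg (by linarith), hyn]
        nlinarith
      have o := oloc x y ‖y‖ hy0 (by linarith) d1
      have a3 : |q x - q y| ≤ c := by
        have := mul_le_mul_of_nonneg_left hlr (abs_nonneg (q x - q y))
        linarith
      have e1 : t * a1 ≤ c0 + n * (-Real.log ‖y‖) := by
        have : t * a1 ≤ t * q y := by gcongr; exact h1 y
        linarith
      have a4 : |q x - q y| * |t| ≤ E := by
        rw [abs_of_nonneg ht, hE, le_div_iff₀ ha1]
        have b1 := mul_le_mul_of_nonneg_left e1 (abs_nonneg (q x - q y))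
        have b2 := mul_le_mul_of_nonneg_right a3 hc00
        have b3 := mul_le_mul_of_nonneg_left o hn'.le
        linarith
      calc Real.exp (t * q x) ≤ Real.exp (E + t * q y) := Real.exp_le_exp.2 (by linarith)
        _ = Real.exp E * (1 * Real.exp (t * q y)) := by rw [Real.exp_add, one_mul]
        _ ≤ K * (Q ^ ((n : ℝ) / 2) * Real.exp (t * q y)) := by
          gcongr
          linarith
  rcases le_or_gt ‖x‖ 1 with hB | hB
  · -- case B
    set w := Real.log (4 * ‖y‖) with hw
    have hw0 : 0 < w := Real.log_pos (by linarith)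
    have hw1 : w = Real.log 4 + Real.log ‖y‖ := Real.log_mul (by norm_num) hy0.ne'
    have e0 : t * q y ≤ c1 - n * w := by
      rw [hw1, hc1]
      linarith
    have hr1 : a1 / a2 ≤ 1 := (div_le_one ha2).2 ha12
    have hr2 : 1 ≤ a2 / a1 := (one_le_div ha1).2 ha12
    have hc12 : c1 ≤ c2 := by rw [hc2]; nlinarith
    have e1 : t * q x ≤ c2 - a * w := by
      rcases le_total t 0 with ht | ht
      · have f1 : t * q x ≤ t * a1 := mul_le_mul_of_nonpos_left (h1 x) ht
        have f2 : a1 / a2 * (t * a2) ≤ a1 / a2 * (t * q y) := by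
          have := mul_le_mul_of_nonpos_left (h2 y) ht
          gcongr
        have f3 : a1 / a2 * (t * a2) = t * a1 := by field_simp
        have f4 : a1 / a2 * (t * q y) ≤ a1 / a2 * (c1 - n * w) := by gcongr
        have f5 : a1 / a2 * c1 ≤ c1 := by nlinarith
        have f6 : a1 / a2 * (c1 - n * w) = a1 / a2 * c1 - a * w := by rw [ha]; ring
        linarith
      · have f1 : t * q x ≤ t * a2 := mul_le_mul_of_nonneg_left (h2 x) ht
        have f2 : a2 / a1 * (t * a1) ≤ a2 / a1 * (t * q y) := by
          have := mul_le_mul_of_nonneg_left (h1 y) ht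
          gcongr
        have f3 : a2 / a1 * (t * a1) = t * a2 := by field_simp
        have f4 : a2 / a1 * (t * q y) ≤ a2 / a1 * (c1 - n * w) := by gcongr
        have f5 : a * w ≤ a2 / a1 * (n * w) := by
          rw [ha, mul_assoc]
          have : 0 < n * w := by positivity
          gcongr
        have f6 : a2 / a1 * (c1 - n * w) = c2 - a2 / a1 * (n * w) := by rw [hc2]; ring
        linarith
    rcases le_or_gt ‖x‖ (Q ^ (-(1 / 2) : ℝ)) with hx2 | hx2
    · right; left
      refine ⟨hx2, ?_⟩
      have : Real.exp (t * q x) ≤ Real.exp c2 := Real.exp_le_exp.2 (by nlinarith)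
      linarith
    · right; right
      have g1 : 1 / 2 * Real.log Q ≤ w := by
        rw [hw, ← Real.log_rpow hQ0]
        apply Real.log_le_log (by positivity)
        have : Q * Q ^ (-(1 / 2) : ℝ) ≤ Q * ‖x‖ := by gcongr
        have h' : Q * Q ^ (-(1 / 2) : ℝ) = Q ^ (1 / 2 : ℝ) := by
          rw [← Real.rpow_one_add' hQ0.le (by norm_num)]
          norm_num
        rw [hyn]
        have : 0 < Q * ‖x‖ := by positivity
        linarith
      have g2 : t * q x ≤ c2 + Real.log Q * (-b) := by
        have : b ≤ a / 2 := min_le_left _ _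
        nlinarith
      have g3 : (2 : ℝ) ^ (-((n : ℝ) + 1)) ≤ (1 + ‖x‖) ^ (-((n : ℝ) + 1)) := by
        apply Real.rpow_le_rpow_of_nonpos (by positivity) (by linarith)
        linarith
      calc Real.exp (t * q x) ≤ Real.exp (c2 + Real.log Q * (-b)) := Real.exp_le_exp.2 g2
        _ = Real.exp c2 * 2 ^ ((n : ℝ) + 1) * (Q ^ (-b) * (2 : ℝ) ^ (-((n : ℝ) + 1))) := by
          rw [Real.exp_add, ← Real.rpow_def_of_pos hQ0, Real.rpow_neg (by norm_num : (0 : ℝ) ≤ 2)]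
          field_simp
        _ ≤ K * (Q ^ (-b) * (1 + ‖x‖) ^ (-((n : ℝ) + 1))) := by
          gcongr
          linarith
  · -- case C
    set L := Real.log (Real.exp 1 + ‖x‖) with hL
    have hL1 : 1 ≤ L := by
      rw [hL, Real.le_log_iff_exp_le (by positivity)]
      linarith
    have o := oinf x y (by linarith)
    have hqt : |q x - q y| ≤ D := by
      have := mul_le_mul_of_nonneg_left hL1 (abs_nonneg (q x - q y))
      linarith
    rcases le_total t (-(M * L + ε * Real.log Q)) with ht | ht
    · right; right
      have ht0 : t ≤ 0 := by
        have : 0 ≤ M * L + ε * Real.log Q := by positivity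
        linarith
      have f1 : t * q x ≤ t * a1 := mul_le_mul_of_nonpos_left (h1 x) ht0
      have f2 : t * a1 ≤ -(M * L + ε * Real.log Q) * a1 := by gcongr
      have f3 : -(M * L + ε * Real.log Q) * a1 = L * (-((n : ℝ) + 1)) + Real.log Q * (-(ε * a1)) := by
        rw [hM]; field_simp; ring
      have f4 : Real.log Q * (-(ε * a1)) ≤ Real.log Q * (-b) := by
        have : b ≤ ε * a1 := min_le_right _ _
        gcongr
      have f5 : (Real.exp 1 + ‖x‖) ^ (-((n : ℝ) + 1)) ≤ (1 + ‖x‖) ^ (-((n : ℝ) + 1)) := by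
        apply Real.rpow_le_rpow_of_nonpos (by positivity) _ (by linarith)
        have : 1 ≤ Real.exp 1 := Real.one_le_exp (by norm_num)
        linarith
      calc Real.exp (t * q x) ≤ Real.exp (Real.log Q * (-b) + L * (-((n : ℝ) + 1))) :=
            Real.exp_le_exp.2 (by linarith)
        _ = 1 * (Q ^ (-b) * (Real.exp 1 + ‖x‖) ^ (-((n : ℝ) + 1))) := by
          rw [Real.exp_add, ← Real.rpow_def_of_pos hQ0, hL, ← Real.rpow_def_of_pos (by positivity),
            one_mul]
        _ ≤ K * (Q ^ (-b) * (1 + ‖x‖) ^ (-((n : ℝ) + 1))) := by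
          gcongr
          linarith
    · left
      have f0 : t ≤ T := by
        rcases le_total t 0 with h0 | h0
        · have : 0 ≤ T := by positivity
          linarith
        rw [hT, le_div_iff₀ ha1]
        have : t * a1 ≤ t * q y := by gcongr; exact h1 y
        have : 0 ≤ n * Real.log ‖y‖ := by
          have := Real.log_nonneg (by linarith : 1 ≤ ‖y‖)
          positivity
        linarith
      have hT0 : 0 ≤ T := by positivity
      have f1 : |t| ≤ M * L + ε * Real.log Q + T := by
        have : 0 ≤ M * L + ε * Real.log Q := by positivity
        rw [abs_le]
        constructor <;> linarith
      have f2 : |q x - q y| * |t| ≤ D * M + D * T + Real.log Q * (n / 2) := by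
        have g1 := mul_le_mul_of_nonneg_left f1 (abs_nonneg (q x - q y))
        have g2 := mul_le_mul_of_nonneg_right o (by positivity : 0 ≤ M)
        have g3 := mul_le_mul_of_nonneg_right hqt hT0
        have g4 := mul_le_mul_of_nonneg_right hqt (by positivity : 0 ≤ ε * Real.log Q)
        have g5 : D * (ε * Real.log Q) = Real.log Q * (n / 2) := by
          rw [hε]; field_simp
        linarith
      calc Real.exp (t * q x) ≤ Real.exp ((D * M + D * T) + (Real.log Q * ((n : ℝ) / 2) + t * q y)) :=
            Real.exp_le_exp.2 (by linarith)
        _ = Real.exp (D * M + D * T) * (Q ^ ((n : ℝ) / 2) * Real.exp (t * q y)) := by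
          rw [Real.exp_add, Real.exp_add (Real.log Q * _), ← Real.rpow_def_of_pos hQ0]
        _ ≤ K * (Q ^ ((n : ℝ) / 2) * Real.exp (t * q y)) := by
          gcongr
          linarith

open MeasureTheory ENNReal

lemma hardy_ptw {n : ℕ} (hn : 0 < n) (q : Rn n → ℝ) (hloc : OscLoc q) (hinf : OscInf q)
    (a1 a2 : ℝ) (ha1 : 0 < a1) (h1 : ∀ x, a1 ≤ q x) (h2 : ∀ x, q x ≤ a2) (C0 : ℝ) (hC0 : 0 < C0) :
    ∃ K b : ℝ, 0 < K ∧ 0 < b ∧ ∀ (x : Rn n) (Q : ℝ) (l : ℝ≥0∞), x ≠ 0 → 1 ≤ Q →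
      ENNReal.ofReal (‖Q • x‖ ^ n) * l ^ q (Q • x) ≤ ENNReal.ofReal C0 →
      l ^ q x ≤ ENNReal.ofReal K * (ENNReal.ofReal (Q ^ ((n : ℝ) / 2)) * l ^ q (Q • x) +
        (Metric.closedBall (0 : Rn n) (Q ^ (-(1 / 2) : ℝ))).indicator 1 x +
        ENNReal.ofReal (Q ^ (-b)) * ENNReal.ofReal ((1 + ‖x‖) ^ (-((n : ℝ) + 1)))) := by
  obtain ⟨K, b, hK, hb, H⟩ := hardy_real hn q hloc hinf a1 a2 ha1 h1 h2 C0 hC0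
  refine ⟨K, b, hK, hb, fun x Q l hx hQ hyp => ?_⟩
  have hQ0 : 0 < Q := by linarith
  have hx0 : 0 < ‖x‖ := norm_pos_iff.2 hx
  have hy0 : 0 < ‖Q • x‖ ^ n := by
    rw [norm_smul, Real.norm_eq_abs, abs_of_pos hQ0]
    positivity
  induction l using ENNReal.recTopCoe with
  | top =>
    exfalso
    rw [ENNReal.top_rpow_of_pos (ha1.trans_le (h1 _)), ENNReal.mul_top (ENNReal.ofReal_pos.2 hy0).ne'] at hyp
    exact ENNReal.ofReal_ne_top (top_le_iff.1 hyp)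
  | coe l =>
    rcases eq_or_ne l 0 with rfl | hl0
    · simp [ha1.trans_le (h1 x)]
    have hl1 : (0 : ℝ) < l := by positivity
    have hrp : ∀ s : ℝ, (l : ℝ≥0∞) ^ s = ENNReal.ofReal (Real.exp (Real.log l * s)) := by
      intro s
      rw [← Real.rpow_def_of_pos hl1, ← ENNReal.ofReal_rpow_of_pos hl1, ENNReal.ofReal_coe_nnreal]
    rw [hrp, ← ENNReal.ofReal_mul (by positivity), ENNReal.ofReal_le_ofReal_iff hC0.le] at hyp
    rw [hrp, hrp]
    rcases H x Q (Real.log l) hx hQ hyp with h | ⟨hxx, h⟩ | h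
    · refine (ENNReal.ofReal_le_ofReal h).trans ?_
      rw [ENNReal.ofReal_mul hK.le, ENNReal.ofReal_mul (by positivity)]
      gcongr
      rw [add_assoc]
      exact le_self_add
    · have : (Metric.closedBall (0 : Rn n) (Q ^ (-(1 / 2) : ℝ))).indicator (1 : Rn n → ℝ≥0∞) x = 1 := by
        rw [Set.indicator_of_mem (by simpa using hxx)]
        rfl
      rw [this]
      refine (ENNReal.ofReal_le_ofReal h).trans ?_
      calc ENNReal.ofReal K = ENNReal.ofReal K * 1 := (mul_one _).symm
        _ ≤ _ := by
          gcongr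
          exact le_add_self.trans le_self_add
    · refine (ENNReal.ofReal_le_ofReal h).trans ?_
      rw [ENNReal.ofReal_mul hK.le, ENNReal.ofReal_mul (by positivity)]
      gcongr
      exact le_add_self

lemma geoE (s : ℝ) (hs : 0 < s) : ∑' j : ℕ, ENNReal.ofReal (((2 : ℝ) ^ j) ^ (-s)) ≠ ⊤ := by
  have h1 : (1 / 2 : ℝ) ^ s < 1 := Real.rpow_lt_one (by norm_num) (by norm_num) hs
  have h0 : 0 ≤ (1 / 2 : ℝ) ^ s := by positivity
  have : ∀ j : ℕ, ((2 : ℝ) ^ j) ^ (-s) = ((1 / 2 : ℝ) ^ s) ^ j := by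
    intro j
    rw [one_div, Real.inv_rpow (by norm_num), inv_pow, ← Real.rpow_natCast, ← Real.rpow_natCast,
      ← Real.rpow_mul (by norm_num), ← Real.rpow_mul (by norm_num), ← Real.rpow_neg (by norm_num)]
    congr 1
    ring
  simp_rw [this]
  have hs := summable_geometric_of_lt_one h0 h1
  rw [← ENNReal.ofReal_tsum_of_nonneg (fun j => by positivity) hs]
  exact ENNReal.ofReal_ne_top

lemma tsum_rpow_bound (ε a2 : ℝ) (hε : 0 < ε) (ha2 : 0 < a2) : ∃ B : ℝ≥0∞, B ≠ ⊤ ∧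
    ∀ (w : ℕ → ℝ≥0∞) (s : ℝ), 0 < s → s ≤ a2 →
      (∑' j, w j) ^ s ≤ B * ∑' j, ENNReal.ofReal (((2 : ℝ) ^ j) ^ (ε * a2)) * w j ^ s := by
  set G := ∑' j : ℕ, ENNReal.ofReal (((2 : ℝ) ^ j) ^ (-ε)) with hG
  have hGt : G ≠ ⊤ := geoE ε hε
  refine ⟨(1 + G) ^ a2, ENNReal.rpow_ne_top_of_nonneg ha2.le (by simp [hGt]), fun w s hs hsa => ?_⟩
  set S := ∑' j, ENNReal.ofReal (((2 : ℝ) ^ j) ^ (ε * a2)) * w j ^ s with hS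
  have h1 : ∀ j, w j ≤ ENNReal.ofReal (((2 : ℝ) ^ j) ^ (-ε)) * S ^ (1 / s) := by
    intro j
    have h2j : (1 : ℝ) ≤ 2 ^ j := one_le_pow₀ (by norm_num)
    have e1 : ENNReal.ofReal (((2 : ℝ) ^ j) ^ (ε * a2)) * w j ^ s ≤ S := ENNReal.le_tsum j
    have e2 : ENNReal.ofReal (((2 : ℝ) ^ j) ^ (ε * s)) * w j ^ s ≤ S := by
      refine le_trans ?_ e1
      gcongr
    have e3 := ENNReal.rpow_le_rpow e2 (by positivity : 0 ≤ 1 / s)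
    rw [ENNReal.mul_rpow_of_nonneg _ _ (by positivity), ← ENNReal.rpow_mul,
      mul_one_div_cancel hs.ne', ENNReal.rpow_one, ENNReal.ofReal_rpow_of_pos (by positivity),
      ← Real.rpow_mul (by positivity), mul_assoc, mul_one_div_cancel hs.ne', mul_one] at e3
    calc w j = ENNReal.ofReal (((2 : ℝ) ^ j) ^ (-ε)) * (ENNReal.ofReal (((2 : ℝ) ^ j) ^ ε) * w j) := by
          rw [← mul_assoc, ← ENNReal.ofReal_mul (by positivity), Real.rpow_neg (by positivity),
            inv_mul_cancel₀ (by positivity)]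
          simp
      _ ≤ _ := by gcongr
  have h2 : ∑' j, w j ≤ G * S ^ (1 / s) := by
    refine (ENNReal.tsum_le_tsum h1).trans ?_
    rw [ENNReal.tsum_mul_right]
  calc (∑' j, w j) ^ s ≤ (G * S ^ (1 / s)) ^ s := ENNReal.rpow_le_rpow h2 hs.le
    _ = G ^ s * S := by
      rw [ENNReal.mul_rpow_of_nonneg _ _ hs.le, ← ENNReal.rpow_mul, one_div_mul_cancel hs.ne',
        ENNReal.rpow_one]
    _ ≤ (1 + G) ^ s * S := by
      gcongr
      exact le_add_self
    _ ≤ (1 + G) ^ a2 * S := by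
      gcongr
      exact le_self_add

lemma lintegral_dil {n : ℕ} (Q : ℝ) (hQ : 0 < Q) (g : Rn n → ℝ≥0∞) (hg : Measurable g) :
    ∫⁻ x, g (Q • x) = ENNReal.ofReal (Q ^ (-(n : ℝ))) * ∫⁻ x, g x := by
  have h := lintegral_map (μ := (volume : Measure (Rn n))) hg (measurable_const_smul Q)
  rw [← h, Measure.map_addHaar_smul _ hQ.ne', lintegral_smul_measure, finrank_euclideanSpace,
    Fintype.card_fin, smul_eq_mul, abs_of_pos (by positivity), Real.rpow_neg hQ.le, Real.rpow_natCast]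

set_option maxHeartbeats 800000 in
lemma hardy {n : ℕ} (hn : 0 < n) (q : Rn n → ℝ) (hqm : Measurable q)
    (hloc : OscLoc q) (hinf : OscInf q)
    (a1 a2 : ℝ) (ha1 : 0 < a1) (h1 : ∀ x, a1 ≤ q x) (h2 : ∀ x, q x ≤ a2) (C0 : ℝ) (hC0 : 0 < C0) :
    ∃ B : ℝ≥0∞, B ≠ ⊤ ∧ ∀ H : Rn n → ℝ≥0∞, Measurable H → ∫⁻ x, H x ^ q x ≤ 1 →
      (∀ y, y ≠ 0 → ENNReal.ofReal (‖y‖ ^ n) * H y ^ q y ≤ ENNReal.ofReal C0) →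
      ∫⁻ x, (∑' j : ℕ, H ((2 : ℝ) ^ j • x)) ^ q x ≤ B := by
  obtain ⟨K, b, hK, hb, P⟩ := hardy_ptw hn q hloc hinf a1 a2 ha1 h1 h2 C0 hC0
  have hn' : (0 : ℝ) < n := by exact_mod_cast hn
  have ha2 : 0 < a2 := ha1.trans_le ((h1 0).trans (h2 0))
  set δ := min ((n : ℝ) / 2) b with hδ
  have hδ0 : 0 < δ := by positivity
  have hδ1 : δ ≤ n / 2 := min_le_left _ _
  have hδ2 : δ ≤ b := min_le_right _ _
  set ε := δ / (2 * a2) with hε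
  have hε0 : 0 < ε := by positivity
  have hεa : ε * a2 = δ / 2 := by rw [hε]; field_simp
  obtain ⟨B1, hB1, T⟩ := tsum_rpow_bound ε a2 hε0 ha2
  set V := volume (Metric.ball (0 : Rn n) 1) with hV
  have hV1 : V ≠ ⊤ := measure_ball_lt_top.ne
  set I := ∫⁻ x : Rn n, ENNReal.ofReal ((1 + ‖x‖) ^ (-((n : ℝ) + 1))) with hI
  have hI1 : I ≠ ⊤ := by
    apply (finite_integral_one_add_norm _).ne
    rw [finrank_euclideanSpace, Fintype.card_fin]
    linarith
  have hgeo := geoE (δ / 2) (by positivity)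
  refine ⟨B1 * ((ENNReal.ofReal K * (1 + V + I)) *
    ∑' j : ℕ, ENNReal.ofReal (((2 : ℝ) ^ j) ^ (-(δ / 2)))), ?_, ?_⟩
  · apply ENNReal.mul_ne_top hB1
    apply ENNReal.mul_ne_top _ hgeo
    apply ENNReal.mul_ne_top ENNReal.ofReal_ne_top
    simp [hV1, hI1]
  intro H hH hH1 hH2
  have hae : ∀ᵐ x : Rn n, x ≠ 0 := by
    have : Nonempty (Fin n) := ⟨⟨0, hn⟩⟩
    have : Nontrivial (Rn n) := inferInstance
    exact Measure.ae_ne volume _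
  have hmj : ∀ j : ℕ, Measurable fun x : Rn n => H ((2 : ℝ) ^ j • x) :=
    fun j => hH.comp (measurable_const_smul _)
  have hHq : Measurable fun x => H x ^ q x := hH.pow hqm
  have each : ∀ j : ℕ, ∫⁻ x, H ((2 : ℝ) ^ j • x) ^ q x ≤
      ENNReal.ofReal K * (1 + V + I) * ENNReal.ofReal (((2 : ℝ) ^ j) ^ (-δ)) := by
    intro j
    have h2j : (1 : ℝ) ≤ 2 ^ j := one_le_pow₀ (by norm_num)
    set Q : ℝ := 2 ^ j with hQ
    have hQ0 : 0 < Q := by positivity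
    have hb1 : ∫⁻ x, H (Q • x) ^ q x ≤ ∫⁻ x, ENNReal.ofReal K * (ENNReal.ofReal (Q ^ ((n : ℝ) / 2)) * H (Q • x) ^ q (Q • x) +
        (Metric.closedBall (0 : Rn n) (Q ^ (-(1 / 2) : ℝ))).indicator 1 x +
        ENNReal.ofReal (Q ^ (-b)) * ENNReal.ofReal ((1 + ‖x‖) ^ (-((n : ℝ) + 1)))) := by
      apply lintegral_mono_ae
      filter_upwards [hae] with x hx
      exact P x Q _ hx h2j (hH2 _ (smul_ne_zero hQ0.ne' hx))
    have hm1 : Measurable fun x : Rn n => ENNReal.ofReal (Q ^ ((n : ℝ) / 2)) * H (Q • x) ^ q (Q • x) :=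
      (hHq.comp (measurable_const_smul Q)).const_mul _
    have hm2 : Measurable fun x : Rn n =>
        (Metric.closedBall (0 : Rn n) (Q ^ (-(1 / 2) : ℝ))).indicator (1 : Rn n → ℝ≥0∞) x :=
      measurable_one.indicator Metric.isClosed_closedBall.measurableSet
    have hm12 : Measurable fun x : Rn n => ENNReal.ofReal (Q ^ ((n : ℝ) / 2)) * H (Q • x) ^ q (Q • x) +
        (Metric.closedBall (0 : Rn n) (Q ^ (-(1 / 2) : ℝ))).indicator (1 : Rn n → ℝ≥0∞) x :=
      hm1.add hm2
    have hcb : ∫⁻ x, (Metric.closedBall (0 : Rn n) (Q ^ (-(1 / 2) : ℝ))).indicator (1 : Rn n → ℝ≥0∞) x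
        = ENNReal.ofReal (Q ^ (-((n : ℝ) / 2))) * V := by
      rw [lintegral_indicator_one Metric.isClosed_closedBall.measurableSet,
        Measure.addHaar_closedBall _ _ (by positivity), finrank_euclideanSpace, Fintype.card_fin,
        ← Real.rpow_natCast, ← Real.rpow_mul hQ0.le]
      congr 3
      ring
    rw [lintegral_const_mul' _ _ ENNReal.ofReal_ne_top, lintegral_add_left hm12,
      lintegral_add_left hm1, lintegral_const_mul' _ _ ENNReal.ofReal_ne_top,
      lintegral_const_mul' _ _ ENNReal.ofReal_ne_top,
      lintegral_dil Q hQ0 (fun x => H x ^ q x) hHq, hcb, ← mul_assoc (ENNReal.ofReal _),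
      ← ENNReal.ofReal_mul (by positivity), ← Real.rpow_add hQ0] at hb1
    refine hb1.trans ?_
    rw [mul_assoc]
    gcongr
    have m1 : ENNReal.ofReal (Q ^ ((n : ℝ) / 2 + -(n : ℝ))) ≤ ENNReal.ofReal (Q ^ (-δ)) := by
      gcongr
      linarith
    have m2 : ENNReal.ofReal (Q ^ (-((n : ℝ) / 2))) ≤ ENNReal.ofReal (Q ^ (-δ)) := by
      gcongr
    have m3 : ENNReal.ofReal (Q ^ (-b)) ≤ ENNReal.ofReal (Q ^ (-δ)) := by
      gcongr
    calc _ ≤ ENNReal.ofReal (Q ^ (-δ)) * 1 + ENNReal.ofReal (Q ^ (-δ)) * V +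
          ENNReal.ofReal (Q ^ (-δ)) * I := by gcongr
      _ = _ := by ring
  calc ∫⁻ x, (∑' j : ℕ, H ((2 : ℝ) ^ j • x)) ^ q x
      ≤ ∫⁻ x, B1 * ∑' j : ℕ, ENNReal.ofReal (((2 : ℝ) ^ j) ^ (ε * a2)) * H ((2 : ℝ) ^ j • x) ^ q x :=
        lintegral_mono fun x => T _ _ (ha1.trans_le (h1 x)) (h2 x)
    _ = B1 * ∑' j : ℕ, ENNReal.ofReal (((2 : ℝ) ^ j) ^ (ε * a2)) * ∫⁻ x, H ((2 : ℝ) ^ j • x) ^ q x := by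
        rw [lintegral_const_mul' _ _ hB1, lintegral_tsum]
        · congr 2
          funext j
          rw [lintegral_const_mul' _ _ ENNReal.ofReal_ne_top]
        · intro j
          exact (((hmj j).pow hqm).const_mul _).aemeasurable
    _ ≤ B1 * ∑' j : ℕ, (ENNReal.ofReal K * (1 + V + I)) * ENNReal.ofReal (((2 : ℝ) ^ j) ^ (-(δ / 2))) := by
        refine mul_le_mul_right (ENNReal.tsum_le_tsum fun j => ?_) B1
        calc _ ≤ ENNReal.ofReal (((2 : ℝ) ^ j) ^ (ε * a2)) *
              (ENNReal.ofReal K * (1 + V + I) * ENNReal.ofReal (((2 : ℝ) ^ j) ^ (-δ))) := by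
              gcongr
              exact each j
          _ = (ENNReal.ofReal K * (1 + V + I)) * (ENNReal.ofReal (((2 : ℝ) ^ j) ^ (ε * a2)) *
              ENNReal.ofReal (((2 : ℝ) ^ j) ^ (-δ))) := by ring
          _ = _ := by
              rw [← ENNReal.ofReal_mul (by positivity), ← Real.rpow_add (by positivity), hεa]
              congr 3
              ring
    _ = _ := by rw [ENNReal.tsum_mul_left]

open MeasureTheory ENNReal

lemma mApp_mApp {n : ℕ} (A B : Matrix (Fin n) (Fin n) ℝ) (x : Rn n) :
    mApp A (mApp B x) = mApp (A * B) x := by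
  simp [mApp, Matrix.toEuclideanLin_apply, Matrix.mulVec_mulVec]

lemma mApp_one {n : ℕ} (x : Rn n) : mApp (1 : Matrix (Fin n) (Fin n) ℝ) x = x := by
  simp [mApp, Matrix.toEuclideanLin_apply]

lemma exists_equiv {n : ℕ} (A : Matrix (Fin n) (Fin n) ℝ) (hA : IsUnit A) :
    ∃ a : Rn n ≃L[ℝ] Rn n, ∀ y, a y = mApp A y := by
  obtain ⟨U, rfl⟩ := hA
  refine ⟨(LinearEquiv.ofLinear (Matrix.toEuclideanLin (U : Matrix (Fin n) (Fin n) ℝ))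
    (Matrix.toEuclideanLin ((U⁻¹ : (Matrix (Fin n) (Fin n) ℝ)ˣ) : Matrix (Fin n) (Fin n) ℝ))
    ?_ ?_).toContinuousLinearEquiv, fun y => rfl⟩
  · refine LinearMap.ext fun x => ?_
    have := mApp_mApp (U : Matrix (Fin n) (Fin n) ℝ)
      ((U⁻¹ : (Matrix (Fin n) (Fin n) ℝ)ˣ) : Matrix (Fin n) (Fin n) ℝ) x
    rw [Units.mul_inv, mApp_one] at this
    exact this
  · refine LinearMap.ext fun x => ?_
    have := mApp_mApp 
      ((U⁻¹ : (Matrix (Fin n) (Fin n) ℝ)ˣ) : Matrix (Fin n) (Fin n) ℝ) (U : Matrix (Fin n) (Fin n) ℝ) x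
    rw [Units.inv_mul, mApp_one] at this
    exact this

lemma exists_d {n m : ℕ} (A : Fin m → Matrix (Fin n) (Fin n) ℝ)
    (hAij : ∀ i j, i ≠ j → IsUnit (A i - A j)) (a : Fin m → (Rn n ≃L[ℝ] Rn n))
    (ha : ∀ i y, a i y = mApp (A i) y) :
    ∃ d : ℝ, 0 < d ∧ ∀ i l, i ≠ l → ∀ x, d * ‖x‖ ≤ ‖(a i).symm x - (a l).symm x‖ := by
  have h1 : ∀ s : Fin m × Fin m, ∃ K : ℝ, 0 < K ∧ (s.1 ≠ s.2 → ∀ x,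
      ‖x‖ ≤ K * ‖(a s.1).symm x - (a s.2).symm x‖) := by
    rintro ⟨i, l⟩
    by_cases hil : i = l
    · exact ⟨1, one_pos, fun h => absurd hil h⟩
    let T : Rn n →ₗ[ℝ] Rn n := ((a i).symm.toLinearEquiv : Rn n →ₗ[ℝ] Rn n) -
      ((a l).symm.toLinearEquiv : Rn n →ₗ[ℝ] Rn n)
    have hT : ∀ x, T x = (a i).symm x - (a l).symm x := fun x => rfl
    have hker : LinearMap.ker T = ⊥ := by
      rw [LinearMap.ker_eq_bot']
      intro x hx
      rw [hT, sub_eq_zero] at hx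
      have e1 : mApp (A i) ((a i).symm x) = x := by rw [← ha, ContinuousLinearEquiv.apply_symm_apply]
      have e2 : mApp (A l) ((a i).symm x) = x := by
        rw [hx, ← ha, ContinuousLinearEquiv.apply_symm_apply]
      have e3 : mApp (A i - A l) ((a i).symm x) = 0 := by
        unfold mApp at *
        rw [map_sub, LinearMap.sub_apply, e1, e2, sub_self]
      obtain ⟨b, hb⟩ := exists_equiv _ (hAij i l hil)
      rw [← hb] at e3
      have e4 : (a i).symm x = 0 := by simpa using e3
      simpa using e4
    obtain ⟨K, hK, hL⟩ := T.exists_antilipschitzWith hker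
    refine ⟨K, hK, fun _ x => ?_⟩
    have := hL.le_mul_dist x 0
    rw [map_zero, dist_zero_right, dist_zero_right, hT] at this
    exact this
  choose K hK0 hK using h1
  have hS : 0 ≤ ∑ s, K s := Finset.sum_nonneg fun s _ => (hK0 s).le
  refine ⟨(1 + ∑ s, K s)⁻¹, by positivity, fun i l hil x => ?_⟩
  rw [inv_mul_le_iff₀ (by positivity)]
  refine (hK (i, l) hil x).trans ?_
  gcongr
  have := Finset.single_le_sum (s := Finset.univ) (fun s _ => (hK0 s).le) (Finset.mem_univ (i, l))
  linarith

lemma cont_of_osc {n : ℕ} {p : Rn n → ℝ} (h : OscLoc p) : Continuous p := by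
  obtain ⟨c, hc, h⟩ := h
  rw [Metric.continuous_iff]
  intro x ε hε
  have hpos : 0 < c / ε := by positivity
  have hr : Real.exp (-(c / ε + 1)) < 1 / 2 := by
    rw [Real.exp_neg, one_div]
    apply inv_strictAnti₀ (by norm_num)
    have := Real.add_one_lt_exp (by positivity : c / ε + 1 ≠ 0)
    linarith
  refine ⟨Real.exp (-(c / ε + 1)), Real.exp_pos _, fun y hy => ?_⟩
  rw [dist_eq_norm] at hy
  have := h y x _ (Real.exp_pos _) hr hy.le
  rw [Real.log_exp, neg_neg] at this
  rw [Real.dist_eq]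
  by_contra hcon
  push Not at hcon
  have h2 : ε * (c / ε + 1) ≤ |p y - p x| * (c / ε + 1) := by gcongr
  have h3 : ε * (c / ε + 1) = c + ε := by field_simp
  linarith

lemma q_facts {n : ℕ} (hn : 0 < n) (α : ℝ) (hα0 : 0 ≤ α) (p q : Rn n → ℝ)
    (hploc : LogHolderLocal p) (hpinf : LogHolderInfty p)
    (pm pp : ℝ) (hpm : 0 < pm) (hpmle : ∀ x, pm ≤ p x) (hple : ∀ x, p x ≤ pp)
    (hpp : pp * α < n) (hq : ∀ x, 1 / q x = 1 / p x - α / n) :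
    OscLoc p ∧ OscLoc q ∧ OscInf q ∧ (∀ x, pm ≤ q x) ∧ (∀ x, q x ≤ pp * n / (n - pp * α)) ∧
    (∀ x, (1 - α * p x / n) * q x = p x) := by
  have hn' : (0 : ℝ) < n := by exact_mod_cast hn
  have hp0 : ∀ x, 0 < p x := fun x => hpm.trans_le (hpmle x)
  have hden : 0 < n - pp * α := by linarith
  have hdx : ∀ x, n - pp * α ≤ n - p x * α := by
    intro x
    have := mul_le_mul_of_nonneg_right (hple x) hα0
    linarith
  have hqe : ∀ x, q x = p x * n / (n - p x * α) := by
    intro x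
    have h1 := hq x
    have hx := hp0 x
    have hd : 0 < n - p x * α := hden.trans_le (hdx x)
    have h2 : 1 / p x - α / n = (n - p x * α) / (p x * n) := by field_simp
    rw [h2] at h1
    rw [← one_div_one_div (q x), h1, one_div_div]
  have hdiff : ∀ x y, |q x - q y| ≤ n ^ 2 / (n - pp * α) ^ 2 * |p x - p y| := by
    intro x y
    have hd : 0 < n - p x * α := hden.trans_le (hdx x)
    have hd' : 0 < n - p y * α := hden.trans_le (hdx y)
    have e : q x - q y = n ^ 2 / ((n - p x * α) * (n - p y * α)) * (p x - p y) := by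
      rw [hqe, hqe, div_sub_div _ _ hd.ne' hd'.ne', div_mul_eq_mul_div]
      congr 1
      ring
    rw [e, abs_mul, abs_of_pos (by positivity), sq (n - pp * α)]
    have h1 := hdx x
    have h2 := hdx y
    gcongr
  have ol := osc_loc hploc
  have oi := osc_inf hpinf
  refine ⟨ol, ?_, ?_, ?_, ?_, ?_⟩
  · obtain ⟨c, hc, h⟩ := ol
    refine ⟨n ^ 2 / (n - pp * α) ^ 2 * c, by positivity, fun x y r hr hr2 hxy => ?_⟩
    have hl : 0 ≤ -Real.log r := by
      have := Real.log_nonpos hr.le (by linarith)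
      linarith
    have h1 := mul_le_mul_of_nonneg_right (hdiff x y) hl
    have h2 := mul_le_mul_of_nonneg_left (h x y r hr hr2 hxy)
      (by positivity : 0 ≤ (n : ℝ) ^ 2 / (n - pp * α) ^ 2)
    linarith
  · obtain ⟨c, hc, h⟩ := oi
    refine ⟨n ^ 2 / (n - pp * α) ^ 2 * c, by positivity, fun x y hxy => ?_⟩
    have hl : 0 ≤ Real.log (Real.exp 1 + ‖x‖) := by
      apply Real.log_nonneg
      have : 1 ≤ Real.exp 1 := Real.one_le_exp (by norm_num)
      linarith [norm_nonneg x]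
    have h1 := mul_le_mul_of_nonneg_right (hdiff x y) hl
    have h2 := mul_le_mul_of_nonneg_left (h x y hxy)
      (by positivity : 0 ≤ (n : ℝ) ^ 2 / (n - pp * α) ^ 2)
    linarith
  · intro x
    have hd : 0 < n - p x * α := hden.trans_le (hdx x)
    rw [hqe, le_div_iff₀ hd]
    have := hp0 x
    have h3 : 0 ≤ p x * α := by positivity
    calc pm * (n - p x * α) ≤ pm * n := by gcongr; linarith
      _ ≤ p x * n := by gcongr; exact hpmle x
  · intro x
    rw [hqe]
    have h1 := hdx x
    have h2 := hple x
    have h3 := (hp0 x).le.trans h2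
    gcongr
  · intro x
    have hd : 0 < n - p x * α := hden.trans_le (hdx x)
    rw [hqe]
    have e1 : 1 - α * p x / n = (n - p x * α) / n := by
      rw [sub_div, div_self hn'.ne', mul_comm α]
    rw [e1, div_mul_div_comm, div_eq_iff (by positivity)]
    ring

lemma loc_int {n m : ℕ} (hn : 0 < n) (a : Fin m → (Rn n ≃L[ℝ] Rn n)) (αe : Fin m → ℝ)
    (hαe : ∀ i, 0 < αe i) (f : Rn n → ℝ) (x : Rn n)
    (h : Integrable (fun y => (∏ l, ‖x - a l y‖ ^ (-(αe l))) * f y)) : LocallyIntegrable f := by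
  rw [locallyIntegrable_iff]
  intro k hk
  have hc : Continuous fun y => ∏ l, ‖x - a l y‖ ^ (αe l) := by
    apply continuous_finset_prod
    intro l _
    apply Continuous.rpow_const (by fun_prop)
    intro y
    exact Or.inr (hαe l).le
  have h1 := (h.integrableOn (s := k)).continuousOn_mul hc.continuousOn hk
  refine h1.congr (ae_restrict_of_ae ?_)
  have hnull : ∀ᵐ y : Rn n, ∀ i, y ≠ (a i).symm x := by
    have : Nonempty (Fin n) := ⟨⟨0, hn⟩⟩
    have : Nontrivial (Rn n) := inferInstance
    rw [ae_all_iff]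
    intro i
    exact Measure.ae_ne volume _
  filter_upwards [hnull] with y hy
  rw [← mul_assoc, ← Finset.prod_mul_distrib, Finset.prod_eq_one, one_mul]
  intro l _
  have : 0 < ‖x - a l y‖ := by
    apply norm_pos_iff.2
    rw [sub_ne_zero]
    intro hh
    apply hy l
    rw [hh, ContinuousLinearEquiv.symm_apply_apply]
  rw [← Real.rpow_add this]
  simp

lemma lintegral_cov {n : ℕ} (a : Rn n ≃L[ℝ] Rn n) : ∃ c : ℝ≥0∞, c ≠ ⊤ ∧ ∀ g : Rn n → ℝ≥0∞, Measurable g →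
    ∫⁻ x, g (a x) = c * ∫⁻ x, g x := by
  have hdet : LinearMap.det (a.toLinearEquiv : Rn n →ₗ[ℝ] Rn n) ≠ 0 :=
    (LinearEquiv.isUnit_det' a.toLinearEquiv).ne_zero
  refine ⟨ENNReal.ofReal |(LinearMap.det (a.toLinearEquiv : Rn n →ₗ[ℝ] Rn n))⁻¹|, ENNReal.ofReal_ne_top, fun g hg => ?_⟩
  · have h := lintegral_map (μ := (volume : Measure (Rn n))) hg a.continuous.measurable
    rw [← h]
    have h2 := Measure.map_linearMap_addHaar_eq_smul_addHaar (volume : Measure (Rn n)) hdet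
    have h3 : (⇑(a.toLinearEquiv : Rn n →ₗ[ℝ] Rn n)) = ⇑a := rfl
    rw [h3] at h2
    rw [h2, lintegral_smul_measure, smul_eq_mul]

lemma sum_rpow_bound {m : ℕ} (K : ℝ≥0∞) (a2 : ℝ) (w : Fin m → ℝ≥0∞) (s : ℝ≥0∞) (q : ℝ) (hq : 0 < q)
    (hqa : q ≤ a2) : (K * (∑ i, w i + s)) ^ q ≤ ((1 + K) * (m + 1)) ^ a2 * (∑ i, w i ^ q + s ^ q) := by
  set X := ∑ i, w i ^ q + s ^ q with hX
  have h0 : ∀ v : ℝ≥0∞, v ^ q ≤ X → v ≤ X ^ (1 / q) := by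
    intro v hv
    have := ENNReal.rpow_le_rpow hv (by positivity : 0 ≤ 1 / q)
    rwa [← ENNReal.rpow_mul, mul_one_div_cancel hq.ne', ENNReal.rpow_one] at this
  have h1 : ∀ i, w i ≤ X ^ (1 / q) := fun i => h0 _
    ((Finset.single_le_sum (f := fun i => w i ^ q) (fun _ _ => by positivity) (Finset.mem_univ i)).trans le_self_add)
  have h2 : s ≤ X ^ (1 / q) := h0 _ le_add_self
  have h3 : ∑ i, w i + s ≤ (m + 1) * X ^ (1 / q) := by
    calc ∑ i, w i + s ≤ ∑ _i : Fin m, X ^ (1 / q) + X ^ (1 / q) :=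
          add_le_add (Finset.sum_le_sum fun i _ => h1 i) h2
      _ = _ := by simp [add_mul]
  calc (K * (∑ i, w i + s)) ^ q ≤ ((1 + K) * ((m + 1) * X ^ (1 / q))) ^ q := by
        apply ENNReal.rpow_le_rpow _ hq.le
        gcongr
        exact le_add_self
    _ = ((1 + K) * (m + 1)) ^ q * X := by
        rw [← mul_assoc, ENNReal.mul_rpow_of_nonneg _ _ hq.le, ← ENNReal.rpow_mul,
          one_div_mul_cancel hq.ne', ENNReal.rpow_one]
    _ ≤ _ := by
        gcongr
        have e1 : (1 : ℝ≥0∞) ≤ 1 + K := le_self_add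
        have e2 : (1 : ℝ≥0∞) ≤ m + 1 := le_add_self
        calc (1 : ℝ≥0∞) = 1 * 1 := by simp
          _ ≤ _ := by gcongr

open MeasureTheory ENNReal

lemma G_measurable {n : ℕ} (F : Rn n → ℝ≥0∞) :
    Measurable (fun y : Rn n => ⨅ (z : Rn n) (_ : ‖z‖ ≤ 2 * ‖y‖), F z) := by
  have h1 : Antitone (fun s : ℝ => ⨅ (z : Rn n) (_ : ‖z‖ ≤ 2 * s), F z) := by
    intro s t hst
    refine le_iInf₂ fun z hz => iInf₂_le z (by linarith)
  exact h1.measurable.comp measurable_norm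

set_option maxHeartbeats 1000000 in
lemma core {n m : ℕ} (hn : 0 < n)
    (a : Fin m → (Rn n ≃L[ℝ] Rn n)) (d : ℝ) (hd0 : 0 < d)
    (hd : ∀ i l, i ≠ l → ∀ x, d * ‖x‖ ≤ ‖(a i).symm x - (a l).symm x‖)
    (α : ℝ) (hα0 : 0 ≤ α)
    (αe : Fin m → ℝ) (hαe : ∀ i, 0 < αe i) (hsum : ∑ i, αe i = (n : ℝ) - α)
    (hlt : ∀ i, αe i < ∑ i, αe i)
    (p q : Rn n → ℝ)
    (hploc : LogHolderLocal p) (hpinf : LogHolderInfty p)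
    (pm pp : ℝ) (hpm : 0 < pm) (hpmle : ∀ x, pm ≤ p x) (hple : ∀ x, p x ≤ pp)
    (hpp : pp * α < n)
    (hpA : ∀ i, ∀ x : Rn n, p ((a i).symm x) = p x)
    (hq : ∀ x, 1 / q x = 1 / p x - α / n) (N : ℕ) :
    ∃ M0 : ℝ≥0∞, M0 ≠ ⊤ ∧ ∀ f : Rn n → ℝ, ∀ lam : ℝ, 0 < lam →
      ∫⁻ x, (grandMax n N f x / ENNReal.ofReal lam) ^ p x ≤ 1 →
      ∫⁻ x, (ENNReal.ofReal |∫ y, (∏ l, ‖x - a l y‖ ^ (-(αe l))) * f y| / ENNReal.ofReal lam) ^ q x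
        ≤ M0 := by
  have hn' : (0 : ℝ) < n := by exact_mod_cast hn
  have hp0 : ∀ x, 0 < p x := fun x => hpm.trans_le (hpmle x)
  obtain ⟨pol, qol, qoi, hq1, hq2, hqt⟩ :=
    q_facts hn α hα0 p q hploc hpinf pm pp hpm hpmle hple hpp hq
  have hpα : ∀ x, p x * α < n := fun x =>
    (mul_le_mul_of_nonneg_right (hple x) hα0).trans_lt hpp
  have hq0 : ∀ x, 0 < q x := fun x => hpm.trans_le (hq1 x)
  have pmeas : Measurable p := (cont_of_osc pol).measurable
  have qmeas : Measurable q := (cont_of_osc qol).measurable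
  obtain ⟨Cn, hCn, hnear⟩ := near p hploc hpinf pm pp hpm hpmle hple
  set C' : ℝ := 2 ^ n * Cn with hC'
  have hC'0 : 0 < C' := by positivity
  have hCC' : Cn ≤ C' := by
    have : (1 : ℝ) ≤ 2 ^ n := one_le_pow₀ (by norm_num)
    nlinarith
  obtain ⟨Cd, hCd, hdec⟩ := decomp hn N a αe d hd0 hd α hα0 hsum hlt
  obtain ⟨B, hB, hHardy⟩ := hardy hn q qmeas qol qoi pm (pp * n / (n - pp * α)) hpm hq1 hq2 C' hC'0
  choose c hc hcov using fun i => lintegral_cov (a i).symm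
  set Cf : ℝ≥0∞ := ENNReal.ofReal (C' ^ (α / n)) with hCf
  set K : ℝ≥0∞ := ENNReal.ofReal Cd * Cf with hK
  have hKt : K ≠ ⊤ := ENNReal.mul_ne_top ENNReal.ofReal_ne_top ENNReal.ofReal_ne_top
  set a2 := pp * n / (n - pp * α) with ha2
  have ha20 : 0 ≤ a2 := (hq0 0).le.trans (hq2 0)
  set L : ℝ≥0∞ := ((1 + K) * (m + 1)) ^ a2 with hL
  have hLt : L ≠ ⊤ := by
    refine ENNReal.rpow_ne_top_of_nonneg ha20 (ENNReal.mul_ne_top ?_ ?_)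
    · exact ENNReal.add_ne_top.2 ⟨one_ne_top, hKt⟩
    · exact ENNReal.add_ne_top.2 ⟨ENNReal.natCast_ne_top m, one_ne_top⟩
  refine ⟨L * (∑ i, c i + B), ENNReal.mul_ne_top hLt (ENNReal.add_ne_top.2
    ⟨ENNReal.sum_ne_top.2 fun i _ => hc i, hB⟩), fun f lam hlam hf => ?_⟩
  by_cases hex : ∃ x, Integrable (fun y => (∏ l, ‖x - a l y‖ ^ (-(αe l))) * f y)
  swap
  · push Not at hex
    have : ∀ x, (ENNReal.ofReal |∫ y, (∏ l, ‖x - a l y‖ ^ (-(αe l))) * f y| /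
        ENNReal.ofReal lam) ^ q x = 0 := by
      intro x
      rw [integral_undef (hex x)]
      simp [hq0 x]
    simp [this]
  obtain ⟨x0, hx0⟩ := hex
  have hli := loc_int hn a αe hαe f x0 hx0
  have hcm := cMax_measurable n N f hli
  set Λ : ℝ≥0∞ := ENNReal.ofReal lam with hΛ
  have hΛ0 : Λ ≠ 0 := by simpa [hΛ] using hlam
  have hΛt : Λ ≠ ⊤ := ENNReal.ofReal_ne_top
  set F : Rn n → ℝ≥0∞ := fun z => cMax n N f z / Λ with hF
  have hFm : Measurable F := hcm.div_const _
  have hF1 : ∫⁻ x, F x ^ p x ≤ 1 := by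
    refine le_trans (lintegral_mono fun x => ?_) hf
    apply ENNReal.rpow_le_rpow _ (hp0 x).le
    exact ENNReal.div_le_div_right (cMax_le n N f x) _
  set G : Rn n → ℝ≥0∞ := fun y => ⨅ (z : Rn n) (_ : ‖z‖ ≤ 2 * ‖y‖), F z with hG
  have hGm : Measurable G := G_measurable F
  have hGF : ∀ y, G y ≤ F y := fun y => iInf₂_le y (by linarith [norm_nonneg y])
  have hGn : ∀ y, y ≠ 0 → ENNReal.ofReal (‖y‖ ^ n) * G y ^ p y ≤ ENNReal.ofReal C' := by
    intro y hy
    have hy0 : 0 < ‖y‖ := norm_pos_iff.2 hy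
    have h1 := hnear F hF1 y (‖y‖ / 2) (G y) (by positivity) le_rfl (fun z hz => iInf₂_le z (by
      have := norm_sub_norm_le z y
      linarith))
    have e : ‖y‖ ^ n = 2 ^ n * (‖y‖ / 2) ^ n := by rw [← mul_pow]; congr 1; ring
    rw [e, hC', ENNReal.ofReal_mul (by positivity), ENNReal.ofReal_mul (by positivity), mul_assoc]
    gcongr
  set H : Rn n → ℝ≥0∞ := fun y => G y ^ (1 - α * p y / n) with hH
  have hHm : Measurable H := hGm.pow (by fun_prop)
  have hHq : ∀ y, H y ^ q y = G y ^ p y := by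
    intro y
    rw [hH]
    simp only
    rw [← ENNReal.rpow_mul, hqt]
  have hHI := hHardy H hHm (by
    refine le_trans (lintegral_mono fun x => ?_) hF1
    simp only [hHq]
    exact ENNReal.rpow_le_rpow (hGF x) (hp0 x).le) (fun y hy => by rw [hHq]; exact hGn y hy)
  have hmul : ∀ l : ℝ≥0∞, Λ * (l / Λ) = l := fun l => ENNReal.mul_div_cancel hΛ0 hΛt
  set w : Fin m → Rn n → ℝ≥0∞ := fun i u => F u ^ (1 - α * p u / n) with hw
  -- pointwise bound
  have hpt : ∀ x, x ≠ 0 → ENNReal.ofReal |∫ y, (∏ l, ‖x - a l y‖ ^ (-(αe l))) * f y| / Λ ≤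
      K * (∑ i, w i ((a i).symm x) + ∑' j : ℕ, H ((2 : ℝ) ^ j • x)) := by
    intro x hx
    by_cases hint : Integrable (fun y => (∏ l, ‖x - a l y‖ ^ (-(αe l))) * f y)
    swap
    · rw [integral_undef hint]
      simp
    have h := hdec f x hx hint (fun i => Λ * (Cf * w i ((a i).symm x)))
      (fun j => Λ * (Cf * H ((2 : ℝ) ^ j • x))) ?_ ?_
    · rw [← Finset.mul_sum, ← Finset.mul_sum, ENNReal.tsum_mul_left, ENNReal.tsum_mul_left,
        ← mul_add, ← mul_add] at h
      rw [ENNReal.div_le_iff hΛ0 hΛt]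
      refine h.trans (le_of_eq ?_)
      rw [hK]
      ring
    · intro i ρ l hρ hρ2 hz
      have h1 := hnear F hF1 ((a i).symm x) ρ (l / Λ) hρ hρ2
        (fun z hzz => ENNReal.div_le_div_right (hz z hzz) _)
      have h2 := near_frac hn α (p ((a i).symm x)) hα0 (hp0 _) (hpα _) C' ρ hC'0 hρ _
        (h1.trans (ENNReal.ofReal_le_ofReal hCC'))
      have h3 : l / Λ ≤ F ((a i).symm x) :=
        ENNReal.div_le_div_right (hz _ (by simpa using hρ.le)) _
      have hθ : 0 ≤ 1 - α * p ((a i).symm x) / n := by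
        have : α * p ((a i).symm x) / n ≤ 1 := by
          rw [div_le_one hn']
          linarith [hpα ((a i).symm x)]
        linarith
      calc ENNReal.ofReal (ρ ^ α) * l = Λ * (ENNReal.ofReal (ρ ^ α) * (l / Λ)) := by
            rw [← mul_assoc, mul_comm Λ, mul_assoc, hmul]
        _ ≤ Λ * (Cf * (l / Λ) ^ (1 - α * p ((a i).symm x) / n)) := by gcongr
        _ ≤ _ := by
            simp only [hw]
            gcongr
    · intro j l hz
      set y : Rn n := (2 : ℝ) ^ j • x with hy
      have hyn : ‖y‖ = 2 ^ j * ‖x‖ := by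
        rw [hy, norm_smul]; simp
      have hy0 : y ≠ 0 := smul_ne_zero (by positivity) hx
      rw [← hyn] at hz ⊢
      have h3 : l / Λ ≤ G y := le_iInf₂ fun z hzz => ENNReal.div_le_div_right (hz z hzz) _
      have h2 := near_frac hn α (p y) hα0 (hp0 _) (hpα _) C' ‖y‖ hC'0 (norm_pos_iff.2 hy0) _
        (hGn y hy0)
      calc ENNReal.ofReal (‖y‖ ^ α) * l = Λ * (ENNReal.ofReal (‖y‖ ^ α) * (l / Λ)) := by
            rw [← mul_assoc, mul_comm Λ, mul_assoc, hmul]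
        _ ≤ Λ * (ENNReal.ofReal (‖y‖ ^ α) * G y) := by gcongr
        _ ≤ _ := by gcongr
  have hqA : ∀ i x, q ((a i).symm x) = q x := by
    intro i x
    have h1 := hq ((a i).symm x)
    rw [hpA, ← hq x] at h1
    rw [← one_div_one_div (q x), ← h1, one_div_one_div]
  have hwq : ∀ i x, (w i ((a i).symm x)) ^ q x = (fun u => F u ^ p u) ((a i).symm x) := by
    intro i x
    simp only [hw]
    rw [← ENNReal.rpow_mul, ← hqA i x, hqt]
  have hne : ∀ᵐ x : Rn n, x ≠ 0 := by
    have : Nonempty (Fin n) := ⟨⟨0, hn⟩⟩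
    have : Nontrivial (Rn n) := inferInstance
    exact Measure.ae_ne volume _
  have hFpm : Measurable (fun u => F u ^ p u) := hFm.pow pmeas
  calc ∫⁻ x, (ENNReal.ofReal |∫ y, (∏ l, ‖x - a l y‖ ^ (-(αe l))) * f y| / Λ) ^ q x
      ≤ ∫⁻ x, L * (∑ i, (fun u => F u ^ p u) ((a i).symm x) +
          (∑' j : ℕ, H ((2 : ℝ) ^ j • x)) ^ q x) := by
        apply lintegral_mono_ae
        filter_upwards [hne] with x hx
        refine (ENNReal.rpow_le_rpow (hpt x hx) (hq0 x).le).trans ?_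
        refine (sum_rpow_bound K a2 _ _ (q x) (hq0 x) (hq2 x)).trans (le_of_eq ?_)
        simp only [hwq]
        rfl
    _ = L * ((∑ i, ∫⁻ x, (fun u => F u ^ p u) ((a i).symm x)) +
          ∫⁻ x, (∑' j : ℕ, H ((2 : ℝ) ^ j • x)) ^ q x) := by
        rw [lintegral_const_mul' _ _ hLt, lintegral_add_left, lintegral_finsetSum]
        · intro i _
          exact hFpm.comp (a i).symm.continuous.measurable
        · exact Finset.measurable_fun_sum _ fun i _ => hFpm.comp (a i).symm.continuous.measurable
    _ ≤ L * (∑ i, c i + B) := by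
        refine mul_le_mul_right (add_le_add (Finset.sum_le_sum fun i _ => ?_) hHI) _
        rw [hcov i _ hFpm]
        exact mul_le_of_le_one_right' hF1

lemma norm_conclude {n : ℕ} (p q : Rn n → ℝ) (pm : ℝ) (hpm : 0 < pm) (hq1 : ∀ x, pm ≤ q x)
    (M0 : ℝ≥0∞) (hM0 : M0 ≠ ⊤) :
    ∃ C > 0, ∀ (g : Rn n → ℝ≥0∞) (X : Rn n → ℝ≥0∞),
      (∀ lam : ℝ, 0 < lam → ∫⁻ x, (g x / ENNReal.ofReal lam) ^ p x ≤ 1 →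
        ∫⁻ x, (X x / ENNReal.ofReal lam) ^ q x ≤ M0) →
      varLpNormE q X ≤ ENNReal.ofReal C * varLpNormE p g := by
  set R : ℝ := 1 + M0.toReal with hR
  have hR1 : 1 ≤ R := by simp [hR]
  have hR0 : 0 < R := by linarith
  set C : ℝ := R ^ (1 / pm) with hC
  have hC1 : 1 ≤ C := Real.one_le_rpow hR1 (by positivity)
  have hC0 : 0 < C := by linarith
  have hCp : C ^ pm = R := by
    rw [hC, ← Real.rpow_mul hR0.le, one_div_mul_cancel hpm.ne', Real.rpow_one]
  have hMR : M0 ≤ ENNReal.ofReal R := by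
    rw [← ENNReal.ofReal_toReal hM0]
    exact ENNReal.ofReal_le_ofReal (by simp [hR])
  have hO0 : ENNReal.ofReal C ≠ 0 := by simpa using hC0
  refine ⟨C, hC0, fun g X h => ?_⟩
  rw [← ENNReal.div_le_iff' hO0 ENNReal.ofReal_ne_top]
  refine le_sInf ?_
  rintro l ⟨lam, hlam, rfl, hI⟩
  rw [ENNReal.div_le_iff' hO0 ENNReal.ofReal_ne_top]
  refine sInf_le ⟨C * lam, by positivity, (ENNReal.ofReal_mul hC0.le).symm, ?_⟩
  have hM := h lam hlam hI
  have hinv : ENNReal.ofReal R⁻¹ ≠ ⊤ := ENNReal.ofReal_ne_top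
  calc ∫⁻ x, (X x / ENNReal.ofReal (C * lam)) ^ q x
      ≤ ∫⁻ x, ENNReal.ofReal R⁻¹ * (X x / ENNReal.ofReal lam) ^ q x := by
        refine lintegral_mono fun x => ?_
        have hqx : 0 < q x := hpm.trans_le (hq1 x)
        have e : X x / ENNReal.ofReal (C * lam) =
            ENNReal.ofReal C⁻¹ * (X x / ENNReal.ofReal lam) := by
          rw [ENNReal.ofReal_mul hC0.le, div_eq_mul_inv, div_eq_mul_inv,
            ENNReal.mul_inv (Or.inl hO0) (Or.inl ENNReal.ofReal_ne_top),
            ENNReal.ofReal_inv_of_pos hC0]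
          ring
        simp only
        rw [e, ENNReal.mul_rpow_of_nonneg _ _ hqx.le]
        gcongr
        rw [ENNReal.ofReal_rpow_of_pos (by positivity)]
        apply ENNReal.ofReal_le_ofReal
        rw [Real.inv_rpow hC0.le, ← hCp]
        gcongr
        exact hq1 x
    _ = ENNReal.ofReal R⁻¹ * ∫⁻ x, (X x / ENNReal.ofReal lam) ^ q x :=
        lintegral_const_mul' _ _ hinv
    _ ≤ ENNReal.ofReal R⁻¹ * ENNReal.ofReal R := by
        gcongr
        exact hM.trans hMR
    _ = 1 := by
        rw [← ENNReal.ofReal_mul (by positivity), inv_mul_cancel₀ hR0.ne', ENNReal.ofReal_one]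

theorem fractional_operator_Hp_to_Lq
    {n m : ℕ} (hn : 0 < n) (hm : 1 < m)
    (A : Fin m → Matrix (Fin n) (Fin n) ℝ)
    (hA : ∀ i, IsUnit (A i))
    (hAij : ∀ i j, i ≠ j → IsUnit (A i - A j))
    (α : ℝ) (hα0 : 0 ≤ α) (hαn : α < n)
    (αe : Fin m → ℝ) (hαe : ∀ i, 0 < αe i) (hsum : ∑ i, αe i = (n : ℝ) - α)
    (p q : Rn n → ℝ)
    (hploc : LogHolderLocal p) (hpinf : LogHolderInfty p)
    (pm pp : ℝ) (hpm : 0 < pm) (hpmle : ∀ x, pm ≤ p x) (hple : ∀ x, p x ≤ pp)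
    (hpp : pp * α < n)
    (hpA : ∀ i, ∀ x : Rn n, p (mApp (A i) x) = p x)
    (hq : ∀ x, 1 / q x = 1 / p x - α / n) :
    ∃ N₀ : ℕ, ∀ N ≥ N₀, ∃ C > 0, ∀ f : Rn n → ℝ, Measurable f →
      varLpNorm q (Tα A αe f) ≤ ENNReal.ofReal C * hardyNorm p N f := by
  refine ⟨0, fun N _ => ?_⟩
  choose a ha using fun i => exists_equiv (A i) (hA i)
  obtain ⟨d, hd0, hd⟩ := exists_d A hAij a ha
  have hlt : ∀ i, αe i < ∑ i, αe i := by
    intro i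
    have : Nontrivial (Fin m) := Fin.nontrivial_iff_two_le.2 hm
    obtain ⟨j, hj⟩ := exists_ne i
    exact Finset.single_lt_sum hj (Finset.mem_univ i) (Finset.mem_univ j) (hαe j)
      (fun k _ _ => (hαe k).le)
  have hpA' : ∀ i, ∀ x : Rn n, p ((a i).symm x) = p x := by
    intro i x
    rw [← hpA i, ← ha, ContinuousLinearEquiv.apply_symm_apply]
  obtain ⟨M0, hM0, hcore⟩ := core hn a d hd0 hd α hα0 αe hαe hsum hlt p q hploc hpinf pm pp hpm
    hpmle hple hpp hpA' hq N
  have hq1 := (q_facts hn α hα0 p q hploc hpinf pm pp hpm hpmle hple hpp hq).2.2.2.1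
  obtain ⟨C, hC, hfin⟩ := norm_conclude p q pm hpm hq1 M0 hM0
  refine ⟨C, hC, fun f _ => ?_⟩
  refine hfin (grandMax n N f) _ fun lam hlam hI => ?_
  have := hcore f lam hlam hI
  simp only [ha] at this
  exact this
end

section
/- Let 0 < α < n and let I_α be the Riesz potential I_α f(x) = ∫_{ℝⁿ} |x−y|^{α−n} f(y) dy. Suppose p : ℝⁿ → (0,∞) satisfies the local log-Hölder condition and the log-Hölder condition at infinity, and 0 < p₋ ≤ p₊ < n/α. Define q by 1/q(x) = 1/p(x) − α/n. Then I_α extends to a bounded operator from H^{p(·)}(ℝⁿ) to L^{q(·)}(ℝⁿ): there is a constant C such that ‖I_α f‖_{q(·)} ≤ C ‖f‖_{H^{p(·)}} for all f ∈ H^{p(·)}(ℝⁿ). -/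
open MeasureTheory ENNReal

/-! ### Analytic core -/

lemma aux_ball {n : ℕ} (p : Rn n → ℝ) (G : Rn n → ℝ≥0∞) (hG : ∫⁻ x, G x ^ p x ≤ 1)
    (hp : ∀ x, 0 < p x) (z : Rn n) (r : ℝ) (hr : 0 < r) (m : ℝ) (hm : 0 < m)
    (hmG : ∀ y ∈ Metric.closedBall z r, ENNReal.ofReal m ≤ G y) (s : ℝ)
    (hs : ∀ y ∈ Metric.closedBall z r, s ≤ p y * Real.log m) :
    s ≤ -(n * Real.log r + Real.log (volume (Metric.ball (0 : Rn n) 1)).toReal) := by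
  set v := (volume (Metric.ball (0 : Rn n) 1)).toReal with hv
  have hvtop : volume (Metric.ball (0 : Rn n) 1) ≠ ⊤ := measure_ball_lt_top.ne
  have hv0 : 0 < v := ENNReal.toReal_pos (Metric.measure_ball_pos volume _ one_pos).ne' hvtop
  have hvol : volume (Metric.closedBall z r) = ENNReal.ofReal (r ^ n * v) := by
    rw [Measure.addHaar_closedBall volume z hr.le, finrank_euclideanSpace_fin,
      ENNReal.ofReal_mul (by positivity), hv, ENNReal.ofReal_toReal hvtop]
  have h1 : ENNReal.ofReal (Real.exp s) * volume (Metric.closedBall z r) ≤ 1 := by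
    rw [← setLIntegral_const]
    refine le_trans (setLIntegral_mono' Metric.isClosed_closedBall.measurableSet ?_)
      ((setLIntegral_le_lintegral _ _).trans hG)
    intro y hy
    calc ENNReal.ofReal (Real.exp s) ≤ ENNReal.ofReal (m ^ p y) := by
          apply ENNReal.ofReal_le_ofReal
          rw [Real.rpow_def_of_pos hm]
          exact Real.exp_le_exp.2 (by linarith [hs y hy])
      _ = ENNReal.ofReal m ^ p y := by rw [ENNReal.ofReal_rpow_of_pos hm]
      _ ≤ G y ^ p y := ENNReal.rpow_le_rpow (hmG y hy) (hp y).le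
  rw [hvol, ← ENNReal.ofReal_mul (Real.exp_pos s).le, ENNReal.ofReal_le_one] at h1
  have h2 := Real.log_nonpos (by positivity) h1
  rw [Real.log_mul (by positivity) (by positivity), Real.log_exp,
    Real.log_mul (by positivity) (by positivity), Real.log_pow] at h2
  linarith

lemma aux_small {n : ℕ} (p : Rn n → ℝ) (hploc : LogHolderLocal p)
    (pm : ℝ) (hpm : 0 < pm) (hpmle : ∀ x, pm ≤ p x) :
    ∃ C : ℝ, 0 ≤ C ∧ ∀ G : Rn n → ℝ≥0∞, ∫⁻ x, G x ^ p x ≤ 1 → ∀ x : Rn n, ∀ t : ℝ, 0 < t → t ≤ 1 →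
      ∀ m : ℝ, 0 < m → (∀ y ∈ Metric.closedBall x t, ENNReal.ofReal m ≤ G y) →
      Real.log m ≤ C - n / p x * Real.log t := by
  obtain ⟨c, hc, hloc⟩ := hploc
  set V := Real.log (volume (Metric.ball (0 : Rn n) 1)).toReal with hV
  -- K such that log m ≤ K log (4/t)
  set K := (n + |V|) / pm with hK
  have hK0 : 0 ≤ K := by positivity
  refine ⟨(c * K + n * Real.log 4 + |V|) / pm, by positivity, ?_⟩
  intro G hG x t ht ht1 m hm hmG
  have hp : ∀ x, 0 < p x := fun x => hpm.trans_le (hpmle x)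
  have hpx := hp x
  have hlogt : Real.log t ≤ 0 := Real.log_nonpos ht.le ht1
  have hl4 : 1 ≤ Real.log 4 := by
    rw [Real.le_log_iff_exp_le (by norm_num)]
    linarith [Real.exp_one_lt_d9]
  have hlog : Real.log (t / 4) = Real.log t - Real.log 4 := Real.log_div ht.ne' (by norm_num)
  by_cases hL : Real.log m ≤ 0
  · have h1 : 0 ≤ (c * K + n * Real.log 4 + |V|) / pm := by positivity
    have h2 : n / p x * Real.log t ≤ 0 := mul_nonpos_of_nonneg_of_nonpos (by positivity) hlogt
    linarith
  push Not at hL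
  have hsub : ∀ y ∈ Metric.closedBall x (t / 4), ENNReal.ofReal m ≤ G y := fun y hy =>
    hmG y (Metric.closedBall_subset_closedBall (by linarith) hy)
  have h1 := aux_ball p G hG hp x (t / 4) (by positivity) m hm hsub (pm * Real.log m)
    (fun y _ => mul_le_mul_of_nonneg_right (hpmle y) hL.le)
  rw [← hV, hlog] at h1
  have hT : 1 ≤ Real.log 4 - Real.log t := by linarith
  have h2 : Real.log m ≤ K * (Real.log 4 - Real.log t) := by
    rw [hK, div_mul_eq_mul_div, le_div_iff₀ hpm]
    have := neg_abs_le V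
    nlinarith [abs_nonneg V]
  have h3 := aux_ball p G hG hp x (t / 4) (by positivity) m hm hsub (p x * Real.log m - c * K) (by
    intro y hy
    rw [Metric.mem_closedBall, dist_comm, dist_eq_norm] at hy
    have h4 : |p x - p y| ≤ c / (Real.log 4 - Real.log t) := by
      by_cases h0 : ‖x - y‖ = 0
      · have : x = y := by rwa [norm_eq_zero, sub_eq_zero] at h0
        rw [this, sub_self, abs_zero]
        apply div_nonneg hc.le; linarith
      · have h5 := hloc x y (by linarith)
        refine h5.trans ?_
        have : Real.log ‖x - y‖ ≤ Real.log (t / 4) :=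
          Real.log_le_log (lt_of_le_of_ne (norm_nonneg _) (Ne.symm h0)) hy
        apply div_le_div_of_nonneg_left hc.le (by linarith) (by linarith)
    have h6 : (p x - p y) * Real.log m ≤ c * K := by
      calc (p x - p y) * Real.log m ≤ c / (Real.log 4 - Real.log t) * (K * (Real.log 4 - Real.log t)) :=
            mul_le_mul ((le_abs_self _).trans h4) h2 hL.le (div_nonneg hc.le (by linarith))
        _ = c * K := by field_simp
    linarith)
  rw [← hV, hlog] at h3
  have h7 : p x * (Real.log m + n / p x * Real.log t) ≤ c * K + n * Real.log 4 + |V| := by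
    have := neg_abs_le V
    have : p x * (n / p x * Real.log t) = n * Real.log t := by field_simp
    rw [mul_add, this]; linarith
  have h8 : Real.log m + n / p x * Real.log t ≤ (c * K + n * Real.log 4 + |V|) / p x := by
    rw [le_div_iff₀ hpx]; linarith
  have h9 : (c * K + n * Real.log 4 + |V|) / p x ≤ (c * K + n * Real.log 4 + |V|) / pm :=
    div_le_div_of_nonneg_left (by positivity) hpm (hpmle x)
  linarith

lemma aux_unit {n : ℕ} (hn : 0 < n) (x : Rn n) : ∃ e : Rn n, ‖e‖ = 1 ∧
    ∀ s : ℝ, 0 ≤ s → ‖x + s • e‖ = ‖x‖ + s := by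
  by_cases hx : x = 0
  · refine ⟨EuclideanSpace.single ⟨0, hn⟩ 1, by simp, fun s hs => ?_⟩
    simp [hx, norm_smul, abs_of_nonneg hs]
  · have hx' : 0 < ‖x‖ := norm_pos_iff.2 hx
    refine ⟨‖x‖⁻¹ • x, by simp [norm_smul, hx'.ne'], fun s hs => ?_⟩
    have : x + s • ‖x‖⁻¹ • x = (1 + s * ‖x‖⁻¹) • x := by
      rw [add_smul, one_smul, smul_smul]
    rw [this, norm_smul, Real.norm_of_nonneg (by positivity)]
    field_simp

lemma aux_large {n : ℕ} (hn : 0 < n) (p : Rn n → ℝ) (Ci pinf : ℝ) (hCi : 0 < Ci)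
    (hpinf : ∀ x : Rn n, |p x - pinf| ≤ Ci / Real.log (Real.exp 1 + ‖x‖))
    (pm : ℝ) (hpm : 0 < pm) (hpmle : ∀ x, pm ≤ p x) (hpi : pm ≤ pinf) :
    ∃ C : ℝ, 0 ≤ C ∧ ∀ G : Rn n → ℝ≥0∞, ∫⁻ x, G x ^ p x ≤ 1 → ∀ x : Rn n, ∀ t : ℝ, 1 ≤ t →
      ∀ m : ℝ, 0 < m → (∀ y ∈ Metric.closedBall x t, ENNReal.ofReal m ≤ G y) →
      Real.log m ≤ C - n / pinf * Real.log t := by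
  set V := Real.log (volume (Metric.ball (0 : Rn n) 1)).toReal with hV
  have hpi0 : 0 < pinf := hpm.trans_le hpi
  have hl4 : 1 ≤ Real.log 4 := by
    rw [Real.le_log_iff_exp_le (by norm_num)]
    linarith [Real.exp_one_lt_d9]
  set c0 := n * Real.log 4 + |V| with hc0
  have hc00 : 0 ≤ c0 := by positivity
  set K := n / pinf + c0 / pm with hK
  have hK0 : 0 ≤ K := by positivity
  refine ⟨(Ci * K + c0) / pinf + K * Real.log 4, by positivity, ?_⟩
  intro G hG x t ht m hm hmG
  have ht0 : 0 < t := by linarith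
  have hp : ∀ x, 0 < p x := fun x => hpm.trans_le (hpmle x)
  have hlogt : 0 ≤ Real.log t := Real.log_nonneg ht
  have hlog : Real.log (t / 4) = Real.log t - Real.log 4 := Real.log_div ht0.ne' (by norm_num)
  obtain ⟨e, he, hxe⟩ := aux_unit hn x
  set z := x + (3 * t / 4) • e with hz
  have hnz : ‖z‖ = ‖x‖ + 3 * t / 4 := hxe _ (by positivity)
  have hzx : dist z x = 3 * t / 4 := by
    rw [dist_eq_norm, hz, add_sub_cancel_left, norm_smul, he, Real.norm_of_nonneg (by positivity), mul_one]
  have hsub : ∀ y ∈ Metric.closedBall z (t / 4), ENNReal.ofReal m ≤ G y := fun y hy =>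
    hmG y (Metric.closedBall_subset_closedBall' (by rw [hzx]; linarith) hy)
  set Λ := Real.log (Real.exp 1 + t / 2) with hΛ
  have hΛ1 : 1 ≤ Λ := by
    rw [hΛ, Real.le_log_iff_exp_le (by positivity)]; linarith
  have hΛt : Real.log t - Real.log 4 ≤ Λ := by
    rw [← hlog]; apply Real.log_le_log (by positivity); linarith [Real.exp_pos 1]
  have hpy : ∀ y ∈ Metric.closedBall z (t / 4), |p y - pinf| ≤ Ci / Λ := by
    intro y hy
    refine (hpinf y).trans ?_
    apply div_le_div_of_nonneg_left hCi.le (by linarith)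
    apply Real.log_le_log (by positivity)
    rw [Metric.mem_closedBall, dist_comm, dist_eq_norm] at hy
    have := norm_sub_norm_le z y
    linarith [norm_nonneg x]
  have hVa := neg_abs_le V
  have hnp : 0 ≤ (n : ℝ) / pinf := by positivity
  have hA : 0 ≤ (Ci * K + c0) / pinf := by positivity
  have hcp : 0 ≤ c0 / pm := by positivity
  by_cases hL1 : Real.log m < -K * Λ
  · have h1 : n / pinf * (Real.log t - Real.log 4) ≤ n / pinf * Λ := mul_le_mul_of_nonneg_left hΛt hnp
    have h2 : n / pinf * Λ ≤ K * Λ := mul_le_mul_of_nonneg_right (by rw [hK]; linarith) (by linarith)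
    have h3 : n / pinf * Real.log 4 ≤ K * Real.log 4 := mul_le_mul_of_nonneg_right (by rw [hK]; linarith) (by linarith)
    linarith
  have hL2 : Real.log m ≤ K * Λ := by
    by_contra hcon
    push Not at hcon
    have hL0 : 0 < Real.log m := lt_of_le_of_lt (by positivity) hcon
    have h1 := aux_ball p G hG hp z (t / 4) (by positivity) m hm hsub (pm * Real.log m)
      (fun y _ => mul_le_mul_of_nonneg_right (hpmle y) hL0.le)
    rw [← hV, hlog] at h1
    have h2 : Real.log m ≤ c0 / pm := by
      rw [le_div_iff₀ hpm, hc0]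
      have : 0 ≤ n * Real.log t := by positivity
      nlinarith
    have : K ≤ K * Λ := le_mul_of_one_le_right hK0 hΛ1
    linarith
  push Not at hL1
  have hLabs : |Real.log m| ≤ K * Λ := abs_le.2 ⟨by linarith, hL2⟩
  have h3 := aux_ball p G hG hp z (t / 4) (by positivity) m hm hsub (pinf * Real.log m - Ci * K) (by
    intro y hy
    have h6 : (pinf - p y) * Real.log m ≤ Ci * K := by
      calc (pinf - p y) * Real.log m ≤ |(pinf - p y) * Real.log m| := le_abs_self _
        _ = |p y - pinf| * |Real.log m| := by rw [abs_mul, abs_sub_comm]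
        _ ≤ Ci / Λ * (K * Λ) :=
            mul_le_mul (hpy y hy) hLabs (abs_nonneg _) (div_nonneg hCi.le (by linarith))
        _ = Ci * K := by field_simp
    linarith)
  rw [← hV, hlog] at h3
  have h7 : pinf * (Real.log m + n / pinf * Real.log t) ≤ Ci * K + c0 := by
    have : pinf * (n / pinf * Real.log t) = n * Real.log t := by field_simp
    rw [mul_add, this, hc0]; linarith
  have h8 : Real.log m + n / pinf * Real.log t ≤ (Ci * K + c0) / pinf := by
    rw [le_div_iff₀ hpi0]; linarith
  have : 0 ≤ K * Real.log 4 := by positivity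
  linarith

lemma aux_pinf {n : ℕ} (hn : 0 < n) (p : Rn n → ℝ) (Ci pinf : ℝ) (hCi : 0 < Ci)
    (hpinf : ∀ x : Rn n, |p x - pinf| ≤ Ci / Real.log (Real.exp 1 + ‖x‖))
    (pm pp : ℝ) (hpmle : ∀ x, pm ≤ p x) (hple : ∀ x, p x ≤ pp) : pm ≤ pinf ∧ pinf ≤ pp := by
  have key : ∀ ε : ℝ, 0 < ε → ∃ x : Rn n, |p x - pinf| ≤ ε := by
    intro ε hε
    refine ⟨EuclideanSpace.single ⟨0, hn⟩ (Real.exp (Ci / ε)), (hpinf _).trans ?_⟩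
    have h0 : 0 < Ci / ε := by positivity
    have : Ci / ε ≤ Real.log (Real.exp 1 + ‖(EuclideanSpace.single ⟨0, hn⟩ (Real.exp (Ci / ε)) : Rn n)‖) := by
      rw [Real.le_log_iff_exp_le (by positivity)]
      simp [Real.exp_nonneg]
    rw [div_le_iff₀ (by linarith)]
    rwa [div_le_iff₀ hε, mul_comm] at this
  constructor
  · apply _root_.le_of_forall_pos_le_add
    intro ε hε
    obtain ⟨x, hx⟩ := key ε hε
    linarith [(abs_le.1 hx).2, hpmle x]
  · apply _root_.le_of_forall_pos_le_add
    intro ε hε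
    obtain ⟨x, hx⟩ := key ε hε
    linarith [(abs_le.1 hx).1, hple x]

lemma aux_int_small (α δ : ℝ) (hα : 0 < α) (hδ : 0 < δ) :
    ∫⁻ t in Set.Ioc 0 δ, ENNReal.ofReal (t ^ (α - 1)) = ENNReal.ofReal (δ ^ α / α) := by
  have hi : IntervalIntegrable (fun t : ℝ => t ^ (α - 1)) volume 0 δ :=
    intervalIntegral.intervalIntegrable_rpow' (by linarith)
  rw [← ofReal_integral_eq_lintegral_ofReal]
  · rw [← intervalIntegral.integral_of_le hδ.le, integral_rpow (Or.inl (by linarith))]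
    simp [Real.zero_rpow hα.ne']
  · exact (intervalIntegrable_iff_integrableOn_Ioc_of_le hδ.le).1 hi
  · filter_upwards [ae_restrict_mem measurableSet_Ioc] with t ht
    exact Real.rpow_nonneg ht.1.le _

lemma aux_int_large (s δ : ℝ) (hs : 0 < s) (hδ : 0 < δ) :
    ∫⁻ t in Set.Ioi δ, ENNReal.ofReal (t ^ (-s - 1)) = ENNReal.ofReal (δ ^ (-s) / s) := by
  rw [← ofReal_integral_eq_lintegral_ofReal]
  · rw [integral_Ioi_rpow_of_lt (by linarith) hδ]
    congr 1
    rw [sub_add_cancel, neg_div_neg_eq]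
  · exact integrableOn_Ioi_rpow_of_lt (by linarith) hδ
  · filter_upwards [ae_restrict_mem measurableSet_Ioi] with t ht
    exact Real.rpow_nonneg (hδ.trans ht).le _

lemma aux_tail (α a C δ ε : ℝ) (hε : 0 < ε) (ha : α + ε ≤ a) (hδ : 0 < δ) (hC : 0 ≤ C)
    (mm : ℝ → ℝ≥0∞) (S : Set ℝ) (hS : S ⊆ Set.Ioi δ) (hSm : MeasurableSet S)
    (hmm : ∀ t ∈ S, mm t ≤ ENNReal.ofReal (C * t ^ (-a))) :
    ∫⁻ t in S, ENNReal.ofReal (t ^ (α - 1)) * mm t ≤ ENNReal.ofReal (C / ε * δ ^ (α - a)) := by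
  calc ∫⁻ t in S, ENNReal.ofReal (t ^ (α - 1)) * mm t
      ≤ ∫⁻ t in S, ENNReal.ofReal C * ENNReal.ofReal (t ^ (-(a - α) - 1)) := by
        refine setLIntegral_mono' hSm fun t ht => ?_
        have ht0 : 0 < t := hδ.trans (hS ht)
        refine (mul_le_mul_right (hmm t ht) _).trans (le_of_eq ?_)
        rw [← ENNReal.ofReal_mul (by positivity), ← ENNReal.ofReal_mul hC]
        congr 1
        rw [mul_left_comm, ← Real.rpow_add ht0]
        congr 2; ring
    _ ≤ ∫⁻ t in Set.Ioi δ, ENNReal.ofReal C * ENNReal.ofReal (t ^ (-(a - α) - 1)) :=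
        lintegral_mono_set hS
    _ = ENNReal.ofReal (C * (δ ^ (α - a) / (a - α))) := by
        rw [lintegral_const_mul' _ _ ENNReal.ofReal_ne_top, aux_int_large _ _ (by linarith) hδ,
          ENNReal.ofReal_mul hC, neg_sub]
    _ ≤ _ := by
        apply ENNReal.ofReal_le_ofReal
        rw [div_mul_eq_mul_div, ← mul_div_assoc]
        apply div_le_div_of_nonneg_left (by positivity) hε (by linarith)

lemma aux_head (α M δ : ℝ) (hα : 0 < α) (hδ : 0 < δ) (mm : ℝ → ℝ≥0∞)
    (hmm : ∀ t, 0 < t → mm t ≤ ENNReal.ofReal M) :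
    ∫⁻ t in Set.Ioc 0 δ, ENNReal.ofReal (t ^ (α - 1)) * mm t ≤ ENNReal.ofReal (1 / α * (δ ^ α * M)) := by
  calc ∫⁻ t in Set.Ioc 0 δ, ENNReal.ofReal (t ^ (α - 1)) * mm t
      ≤ ∫⁻ t in Set.Ioc 0 δ, ENNReal.ofReal (t ^ (α - 1)) * ENNReal.ofReal M := by
        refine setLIntegral_mono' measurableSet_Ioc fun t ht => ?_
        exact mul_le_mul_right (hmm t ht.1) _
    _ = ENNReal.ofReal (δ ^ α / α * M) := by
        rw [lintegral_mul_const' _ _ ENNReal.ofReal_ne_top, aux_int_small _ _ hα hδ,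
          ENNReal.ofReal_mul (by positivity)]
    _ = _ := by congr 1; ring

lemma aux_hed (α ε a b C M : ℝ) (hα : 0 < α) (hε : 0 < ε) (ha : α + ε ≤ a) (hb : α + ε ≤ b)
    (hC : 0 ≤ C) (hM : 0 < M) (mm : ℝ → ℝ≥0∞)
    (h0 : ∀ t, 0 < t → mm t ≤ ENNReal.ofReal M)
    (h1 : ∀ t, 0 < t → t ≤ 1 → mm t ≤ ENNReal.ofReal (C * t ^ (-a)))
    (h2 : ∀ t, 1 ≤ t → mm t ≤ ENNReal.ofReal (C * t ^ (-b))) :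
    (1 ≤ M → ∫⁻ t in Set.Ioi 0, ENNReal.ofReal (t ^ (α - 1)) * mm t
      ≤ ENNReal.ofReal ((1 / α + 2 * (C / ε)) * M ^ (1 - α / a))) ∧
    (M ≤ 1 → ∫⁻ t in Set.Ioi 0, ENNReal.ofReal (t ^ (α - 1)) * mm t
      ≤ ENNReal.ofReal ((1 / α + 2 * (C / ε)) * M ^ (1 - α / b))) := by
  have e1 : ∀ a, 0 < a → (M ^ (-1 / a)) ^ α * M = M ^ (1 - α / a) := by
    intro a ha
    rw [← Real.rpow_mul hM.le]
    nth_rewrite 2 [← Real.rpow_one M]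
    rw [← Real.rpow_add hM]
    congr 1; ring
  have e2 : ∀ a, 0 < a → (M ^ (-1 / a)) ^ (α - a) = M ^ (1 - α / a) := by
    intro a ha
    rw [← Real.rpow_mul hM.le]
    congr 1; field_simp; ring
  have ha0 : 0 < a := by linarith
  have hb0 : 0 < b := by linarith
  have hCε : 0 ≤ C / ε := by positivity
  constructor
  · intro hM1
    set δ := M ^ (-1 / a) with hδ
    have hδ0 : 0 < δ := Real.rpow_pos_of_pos hM _
    have hδ1 : δ ≤ 1 := Real.rpow_le_one_of_one_le_of_nonpos hM1 (by
      apply div_nonpos_of_nonpos_of_nonneg <;> linarith)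
    have hX : 1 ≤ M ^ (1 - α / a) := Real.one_le_rpow hM1 (by
      rw [sub_nonneg, div_le_one ha0]; linarith)
    have hu : Set.Ioi (0:ℝ) = Set.Ioc 0 δ ∪ (Set.Ioc δ 1 ∪ Set.Ioi 1) := by
      rw [Set.Ioc_union_Ioi_eq_Ioi hδ1, Set.Ioc_union_Ioi_eq_Ioi hδ0.le]
    rw [hu]
    refine (lintegral_union_le _ _ _).trans ?_
    refine (add_le_add_right (lintegral_union_le _ _ _) _).trans ?_
    have i1 := aux_head α M δ hα hδ0 mm h0
    have i2 := aux_tail α a C δ ε hε ha hδ0 hC mm (Set.Ioc δ 1) (fun t ht => ht.1) measurableSet_Ioc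
      (fun t ht => h1 t (hδ0.trans ht.1) ht.2)
    have i3 := aux_tail α b C 1 ε hε hb one_pos hC mm (Set.Ioi 1) (fun t ht => ht) measurableSet_Ioi
      (fun t ht => h2 t (le_of_lt ht))
    rw [e1 a ha0] at i1
    rw [e2 a ha0] at i2
    rw [Real.one_rpow] at i3
    refine (add_le_add i1 (add_le_add i2 i3)).trans ?_
    rw [← ENNReal.ofReal_add (by positivity) (by positivity),
      ← ENNReal.ofReal_add (by positivity) (by positivity)]
    apply ENNReal.ofReal_le_ofReal
    nlinarith
  · intro hM1
    set δ := M ^ (-1 / b) with hδ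
    have hδ0 : 0 < δ := Real.rpow_pos_of_pos hM _
    have hδ1 : 1 ≤ δ := Real.one_le_rpow_of_pos_of_le_one_of_nonpos hM hM1 (by
      apply div_nonpos_of_nonpos_of_nonneg <;> linarith)
    have hX : 0 ≤ M ^ (1 - α / b) := Real.rpow_nonneg hM.le _
    have hu : Set.Ioi (0:ℝ) = Set.Ioc 0 δ ∪ Set.Ioi δ := by
      rw [Set.Ioc_union_Ioi_eq_Ioi hδ0.le]
    rw [hu]
    refine (lintegral_union_le _ _ _).trans ?_
    have i1 := aux_head α M δ hα hδ0 mm h0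
    have i3 := aux_tail α b C δ ε hε hb hδ0 hC mm (Set.Ioi δ) (fun t ht => ht) measurableSet_Ioi
      (fun t ht => h2 t (hδ1.trans (le_of_lt ht)))
    rw [e1 b hb0] at i1
    rw [e2 b hb0] at i3
    refine (add_le_add i1 i3).trans ?_
    rw [← ENNReal.ofReal_add (by positivity) (by positivity)]
    apply ENNReal.ofReal_le_ofReal
    nlinarith [mul_nonneg hCε hX]

lemma aux_exp_rpow (m t C s : ℝ) (hm : 0 < m) (ht : 0 < t) (h : Real.log m ≤ C - s * Real.log t) :
    m ≤ Real.exp C * t ^ (-s) := by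
  rw [Real.rpow_def_of_pos ht, ← Real.exp_add, ← Real.log_le_iff_le_exp hm]
  linarith

/-- The Hedberg-type modular inequality. -/
lemma aux_core {n : ℕ} (hn : 0 < n)
    (α : ℝ) (hα0 : 0 < α)
    (p q : Rn n → ℝ)
    (hploc : LogHolderLocal p) (hpinf : LogHolderInfty p)
    (pm pp : ℝ) (hpm : 0 < pm) (hpmle : ∀ x, pm ≤ p x) (hple : ∀ x, p x ≤ pp)
    (hpp : pp * α < n)
    (hq : ∀ x, 1 / q x = 1 / p x - α / n) :
    ∃ C : ℝ, 0 < C ∧ ∀ G H : Rn n → ℝ≥0∞, ∫⁻ x, G x ^ p x ≤ 1 →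
      (∀ x, H x ≤ ∫⁻ t in Set.Ioi 0, ENNReal.ofReal (t ^ (α - 1)) *
        ⨅ y ∈ Metric.closedBall x t, G y) →
      ∫⁻ x, H x ^ q x ≤ ENNReal.ofReal C := by
  obtain ⟨Ci, hCi, pinf, hpi⟩ := hpinf
  obtain ⟨hpi1, hpi2⟩ := aux_pinf hn p Ci pinf hCi hpi pm pp hpmle hple
  obtain ⟨C1, hC1, hsmall⟩ := aux_small p hploc pm hpm hpmle
  obtain ⟨C2, hC2, hlarge⟩ := aux_large hn p Ci pinf hCi hpi pm hpm hpmle hpi1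
  have hn0 : (0:ℝ) < n := Nat.cast_pos.2 hn
  have hpp0 : 0 < pp := hpm.trans_le ((hpmle 0).trans (hple 0))
  have hpi0 : 0 < pinf := hpm.trans_le hpi1
  have hp : ∀ x, 0 < p x := fun x => hpm.trans_le (hpmle x)
  set ε := n / pp - α with hε
  have hε0 : 0 < ε := by rw [hε, sub_pos, lt_div_iff₀ hpp0]; linarith
  -- q facts
  set qp := 1 / (1 / pp - α / n) with hqp
  have hden : 0 < 1 / pp - α / n := by
    rw [sub_pos, div_lt_div_iff₀ hn0 hpp0]; linarith
  have hqp0 : 0 < qp := by positivity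
  have hden' : ∀ x, 1 / pp - α / n ≤ 1 / p x - α / n := fun x => by
    have := one_div_le_one_div_of_le (hp x) (hple x); linarith
  have hqpos : ∀ x, 0 < q x := fun x => by
    have : 0 < 1 / q x := by rw [hq]; linarith [hden' x]
    exact one_div_pos.1 this
  have hqle : ∀ x, q x ≤ qp := fun x => by
    have h : 1 / q x ≥ 1 / pp - α / n := by rw [hq]; exact hden' x
    have := one_div_le_one_div_of_le hden h
    rwa [one_div_one_div] at this
  have hqeq : ∀ x, q x * (1 - α * p x / n) = p x := fun x => by
    have h := hq x
    have := (hqpos x).ne'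
    have := (hp x).ne'
    field_simp at h ⊢
    linarith
  have hpq : ∀ x, p x ≤ q x := fun x => by
    have h1 := hqeq x
    have h2 : 0 ≤ q x * (α * p x / n) := by have := hqpos x; have := hp x; positivity
    linarith
  set s := pm * (1 - α * pp / n) with hs
  have hs1 : 0 < 1 - α * pp / n := by rw [sub_pos, div_lt_one hn0]; linarith
  have hs0 : 0 < s := by positivity
  set K := (n + 1 : ℝ) / s with hK
  have hK0 : 0 < K := by positivity
  set Dl := qp * (α / n) * Ci with hDl
  have hDl0 : 0 < Dl := by positivity
  set C := Real.exp (C1 + C2) with hC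
  have hC0 : 0 < C := Real.exp_pos _
  set D := 1 / α + 2 * (C / ε) + 1 with hD
  have hD1 : 1 ≤ D := by rw [hD]; have : 0 < 1 / α + 2 * (C / ε) := by positivity
                         linarith
  have hD0 : 0 < D := by linarith
  set B := D ^ qp with hB
  have hB0 : 0 < B := by positivity
  set E := Real.exp (K * Dl) with hE
  have hE1 : 1 ≤ E := Real.one_le_exp (by positivity)
  set J := ∫⁻ x : Rn n, ENNReal.ofReal ((1 + ‖x‖) ^ (-(n + 1 : ℝ))) with hJ
  have hJt : J < ⊤ := finite_integral_one_add_norm (by rw [finrank_euclideanSpace_fin]; linarith)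
  refine ⟨B * (E + J.toReal), by positivity, ?_⟩
  intro G H hG hH
  have key : ∀ x, H x ^ q x ≤ ENNReal.ofReal (B * E) * G x ^ p x +
      ENNReal.ofReal B * ENNReal.ofReal ((1 + ‖x‖) ^ (-(n + 1 : ℝ))) := by
    intro x
    have hmG : ∀ t, 0 < t → (⨅ y ∈ Metric.closedBall x t, G y) ≤ G x := fun t ht =>
      iInf₂_le x (Metric.mem_closedBall_self ht.le)
    by_cases hGtop : G x = ⊤
    · rw [hGtop, ENNReal.top_rpow_of_pos (hp x), ENNReal.mul_top (by simp; positivity), top_add]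
      exact le_top
    by_cases hG0 : G x = 0
    · have : H x = 0 := by
        refine le_antisymm ((hH x).trans ?_) zero_le
        rw [setLIntegral_congr_fun (g := fun _ => 0) measurableSet_Ioi]
        · simp
        · intro t ht
          have := hmG t ht
          rw [hG0, nonpos_iff_eq_zero] at this
          simp only [this, mul_zero]
      rw [this, ENNReal.zero_rpow_of_pos (hqpos x)]
      exact zero_le
    set M := (G x).toReal with hM
    have hM0 : 0 < M := ENNReal.toReal_pos hG0 hGtop
    have hGM : G x = ENNReal.ofReal M := (ENNReal.ofReal_toReal hGtop).symm
    -- bounds on infima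
    have hbd : ∀ t, 0 < t → ∀ W : ℝ, (∀ m : ℝ, 0 < m →
        (∀ y ∈ Metric.closedBall x t, ENNReal.ofReal m ≤ G y) → m ≤ W) →
        (⨅ y ∈ Metric.closedBall x t, G y) ≤ ENNReal.ofReal W := by
      intro t ht W hW
      set I := ⨅ y ∈ Metric.closedBall x t, G y with hI
      have hIt : I ≠ ⊤ := ne_top_of_le_ne_top hGtop (hmG t ht)
      by_cases hI0 : I = 0
      · rw [hI0]; exact zero_le
      rw [← ENNReal.ofReal_toReal hIt]
      apply ENNReal.ofReal_le_ofReal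
      apply hW _ (ENNReal.toReal_pos hI0 hIt)
      intro y hy
      rw [ENNReal.ofReal_toReal hIt]
      exact iInf₂_le y hy
    have ha : α + ε ≤ n / p x := by
      rw [hε, add_sub_cancel]; exact div_le_div_of_nonneg_left hn0.le (hp x) (hple x)
    have hb : α + ε ≤ n / pinf := by
      rw [hε, add_sub_cancel]; exact div_le_div_of_nonneg_left hn0.le hpi0 hpi2
    obtain ⟨hed1, hed2⟩ := aux_hed α ε (n / p x) (n / pinf) C M hα0 hε0 ha hb hC0.le hM0
      (fun t => ⨅ y ∈ Metric.closedBall x t, G y)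
      (fun t ht => (hmG t ht).trans hGM.le)
      (fun t ht ht1 => hbd t ht _ fun m hm hmy => aux_exp_rpow m t _ _ hm ht
        ((hsmall G hG x t ht ht1 m hm hmy).trans (by linarith)))
      (fun t ht1 => hbd t (by linarith) _ fun m hm hmy => aux_exp_rpow m t _ _ hm (by linarith)
        ((hlarge G hG x t ht1 m hm hmy).trans (by linarith)))
    have hraise : ∀ e : ℝ, H x ≤ ENNReal.ofReal ((1 / α + 2 * (C / ε)) * M ^ e) →
        H x ^ q x ≤ ENNReal.ofReal (B * M ^ (q x * e)) := by
      intro e he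
      have hMe : 0 < M ^ e := Real.rpow_pos_of_pos hM0 _
      have he' : H x ≤ ENNReal.ofReal (D * M ^ e) := he.trans (ENNReal.ofReal_le_ofReal
        (mul_le_mul_of_nonneg_right (by rw [hD]; linarith) hMe.le))
      refine (ENNReal.rpow_le_rpow he' (hqpos x).le).trans ?_
      rw [ENNReal.ofReal_rpow_of_pos (by positivity)]
      apply ENNReal.ofReal_le_ofReal
      rw [Real.mul_rpow hD0.le hMe.le, ← Real.rpow_mul hM0.le, mul_comm e]
      exact mul_le_mul_of_nonneg_right (Real.rpow_le_rpow_of_exponent_le hD1 (hqle x)) (by positivity)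
    have hGp : G x ^ p x = ENNReal.ofReal (M ^ p x) := by rw [hGM, ENNReal.ofReal_rpow_of_pos hM0]
    rcases le_total 1 M with hM1 | hM1
    · refine le_add_right ((hraise _ ((hH x).trans (hed1 hM1))).trans ?_)
      rw [hGp, ← ENNReal.ofReal_mul (by positivity)]
      apply ENNReal.ofReal_le_ofReal
      have : q x * (1 - α / (n / p x)) = p x := by
        rw [← hqeq x, hqeq x, div_div_eq_mul_div, hqeq x]
      rw [this]
      exact mul_le_mul_of_nonneg_right (le_mul_of_one_le_right hB0.le hE1) (by positivity)
    · have hr := hraise _ ((hH x).trans (hed2 hM1))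
      set ex := q x * (1 - α / (n / pinf)) with hex
      set Λ := Real.log (Real.exp 1 + ‖x‖) with hΛ
      have hXpos : 0 < Real.exp 1 + ‖x‖ := by positivity
      have hΛ1 : 1 ≤ Λ := by
        rw [hΛ, Real.le_log_iff_exp_le hXpos]; linarith [norm_nonneg x]
      have hlM : Real.log M ≤ 0 := Real.log_nonpos hM0.le hM1
      have hexs : s ≤ ex := by
        rw [hs, hex, div_div_eq_mul_div]
        apply mul_le_mul ((hpmle x).trans (hpq x)) _ hs1.le (hqpos x).le
        have : α * pinf / n ≤ α * pp / n := by gcongr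
        linarith
      by_cases hcase : -(K * Λ) ≤ Real.log M
      · refine le_add_right (hr.trans ?_)
        rw [hGp, ← ENNReal.ofReal_mul (by positivity)]
        apply ENNReal.ofReal_le_ofReal
        rw [mul_assoc]
        apply mul_le_mul_of_nonneg_left _ hB0.le
        rw [Real.rpow_def_of_pos hM0, Real.rpow_def_of_pos hM0, hE, ← Real.exp_add]
        apply Real.exp_le_exp.2
        have hdiff : ex - p x = q x * (α / n) * (p x - pinf) := by
          rw [hex, div_div_eq_mul_div]
          linear_combination hqeq x
        have hab : |ex - p x| ≤ Dl / Λ := by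
          rw [hdiff, abs_mul, abs_of_nonneg (by have := hqpos x; positivity), hDl, mul_div_assoc]
          exact mul_le_mul (mul_le_mul_of_nonneg_right (hqle x) (by positivity)) (hpi x)
            (abs_nonneg _) (by positivity)
        have hlab : |Real.log M| ≤ K * Λ := abs_le.2 ⟨hcase, by have : 0 ≤ K * Λ := by positivity
                                                                linarith⟩
        have : Real.log M * (ex - p x) ≤ K * Dl := by
          calc _ ≤ |Real.log M * (ex - p x)| := le_abs_self _
            _ = |Real.log M| * |ex - p x| := abs_mul _ _
            _ ≤ K * Λ * (Dl / Λ) := mul_le_mul hlab hab (abs_nonneg _) (by positivity)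
            _ = K * Dl := by field_simp
        linarith
      · push Not at hcase
        refine le_add_left (hr.trans ?_)
        rw [← ENNReal.ofReal_mul hB0.le]
        apply ENNReal.ofReal_le_ofReal
        apply mul_le_mul_of_nonneg_left _ hB0.le
        have h1 : M ^ ex ≤ (Real.exp 1 + ‖x‖) ^ (-(n + 1 : ℝ)) := by
          rw [Real.rpow_def_of_pos hM0, Real.rpow_def_of_pos hXpos]
          apply Real.exp_le_exp.2
          have hKs : K * s = n + 1 := by rw [hK]; field_simp
          calc Real.log M * ex ≤ Real.log M * s := mul_le_mul_of_nonpos_left hexs hlM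
            _ ≤ -(K * Λ) * s := mul_le_mul_of_nonneg_right hcase.le hs0.le
            _ = Λ * -(n + 1 : ℝ) := by rw [← hKs]; ring
        refine h1.trans (Real.rpow_le_rpow_of_nonpos (by positivity) ?_ (by linarith))
        have := Real.add_one_le_exp (1:ℝ)
        linarith
  calc ∫⁻ x, H x ^ q x ≤ ∫⁻ x, (ENNReal.ofReal (B * E) * G x ^ p x +
      ENNReal.ofReal B * ENNReal.ofReal ((1 + ‖x‖) ^ (-(n + 1 : ℝ)))) := lintegral_mono key
    _ = ENNReal.ofReal (B * E) * (∫⁻ x, G x ^ p x) + ENNReal.ofReal B * J := by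
        rw [lintegral_add_right _ (by fun_prop), lintegral_const_mul' _ _ ENNReal.ofReal_ne_top,
          lintegral_const_mul' _ _ ENNReal.ofReal_ne_top]
    _ ≤ ENNReal.ofReal (B * E) * 1 + ENNReal.ofReal B * ENNReal.ofReal J.toReal := by
        rw [ENNReal.ofReal_toReal hJt.ne]; exact add_le_add (mul_le_mul_right hG _) le_rfl
    _ = ENNReal.ofReal (B * (E + J.toReal)) := by
        rw [mul_one, ← ENNReal.ofReal_mul hB0.le, ← ENNReal.ofReal_add (by positivity) (by positivity),
          mul_add]

/-! ### The kernel representation -/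

/-- A smooth compactly supported radial bump. -/
noncomputable def bmp {n : ℕ} (w u : Rn n) : ℝ := Real.smoothTransition (2 - ‖u + w‖ ^ 2)

lemma bmp_contDiff {n : ℕ} (w : Rn n) : ContDiff ℝ (↑(⊤ : ℕ∞)) (bmp w) := by
  unfold bmp
  apply Real.smoothTransition.contDiff.comp
  apply contDiff_const.sub
  exact (contDiff_id.add contDiff_const).norm_sq ℝ

lemma bmp_compact {n : ℕ} (w : Rn n) : HasCompactSupport (bmp w) := by
  apply HasCompactSupport.intro (isCompact_closedBall (-w) 2)
  intro u hu
  rw [Metric.mem_closedBall, dist_eq_norm, sub_neg_eq_add, not_le] at hu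
  apply Real.smoothTransition.zero_of_nonpos
  nlinarith

lemma pderiv1_good {n : ℕ} (i : Fin n) (g : Rn n → ℝ)
    (h : HasCompactSupport g ∧ ContDiff ℝ (↑(⊤ : ℕ∞)) g) :
    HasCompactSupport (pderiv1 i g) ∧ ContDiff ℝ (↑(⊤ : ℕ∞)) (pderiv1 i g) := by
  refine ⟨?_, ?_⟩
  · exact h.1.fderiv_apply (𝕜 := ℝ) _
  · exact (h.2.fderiv_right (m := ↑(⊤ : ℕ∞)) (by simp)).clm_apply contDiff_const

lemma mderiv_ind {n : ℕ} (P : (Rn n → ℝ) → Prop) (hP : ∀ i g, P g → P (pderiv1 i g))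
    (γ : Fin n → ℕ) (g : Rn n → ℝ) (hg : P g) : P (mderiv γ g) := by
  unfold mderiv
  induction (List.finRange n) with
  | nil => exact hg
  | cons i l ih =>
    simp only [List.foldr_cons]
    generalize List.foldr (fun i h => (pderiv1 i)^[γ i] h) g l = h at ih
    induction γ i with
    | zero => exact ih
    | succ k ihk => rw [Function.iterate_succ_apply']; exact hP i _ ihk

lemma mderiv_rel {n : ℕ} (T : (Rn n → ℝ) → (Rn n → ℝ)) (hT : ∀ i g, pderiv1 i (T g) = T (pderiv1 i g))
    (γ : Fin n → ℕ) (g : Rn n → ℝ) : mderiv γ (T g) = T (mderiv γ g) := by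
  unfold mderiv
  induction (List.finRange n) with
  | nil => rfl
  | cons i l ih =>
    simp only [List.foldr_cons]
    rw [ih]
    generalize List.foldr (fun i h => (pderiv1 i)^[γ i] h) g l = h
    induction γ i with
    | zero => rfl
    | succ k ihk => rw [Function.iterate_succ_apply', Function.iterate_succ_apply', ihk, hT]

lemma mderiv_trans {n : ℕ} (c : ℝ) (w : Rn n) (γ : Fin n → ℕ) (g : Rn n → ℝ) :
    mderiv γ (fun u => c * g (u + w)) = fun u => c * mderiv γ g (u + w) := by
  apply mderiv_rel (fun g u => c * g (u + w))
  intro i g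
  funext x
  unfold pderiv1
  have : (fun u => c * g (u + w)) = c • (fun u => g (u + w)) := by
    funext u; simp
  rw [this, fderiv_const_smul_field, Pi.smul_apply, fderiv_comp_add_right]
  simp

lemma aux_FN (n N : ℕ) : ∃ A : ℝ, 0 < A ∧ ∀ w : Rn n, ‖w‖ ≤ 1 → ∃ φ ∈ FN n N,
    ∀ u, φ u = A⁻¹ * bmp 0 (u + w) := by
  have hbd : ∀ γ : Fin n → ℕ, ∃ b : ℝ, 0 ≤ b ∧ ∀ x : Rn n, (1 + ‖x‖) ^ N * |mderiv γ (bmp 0) x| ≤ b := by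
    intro γ
    obtain ⟨h1, h2⟩ := mderiv_ind (fun g : Rn n → ℝ => HasCompactSupport g ∧ ContDiff ℝ (↑(⊤ : ℕ∞)) g)
      pderiv1_good γ (bmp 0) ⟨bmp_compact 0, bmp_contDiff 0⟩
    have h3 : Continuous (fun x : Rn n => (1 + ‖x‖) ^ N * mderiv γ (bmp 0) x) := by
      have := h2.continuous
      fun_prop
    obtain ⟨b, hb⟩ := h3.bounded_above_of_compact_support (h1.mul_left)
    refine ⟨b, (norm_nonneg _).trans (hb 0), fun x => ?_⟩
    have := hb x
    rwa [norm_mul, Real.norm_of_nonneg (by positivity), Real.norm_eq_abs] at this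
  choose b hb0 hb using hbd
  set S := ∑ γ ∈ multiIndices n N, 2 ^ N * b γ with hS
  have hS0 : 0 ≤ S := Finset.sum_nonneg fun γ _ => mul_nonneg (by positivity) (hb0 γ)
  refine ⟨S + 1, by linarith, fun w hw => ?_⟩
  have hA : 0 < (S + 1)⁻¹ := by positivity
  have hc : HasCompactSupport (fun u => (S + 1)⁻¹ * bmp 0 (u + w)) := by
    have := bmp_compact w
    have h2 : (fun u => bmp 0 (u + w)) = bmp w := by funext u; simp [bmp]
    rw [← h2] at this
    exact this.mul_left
  have hd : ContDiff ℝ (↑(⊤ : ℕ∞)) (fun u => (S + 1)⁻¹ * bmp 0 (u + w)) := by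
    have := bmp_contDiff w
    have h2 : (fun u => bmp 0 (u + w)) = bmp w := by funext u; simp [bmp]
    rw [← h2] at this
    exact contDiff_const.mul this
  refine ⟨hc.toSchwartzMap hd, ?_, fun u => rfl⟩
  have hco : ⇑(hc.toSchwartzMap hd) = fun u => (S + 1)⁻¹ * bmp 0 (u + w) := rfl
  show (∑ γ ∈ multiIndices n N, ⨆ x : Rn n, (1 + ‖x‖) ^ N * |mderiv γ (⇑(hc.toSchwartzMap hd)) x|) ≤ 1
  rw [hco]
  calc _ ≤ ∑ γ ∈ multiIndices n N, (S + 1)⁻¹ * (2 ^ N * b γ) := by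
        apply Finset.sum_le_sum
        intro γ _
        apply ciSup_le
        intro x
        rw [mderiv_trans, abs_mul, abs_of_pos hA, mul_left_comm]
        apply mul_le_mul_of_nonneg_left _ hA.le
        have h1 : 1 + ‖x‖ ≤ 2 * (1 + ‖x + w‖) := by
          have h := norm_sub_le (x + w) w
          rw [add_sub_cancel_right] at h
          linarith [norm_nonneg (x + w)]
        calc (1 + ‖x‖) ^ N * |mderiv γ (bmp 0) (x + w)|
            ≤ (2 * (1 + ‖x + w‖)) ^ N * |mderiv γ (bmp 0) (x + w)| := by gcongr
          _ = 2 ^ N * ((1 + ‖x + w‖) ^ N * |mderiv γ (bmp 0) (x + w)|) := by rw [mul_pow]; ring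
          _ ≤ 2 ^ N * b γ := by gcongr; exact hb γ _
    _ = (S + 1)⁻¹ * S := by rw [← Finset.mul_sum]
    _ ≤ 1 := by rw [inv_mul_le_iff₀ (by linarith)]; linarith

lemma aux_grand (n N : ℕ) : ∃ A : ℝ, 0 < A ∧ ∀ (f : Rn n → ℝ) (x : Rn n) (t : ℝ), 0 < t →
    ENNReal.ofReal |∫ y, t ^ (-(n : ℝ)) * bmp 0 (t⁻¹ • (x - y)) * f y| ≤
      ENNReal.ofReal A * ⨅ y ∈ Metric.closedBall x t, grandMax n N f y := by
  obtain ⟨A, hA, h⟩ := aux_FN n N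
  refine ⟨A, hA, fun f x t ht => ?_⟩
  rw [mul_comm (ENNReal.ofReal A), ← ENNReal.div_le_iff_le_mul (by simp [hA]) (by simp)]
  refine le_iInf₂ fun z hz => ?_
  rw [ENNReal.div_le_iff_le_mul (by simp [hA]) (by simp), mul_comm]
  rw [Metric.mem_closedBall, dist_comm, dist_eq_norm] at hz
  obtain ⟨φ, hφ, hφe⟩ := h (t⁻¹ • (x - z)) (by
    rw [norm_smul, norm_inv, Real.norm_of_nonneg ht.le, inv_mul_le_iff₀ ht]; linarith)
  have h1 : ENNReal.ofReal |∫ y, t ^ (-(n : ℝ)) * φ (t⁻¹ • (z - y)) * f y| ≤ grandMax n N f z := by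
    unfold grandMax
    exact le_iSup₂_of_le t ht (le_iSup_of_le ⟨φ, hφ⟩ le_rfl)
  have h2 : ∫ y, t ^ (-(n : ℝ)) * bmp 0 (t⁻¹ • (x - y)) * f y =
      A * ∫ y, t ^ (-(n : ℝ)) * φ (t⁻¹ • (z - y)) * f y := by
    rw [← integral_const_mul]
    congr 1
    funext y
    rw [hφe, ← smul_add]
    have : z - y + (x - z) = x - y := by abel
    rw [this]
    field_simp
  rw [h2, abs_mul, abs_of_pos hA, ENNReal.ofReal_mul hA.le]
  exact mul_le_mul_right h1 _

lemma aux_kernel_int {n : ℕ} (α : ℝ) (hαn : α < n) :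
    IntegrableOn (fun t : ℝ => t ^ (α - n - 1) * Real.smoothTransition (2 - (t⁻¹) ^ 2)) (Set.Ioi 0) := by
  have hu : Set.Ioi (0:ℝ) = Set.Ioc 0 (1/2) ∪ Set.Ioi (1/2) :=
    (Set.Ioc_union_Ioi_eq_Ioi (by norm_num)).symm
  rw [hu]
  apply IntegrableOn.union
  · refine IntegrableOn.congr_fun (f := fun _ => (0:ℝ)) integrableOn_zero ?_ measurableSet_Ioc
    intro t ht
    have : Real.smoothTransition (2 - (t⁻¹) ^ 2) = 0 := by
      apply Real.smoothTransition.zero_of_nonpos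
      have : 2 ≤ t⁻¹ := by
        rw [le_inv_comm₀ (by norm_num) ht.1]; linarith [ht.2]
      nlinarith
    simp only [this, mul_zero]
  · have h := integrableOn_Ioi_rpow_of_lt (a := α - n - 1) (c := 1/2) (by linarith) (by norm_num)
    refine Integrable.mono' h ?_ ?_
    · apply Measurable.aestronglyMeasurable
      have := Real.smoothTransition.continuous.measurable
      exact (by fun_prop : Measurable fun t : ℝ => t ^ (α - n - 1)).mul (this.comp (by fun_prop))
    · filter_upwards [ae_restrict_mem measurableSet_Ioi] with t ht
      have ht0 : (0:ℝ) < t := lt_trans (by norm_num) ht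
      rw [norm_mul, Real.norm_of_nonneg (by positivity),
        Real.norm_of_nonneg (Real.smoothTransition.nonneg _)]
      exact mul_le_of_le_one_right (by positivity) (Real.smoothTransition.le_one _)

lemma aux_kernel_pos {n : ℕ} (α : ℝ) (hαn : α < n) :
    0 < ∫ t in Set.Ioi (0:ℝ), t ^ (α - n - 1) * Real.smoothTransition (2 - (t⁻¹) ^ 2) := by
  have h1 : ∫ t in Set.Ioi (1:ℝ), t ^ (α - n - 1) ≤
      ∫ t in Set.Ioi (0:ℝ), t ^ (α - n - 1) * Real.smoothTransition (2 - (t⁻¹) ^ 2) := by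
    calc ∫ t in Set.Ioi (1:ℝ), t ^ (α - n - 1)
        = ∫ t in Set.Ioi (1:ℝ), t ^ (α - n - 1) * Real.smoothTransition (2 - (t⁻¹) ^ 2) := by
          apply setIntegral_congr_fun measurableSet_Ioi
          intro t ht
          have ht1 : (1:ℝ) < t := ht
          have : Real.smoothTransition (2 - (t⁻¹) ^ 2) = 1 := by
            apply Real.smoothTransition.one_of_one_le
            have h1 : t⁻¹ ≤ 1 := inv_le_one_of_one_le₀ ht1.le
            have h0 : 0 ≤ t⁻¹ := by positivity
            nlinarith
          simp only [this, mul_one]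
      _ ≤ _ := by
          apply setIntegral_mono_set (aux_kernel_int α hαn)
          · filter_upwards [ae_restrict_mem measurableSet_Ioi] with t ht
            have ht0 : (0:ℝ) < t := ht
            have := Real.smoothTransition.nonneg (2 - (t⁻¹) ^ 2)
            simp only [Pi.zero_apply]
            positivity
          · exact (Set.Ioi_subset_Ioi zero_le_one).eventuallyLE
  refine lt_of_lt_of_le ?_ h1
  rw [integral_Ioi_rpow_of_lt (by linarith) one_pos, Real.one_rpow, sub_add_cancel]
  apply div_pos_of_neg_of_neg <;> linarith

lemma aux_kernel_scale {n : ℕ} (α : ℝ) (hαn : α < n) (u : Rn n) (hu : u ≠ 0) :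
    IntegrableOn (fun t : ℝ => t ^ (α - n - 1) * bmp 0 (t⁻¹ • u)) (Set.Ioi 0) ∧
    ∫ t in Set.Ioi (0:ℝ), t ^ (α - n - 1) * bmp 0 (t⁻¹ • u) =
      ‖u‖ ^ (α - n) * ∫ t in Set.Ioi (0:ℝ), t ^ (α - n - 1) * Real.smoothTransition (2 - (t⁻¹) ^ 2) := by
  have hr : 0 < ‖u‖ := norm_pos_iff.2 hu
  set g : ℝ → ℝ := fun t => t ^ (α - n - 1) * bmp 0 (t⁻¹ • u) with hg
  have hcomp : Set.EqOn (fun t => g (‖u‖ * t)) (fun t => ‖u‖ ^ (α - n - 1) *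
      (t ^ (α - n - 1) * Real.smoothTransition (2 - (t⁻¹) ^ 2))) (Set.Ioi 0) := by
    intro t ht
    have ht0 : (0:ℝ) < t := ht
    have hn : ‖(‖u‖ * t)⁻¹ • u + 0‖ = t⁻¹ := by
      rw [add_zero, norm_smul, Real.norm_of_nonneg (by positivity)]
      field_simp
    simp only [hg, bmp]
    rw [hn, Real.mul_rpow hr.le ht0.le, mul_assoc]
  constructor
  · have h := integrableOn_Ioi_comp_mul_left_iff g 0 hr
    rw [mul_zero] at h
    rw [← h]
    exact IntegrableOn.congr_fun ((aux_kernel_int α hαn).const_mul _) hcomp.symm measurableSet_Ioi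
  · have h := integral_comp_mul_left_Ioi g 0 hr
    rw [mul_zero, setIntegral_congr_fun measurableSet_Ioi hcomp, integral_const_mul, smul_eq_mul] at h
    have h2 : ‖u‖ ^ (α - n) = ‖u‖ * ‖u‖ ^ (α - n - 1) := by
      nth_rewrite 2 [← Real.rpow_one ‖u‖]
      rw [← Real.rpow_add hr]; congr 1; ring
    rw [h2, mul_assoc, h, mul_inv_cancel_left₀ hr.ne']

lemma aux_riesz {n : ℕ} (hn : 0 < n) (α : ℝ) (hαn : α < n) :
    ∃ c : ℝ, 0 < c ∧ ∀ f : Rn n → ℝ, Measurable f → ∀ x : Rn n,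
      ENNReal.ofReal (c * |riesz α f x|) ≤ ∫⁻ t in Set.Ioi 0, ENNReal.ofReal (t ^ (α - 1)) *
        ENNReal.ofReal |∫ y, t ^ (-(n : ℝ)) * bmp 0 (t⁻¹ • (x - y)) * f y| := by
  refine ⟨_, aux_kernel_pos α hαn, fun f hf x => ?_⟩
  set c := ∫ t in Set.Ioi (0:ℝ), t ^ (α - n - 1) * Real.smoothTransition (2 - (t⁻¹) ^ 2) with hc
  have hc0 : 0 < c := aux_kernel_pos α hαn
  by_cases hI : Integrable (fun y => ‖x - y‖ ^ (α - (n : ℝ)) * f y)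
  swap
  · rw [riesz, integral_undef hI]; simp
  have : Nonempty (Fin n) := ⟨⟨0, hn⟩⟩
  set Kf : Rn n → ℝ → ℝ := fun y t => t ^ (α - n - 1) * bmp 0 (t⁻¹ • (x - y)) * f y with hKf
  have hne : ∀ᵐ y : Rn n, x - y ≠ 0 := by
    have : ∀ᵐ y : Rn n, y ≠ x := by
      simp [ae_iff]
    filter_upwards [this] with y hy
    exact sub_ne_zero.2 (Ne.symm hy)
  have hmeas : Measurable (Function.uncurry Kf) := by
    have h1 : Measurable (bmp (0 : Rn n)) := (bmp_contDiff 0).continuous.measurable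
    have h2 : Measurable fun z : Rn n × ℝ => bmp 0 (z.2⁻¹ • (x - z.1)) := h1.comp (by fun_prop)
    have h3 : Measurable fun z : Rn n × ℝ => z.2 ^ (α - n - 1) := by fun_prop
    exact (h3.mul h2).mul (hf.comp measurable_fst)
  have hint : Integrable (Function.uncurry Kf) (volume.prod (volume.restrict (Set.Ioi 0))) := by
    rw [integrable_prod_iff hmeas.aestronglyMeasurable]
    constructor
    · filter_upwards [hne] with y hy
      exact (aux_kernel_scale α hαn (x - y) hy).1.mul_const (f y)
    · refine ((hI.norm).const_mul c).congr ?_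
      filter_upwards [hne] with y hy
      have h1 : ∫ t in Set.Ioi (0:ℝ), ‖Function.uncurry Kf (y, t)‖ =
          ∫ t in Set.Ioi (0:ℝ), (t ^ (α - n - 1) * bmp 0 (t⁻¹ • (x - y))) * ‖f y‖ := by
        apply setIntegral_congr_fun measurableSet_Ioi
        intro t ht
        have ht0 : (0:ℝ) < t := ht
        have hb : 0 ≤ bmp 0 (t⁻¹ • (x - y)) := Real.smoothTransition.nonneg _
        simp only [Function.uncurry_apply_pair, hKf]
        rw [norm_mul, Real.norm_of_nonneg (mul_nonneg (by positivity) hb)]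
      rw [h1, integral_mul_const, (aux_kernel_scale α hαn (x - y) hy).2, norm_mul,
        Real.norm_of_nonneg (Real.rpow_nonneg (norm_nonneg _) _)]
      ring
  have hswap := integral_integral_swap hint
  have hL : ∫ y, ∫ t in Set.Ioi (0:ℝ), Kf y t = c * riesz α f x := by
    rw [riesz, ← integral_const_mul]
    apply integral_congr_ae
    filter_upwards [hne] with y hy
    simp only [hKf]
    rw [integral_mul_const, (aux_kernel_scale α hαn (x - y) hy).2]
    ring
  rw [hL] at hswap
  have h1 : c * |riesz α f x| = ‖∫ t in Set.Ioi (0:ℝ), ∫ y, Kf y t‖ := by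
    rw [← hswap, norm_mul, Real.norm_of_nonneg hc0.le, Real.norm_eq_abs]
  rw [h1, ofReal_norm]
  refine (enorm_integral_le_lintegral_enorm _).trans ?_
  refine setLIntegral_mono' measurableSet_Ioi fun t ht => le_of_eq ?_
  have ht0 : (0:ℝ) < t := ht
  rw [← ENNReal.ofReal_mul (by positivity), ← ofReal_norm]
  congr 1
  have h2 : ∫ y, Kf y t = t ^ (α - 1) * ∫ y, t ^ (-(n : ℝ)) * bmp 0 (t⁻¹ • (x - y)) * f y := by
    rw [← integral_const_mul]
    congr 1
    funext y
    simp only [hKf]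
    have : t ^ (α - n - 1) = t ^ (α - 1) * t ^ (-(n : ℝ)) := by
      rw [← Real.rpow_add ht0]; congr 1; ring
    rw [this]; ring
  rw [h2, norm_mul, Real.norm_of_nonneg (by positivity), Real.norm_eq_abs]

theorem riesz_potential_Hp_to_Lq
    {n : ℕ} (hn : 0 < n)
    (α : ℝ) (hα0 : 0 < α) (hαn : α < n)
    (p q : Rn n → ℝ)
    (hploc : LogHolderLocal p) (hpinf : LogHolderInfty p)
    (pm pp : ℝ) (hpm : 0 < pm) (hpmle : ∀ x, pm ≤ p x) (hple : ∀ x, p x ≤ pp)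
    (hpp : pp * α < n)
    (hq : ∀ x, 1 / q x = 1 / p x - α / n) :
    ∃ N₀ : ℕ, ∀ N ≥ N₀, ∃ C > 0, ∀ f : Rn n → ℝ, Measurable f →
      varLpNorm q (riesz α f) ≤ ENNReal.ofReal C * hardyNorm p N f := by
  refine ⟨0, fun N _ => ?_⟩
  obtain ⟨C, hC, hcore⟩ := aux_core hn α hα0 p q hploc hpinf pm pp hpm hpmle hple hpp hq
  obtain ⟨A, hA, hgrand⟩ := aux_grand n N
  obtain ⟨c, hc, hriesz⟩ := aux_riesz hn α hαn
  -- q ≥ pm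
  have hqpm : ∀ x, pm ≤ q x := by
    intro x
    have hn0 : (0:ℝ) < n := Nat.cast_pos.2 hn
    have hpx : 0 < p x := hpm.trans_le (hpmle x)
    have h1 : 0 < 1 / p x - α / n := by
      rw [sub_pos, div_lt_div_iff₀ hn0 hpx]
      nlinarith [hple x]
    have hqx : 0 < q x := by rw [← hq x] at h1; exact one_div_pos.1 h1
    have h2 : 1 / q x ≤ 1 / p x := by
      rw [hq x]; have : 0 ≤ α / n := by positivity
      linarith
    exact (hpmle x).trans ((one_div_le_one_div hqx hpx).1 h2)
  set D := (max C 1) ^ (1 / pm) with hD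
  have hm1 : 1 ≤ max C 1 := le_max_right _ _
  have hD1 : 1 ≤ D := Real.one_le_rpow hm1 (by positivity)
  have hD0 : 0 < D := by linarith
  set R := D * (A / c) with hR
  have hR0 : 0 < R := by positivity
  refine ⟨R, hR0, fun f hf => ?_⟩
  unfold hardyNorm varLpNorm
  rw [mul_comm (ENNReal.ofReal R), ← ENNReal.div_le_iff_le_mul (by simp [hR0]) (by simp)]
  conv_rhs => unfold varLpNormE
  apply le_sInf
  rintro l ⟨lam, hlam, rfl, hint⟩
  rw [ENNReal.div_le_iff_le_mul (by simp [hR0]) (by simp), mul_comm, ← ENNReal.ofReal_mul hR0.le]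
  apply sInf_le
  refine ⟨R * lam, by positivity, rfl, ?_⟩
  have h := hcore (fun x => grandMax n N f x / ENNReal.ofReal lam)
    (fun x => ENNReal.ofReal (c / A * |riesz α f x| / lam)) hint (by
      intro x
      have h1 := hriesz f hf x
      have h2 : ENNReal.ofReal (c * |riesz α f x|) ≤ ENNReal.ofReal (A * lam) *
          ∫⁻ t in Set.Ioi 0, ENNReal.ofReal (t ^ (α - 1)) *
            ⨅ y ∈ Metric.closedBall x t, grandMax n N f y / ENNReal.ofReal lam := by
        refine h1.trans ?_
        rw [← lintegral_const_mul' _ _ ENNReal.ofReal_ne_top]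
        refine setLIntegral_mono' measurableSet_Ioi fun t ht => ?_
        rw [mul_left_comm]
        refine mul_le_mul_right ((hgrand f x t ht).trans ?_) _
        rw [ENNReal.ofReal_mul hA.le, mul_assoc]
        refine mul_le_mul_right ?_ _
        rw [mul_comm (ENNReal.ofReal lam), ← ENNReal.div_le_iff_le_mul (by simp [hlam]) (by simp)]
        refine le_iInf₂ fun y hy => ?_
        exact ENNReal.div_le_div_right (iInf₂_le y hy) _
      have h3 : c / A * |riesz α f x| / lam = c * |riesz α f x| / (A * lam) := by field_simp
      rw [h3, ENNReal.ofReal_div_of_pos (by positivity)]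
      rw [ENNReal.div_le_iff_le_mul (by left; simp; positivity) (by simp)]
      exact h2.trans (le_of_eq (mul_comm _ _)))
  calc ∫⁻ x, (ENNReal.ofReal |riesz α f x| / ENNReal.ofReal (R * lam)) ^ q x
      ≤ ∫⁻ x, ENNReal.ofReal (max C 1)⁻¹ * ENNReal.ofReal (c / A * |riesz α f x| / lam) ^ q x := by
        apply lintegral_mono
        intro x
        have hqx : 0 < q x := hpm.trans_le (hqpm x)
        have e : |riesz α f x| / (R * lam) = D⁻¹ * (c / A * |riesz α f x| / lam) := by
          rw [hR]; field_simp
        simp only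
        rw [← ENNReal.ofReal_div_of_pos (by positivity), e, ENNReal.ofReal_mul (by positivity),
          ENNReal.mul_rpow_of_nonneg _ _ hqx.le]
        refine mul_le_mul_left ?_ _
        rw [ENNReal.ofReal_rpow_of_pos (by positivity)]
        apply ENNReal.ofReal_le_ofReal
        rw [Real.inv_rpow hD0.le]
        apply inv_anti₀ (by positivity)
        calc max C 1 = D ^ pm := by
              rw [hD, ← Real.rpow_mul (by positivity)]
              field_simp
              simp
          _ ≤ D ^ q x := Real.rpow_le_rpow_of_exponent_le hD1 (hqpm x)
    _ = ENNReal.ofReal (max C 1)⁻¹ * ∫⁻ x, ENNReal.ofReal (c / A * |riesz α f x| / lam) ^ q x :=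
        lintegral_const_mul' _ _ ENNReal.ofReal_ne_top
    _ ≤ ENNReal.ofReal (max C 1)⁻¹ * ENNReal.ofReal C := mul_le_mul_right h _
    _ ≤ 1 := by
        rw [← ENNReal.ofReal_mul (by positivity), ENNReal.ofReal_le_one, inv_mul_le_iff₀ (by positivity),
          mul_one]
        exact le_max_left _ _
end
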